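/- Fix α ∈ (0,1) and ρ ∈ (0,1). On the probability space ((0,1), Borel sets, Gauss measure G), with ζ_i(x) = (a_i(x))^{1/3}, μ = E_G ζ_1 = (1/ln 2) Σ_{j=1}^∞ j^{1/3} ln(1 + 1/(j(j+2))), m = ⌊n^α⌋, k = ⌊n/(2m)⌋, Y_j = Σ_{i=1}^m ζ_{2m(j−1)+i}, and Wₙ° = Σ_{j=1}^k (Y_j − mμ) / √( Σ_{j=1}^k (Y_j − mμ)² ), the following holds: for every sequence (t_n) of nonnegative reals with t_n = o( n^{(1−α)ρ/(4+2ρ)} ), the ratio G(Wₙ° ≥ t_n) / (1 − Φ(t_n)) converges to 1 as n → ∞. -/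

import Mathlib

open MeasureTheory Filter Asymptotics Set

noncomputable section

/-- The standard normal distribution function `Φ`. -/
def stdGaussCDF (x : ℝ) : ℝ :=
  ∫ t in Set.Iic x, (Real.sqrt (2 * Real.pi))⁻¹ * Real.exp (-(t ^ 2) / 2)

/-- `m = ⌊n^α⌋`. -/
def blockLen (α : ℝ) (n : ℕ) : ℕ := ⌊(n : ℝ) ^ α⌋₊

/-- `k = ⌊n / (2m)⌋`. -/
def numBlocks (α : ℝ) (n : ℕ) : ℕ := n / (2 * blockLen α n)

/-- `Y_j = ∑_{i=1}^m η_{2m(j-1)+i}`. -/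
def blockSum {Ω : Type*} (η : ℕ → Ω → ℝ) (α : ℝ) (n j : ℕ) (ω : Ω) : ℝ :=
  ∑ i ∈ Finset.Icc 1 (blockLen α n), η (2 * blockLen α n * (j - 1) + i) ω

/-- The Gauss map `T(x) = 1/x - ⌊1/x⌋`. -/
def gaussMap (x : ℝ) : ℝ := Int.fract x⁻¹

/-- The `n`-th continued fraction digit `a_n(x)` (for `n ≥ 1`):
`a_1(x) = ⌊1/x⌋` and `a_{n+1}(x) = a_1(Tⁿ x)`. -/
def cfDigit (n : ℕ) (x : ℝ) : ℕ := ⌊(gaussMap^[n - 1] x)⁻¹⌋₊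

/-- The Gauss measure `G(E) = (1/ln 2) ∫_E 1/(1+x) dx` on `(0,1)`. -/
def gaussMeasure : MeasureTheory.Measure ℝ :=
  (MeasureTheory.volume.restrict (Set.Ioo (0 : ℝ) 1)).withDensity
    fun x => ENNReal.ofReal ((Real.log 2)⁻¹ * (1 + x)⁻¹)

/-- `ζ_i(x) = (a_i(x))^{1/3}`. -/
def cfRV (i : ℕ) (x : ℝ) : ℝ := (cfDigit i x : ℝ) ^ ((1 : ℝ) / 3)

/-- `μ = (1/ln 2) ∑_{j=1}^∞ j^{1/3} ln(1 + 1/(j(j+2)))`, the Gauss-measure mean of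
`ζ_1`. -/
def μcf : ℝ :=
  (Real.log 2)⁻¹ * ∑' j : ℕ,
    ((j : ℝ) + 1) ^ ((1 : ℝ) / 3) *
      Real.log (1 + (((j : ℝ) + 1) * ((j : ℝ) + 3))⁻¹)

/-- The self-normalized statistic
`Wₙ° = ∑_{j=1}^k (Y_j - mμ) / √(∑_{j=1}^k (Y_j - mμ)²)` built from the continued
fraction digits. -/
def Wcf (α : ℝ) (n : ℕ) (x : ℝ) : ℝ :=
  (∑ j ∈ Finset.Icc 1 (numBlocks α n),
      (blockSum cfRV α n j x - (blockLen α n : ℝ) * μcf)) /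
    Real.sqrt (∑ j ∈ Finset.Icc 1 (numBlocks α n),
      (blockSum cfRV α n j x - (blockLen α n : ℝ) * μcf) ^ 2)

open MeasureTheory Filter Asymptotics Set
noncomputable section
namespace CMD

lemma small_large {p : ℝ} (hp2 : 2 ≤ p) (hp3 : p ≤ 3) {F : ℝ} {K y : ℝ} (hK : 0 ≤ K)
    (h1 : |y| ≤ 1 → F ≤ K * |y| ^ 3) (h2 : 1 ≤ |y| → F ≤ K * |y| ^ 2) :
    F ≤ K * |y| ^ p := by
  rcases le_total |y| 1 with h | h
  · refine (h1 h).trans (mul_le_mul_of_nonneg_left ?_ hK)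
    rcases eq_or_lt_of_le (abs_nonneg y) with h0 | h0
    · rw [← h0]; rw [Real.zero_rpow (by linarith)]; norm_num
    · rw [← Real.rpow_natCast]
      exact Real.rpow_le_rpow_of_exponent_ge h0 h (by exact_mod_cast hp3)
  · refine (h2 h).trans (mul_le_mul_of_nonneg_left ?_ hK)
    rw [← Real.rpow_natCast]
    exact Real.rpow_le_rpow_of_exponent_le h (by exact_mod_cast hp2)

lemma exp_taylor2 (w : ℝ) : |Real.exp w - 1 - w - w ^ 2 / 2| ≤ |w| ^ 3 * Real.exp |w| := by
  have := Complex.norm_exp_sub_sum_le_norm_mul_exp (w : ℂ) 3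
  simp only [Finset.sum_range_succ, Finset.sum_range_zero] at this
  rw [Complex.norm_real, Real.norm_eq_abs] at this
  refine le_trans (le_of_eq ?_) this
  rw [← Real.norm_eq_abs, ← Complex.norm_real]
  congr 1
  push_cast
  simp [Nat.factorial]
  ring

lemma exp_taylor1 (w : ℝ) : |Real.exp w - 1 - w| ≤ |w| ^ 2 * Real.exp |w| := by
  have := Complex.norm_exp_sub_sum_le_norm_mul_exp (w : ℂ) 2
  simp only [Finset.sum_range_succ, Finset.sum_range_zero] at this
  rw [Complex.norm_real, Real.norm_eq_abs] at this
  refine le_trans (le_of_eq ?_) this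
  rw [← Real.norm_eq_abs, ← Complex.norm_real]
  congr 1
  push_cast
  simp [Nat.factorial]
  ring

lemma exp_taylor0 (w : ℝ) : |Real.exp w - 1| ≤ |w| * Real.exp |w| := by
  have := Complex.norm_exp_sub_sum_le_norm_mul_exp (w : ℂ) 1
  simp only [Finset.sum_range_succ, Finset.sum_range_zero] at this
  rw [Complex.norm_real, Real.norm_eq_abs] at this
  refine le_trans (le_of_eq ?_) (by simpa using this)
  rw [← Real.norm_eq_abs, ← Complex.norm_real]
  congr 1
  push_cast
  simp

lemma iexp2 (θ : ℝ) :
    ‖Complex.exp (Complex.I * θ) - 1 - Complex.I * θ + θ ^ 2 / 2‖ ≤ 4 * |θ| ^ 3 := by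
  rcases le_total |θ| 1 with h | h
  · have := Complex.norm_exp_sub_sum_le_norm_mul_exp (Complex.I * θ : ℂ) 3
    simp only [Finset.sum_range_succ, Finset.sum_range_zero] at this
    have hn : ‖(Complex.I * θ : ℂ)‖ = |θ| := by simp
    rw [hn] at this
    have e : Real.exp |θ| ≤ 4 := (Real.exp_le_exp.2 h).trans (by have := Real.exp_one_lt_d9; linarith)
    calc _ = _ := by
          congr 1
          simp [Nat.factorial, mul_pow]
          ring
      _ ≤ _ := this
      _ ≤ |θ| ^ 3 * 4 := by gcongr
      _ = _ := by ring
  · have h1 : ‖Complex.exp (Complex.I * θ)‖ = 1 := by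
      rw [mul_comm]; exact Complex.norm_exp_ofReal_mul_I θ
    calc _ ≤ ‖Complex.exp (Complex.I * θ)‖ + ‖(1:ℂ)‖ + ‖Complex.I * (θ:ℂ)‖ + ‖((θ:ℂ) ^ 2 / 2)‖ := by
          refine (norm_add_le _ _).trans ?_
          gcongr
          refine (norm_sub_le _ _).trans ?_
          gcongr
          exact norm_sub_le _ _
      _ = 1 + 1 + |θ| + |θ| ^ 2 / 2 := by rw [h1]; simp
      _ ≤ 4 * |θ| ^ 3 := by nlinarith [pow_le_pow_right₀ h (show 2 ≤ 3 by norm_num), pow_le_pow_right₀ h (show 1 ≤ 3 by norm_num), pow_le_pow_right₀ h (show 0 ≤ 3 by norm_num)]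

lemma iexp1 (θ : ℝ) :
    ‖Complex.exp (Complex.I * θ) - 1 - Complex.I * θ‖ ≤ 4 * |θ| ^ 2 := by
  rcases le_total |θ| 1 with h | h
  · have := Complex.norm_exp_sub_sum_le_norm_mul_exp (Complex.I * θ : ℂ) 2
    simp only [Finset.sum_range_succ, Finset.sum_range_zero] at this
    have hn : ‖(Complex.I * θ : ℂ)‖ = |θ| := by simp
    rw [hn] at this
    have e : Real.exp |θ| ≤ 4 := (Real.exp_le_exp.2 h).trans (by have := Real.exp_one_lt_d9; linarith)
    calc _ = _ := by
          congr 1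
          simp [Nat.factorial]
          ring
      _ ≤ _ := this
      _ ≤ |θ| ^ 2 * 4 := by gcongr
      _ = _ := by ring
  · have h1 : ‖Complex.exp (Complex.I * θ)‖ = 1 := by
      rw [mul_comm]; exact Complex.norm_exp_ofReal_mul_I θ
    calc _ ≤ ‖Complex.exp (Complex.I * θ)‖ + ‖(1:ℂ)‖ + ‖Complex.I * (θ:ℂ)‖ := by
          refine (norm_sub_le _ _).trans ?_
          gcongr
          exact norm_sub_le _ _
      _ = 1 + 1 + |θ| := by rw [h1]; simp
      _ ≤ 4 * |θ| ^ 2 := by nlinarith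

/-- universal constant -/
def KK : ℝ := 100 * Real.exp 4

lemma KK_ge : 100 ≤ KK := by
  unfold KK; nlinarith [Real.add_one_le_exp (4:ℝ)]

lemma E1 {p : ℝ} (hp2 : 2 ≤ p) (hp3 : p ≤ 3) {l : ℝ} (hl : 1 / 8 ≤ l) (hl' : l ≤ 3 / 2) (y : ℝ) :
    |Real.exp (y - l * y ^ 2) - 1 - y - (1 / 2 - l) * y ^ 2| ≤ KK * |y| ^ p := by
  apply small_large hp2 hp3 (by have := KK_ge; linarith)
  · intro hy
    set w := y - l * y ^ 2 with hw
    have hy2 : |y| ^ 2 ≤ |y| := by nlinarith [abs_nonneg y]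
    have hwb : |w| ≤ 5 / 2 * |y| := by
      calc |w| ≤ |y| + |l * y ^ 2| := abs_sub _ _
        _ = |y| + l * |y| ^ 2 := by rw [abs_mul, abs_of_nonneg (by linarith : 0 ≤ l), abs_pow]
        _ ≤ _ := by nlinarith
    have h1 := exp_taylor2 w
    have h2 : Real.exp |w| ≤ Real.exp 4 := Real.exp_le_exp.2 (by linarith)
    have h3 : |w| ^ 3 ≤ (5 / 2 * |y|) ^ 3 := by gcongr
    have hy3 : |y| ^ 4 ≤ |y| ^ 3 := pow_le_pow_of_le_one (abs_nonneg y) hy (by norm_num)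
    have h4 : |w ^ 2 / 2 - y ^ 2 / 2| ≤ 3 * |y| ^ 3 := by
      have : w ^ 2 / 2 - y ^ 2 / 2 = -(l * y ^ 3) + l ^ 2 / 2 * y ^ 4 := by rw [hw]; ring
      rw [this]
      calc _ ≤ |-(l * y ^ 3)| + |l ^ 2 / 2 * y ^ 4| := abs_add_le _ _
        _ = l * |y| ^ 3 + l ^ 2 / 2 * |y| ^ 4 := by
          rw [abs_neg, abs_mul, abs_mul, abs_of_nonneg (by linarith : 0 ≤ l),
            abs_of_nonneg (by positivity : 0 ≤ l ^ 2 / 2), abs_pow, abs_pow]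
        _ ≤ l * |y| ^ 3 + l ^ 2 / 2 * |y| ^ 3 := by gcongr
        _ ≤ _ := by
          have : l ^ 2 ≤ 9 / 4 := by nlinarith
          nlinarith [pow_nonneg (abs_nonneg y) 3]
    have h5 : Real.exp w - 1 - y - (1 / 2 - l) * y ^ 2 =
        (Real.exp w - 1 - w - w ^ 2 / 2) + (w ^ 2 / 2 - y ^ 2 / 2) := by rw [hw]; ring
    rw [h5]
    refine (abs_add_le _ _).trans ?_
    have h6 : |w| ^ 3 * Real.exp |w| ≤ (5 / 2 * |y|) ^ 3 * Real.exp 4 := by gcongr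
    have e4 : 1 ≤ Real.exp 4 := Real.one_le_exp (by norm_num)
    unfold KK
    nlinarith [pow_nonneg (abs_nonneg y) 3, mul_le_mul_of_nonneg_left e4 (pow_nonneg (abs_nonneg y) 3)]
  · intro hy
    have h1 : Real.exp (y - l * y ^ 2) ≤ Real.exp 4 := Real.exp_le_exp.2 (by nlinarith [sq_nonneg (y - 4), sq_nonneg y])
    have h0 := Real.exp_pos (y - l * y ^ 2)
    have hl2 : |1 / 2 - l| ≤ 1 := by rw [abs_le]; constructor <;> linarith
    have e4 : 1 ≤ Real.exp 4 := Real.one_le_exp (by norm_num)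
    calc _ ≤ |Real.exp (y - l * y ^ 2)| + |1| + |y| + |(1 / 2 - l) * y ^ 2| := by
          refine (abs_sub _ _).trans ?_
          gcongr
          refine (abs_sub _ _).trans ?_
          gcongr
          exact abs_sub _ _
      _ ≤ Real.exp 4 + 1 + |y| + 1 * |y| ^ 2 := by
          rw [abs_mul, abs_of_pos h0, abs_one, abs_pow]; gcongr
      _ ≤ _ := by
        unfold KK
        nlinarith [mul_le_mul_of_nonneg_left hy (Real.exp_pos 4).le, mul_le_mul_of_nonneg_left (one_le_pow₀ hy (n := 2)) (Real.exp_pos 4).le]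

lemma powexp (j : ℕ) (hj : j ≤ 3) {r : ℝ} (hr : r ≤ 1 / 2) : Real.exp r * |r| ^ j ≤ 6 := by
  rcases le_total 0 r with h | h
  · have h1 : |r| ≤ 1 := by rw [abs_of_nonneg h]; linarith
    have h2 : Real.exp r ≤ 4 := (Real.exp_le_exp.2 (by linarith : r ≤ 1)).trans (by have := Real.exp_one_lt_d9; linarith)
    have h3 := pow_le_one₀ (abs_nonneg r) h1 (n := j)
    have h4 := Real.exp_pos r
    nlinarith [pow_nonneg (abs_nonneg r) j]
  · have h1 := Real.pow_div_factorial_le_exp |r| (abs_nonneg r) j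
    have hf : (j.factorial : ℝ) ≤ 6 := by
      have := Nat.factorial_le hj
      have h6 : Nat.factorial 3 = 6 := rfl
      rw [h6] at this; exact_mod_cast this
    have hf0 : (0:ℝ) < j.factorial := by positivity
    rw [div_le_iff₀ hf0] at h1
    have h2 : Real.exp r * Real.exp |r| = 1 := by rw [abs_of_nonpos h, ← Real.exp_add]; simp
    calc Real.exp r * |r| ^ j ≤ Real.exp r * (Real.exp |r| * j.factorial) := by gcongr
      _ = j.factorial := by rw [← mul_assoc, h2, one_mul]
      _ ≤ 6 := hf

lemma rbound {y : ℝ} (hy : |y| ≤ 1) : |y - y ^ 2 / 2| ≤ 3 / 2 * |y| := by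
  calc |y - y ^ 2 / 2| ≤ |y| + |y ^ 2 / 2| := abs_sub _ _
    _ = |y| + |y| ^ 2 / 2 := by rw [abs_div, abs_pow]; norm_num
    _ ≤ _ := by nlinarith [abs_nonneg y]

lemma E2a {p : ℝ} (hp2 : 2 ≤ p) (hp3 : p ≤ 3) (y : ℝ) :
    |Real.exp (y - y ^ 2 / 2) * (y - y ^ 2 / 2) - y - y ^ 2 / 2| ≤ KK * |y| ^ p := by
  set r := y - y ^ 2 / 2 with hr
  have e4 : 1 ≤ Real.exp 4 := Real.one_le_exp (by norm_num)
  have hK := KK_ge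
  apply small_large hp2 hp3 (by linarith)
  · intro hy
    have hb := rbound hy
    rw [← hr] at hb
    have h1 := exp_taylor1 r
    have h2 : Real.exp |r| ≤ Real.exp 4 := Real.exp_le_exp.2 (by linarith)
    have hy3 : |y| ^ 4 ≤ |y| ^ 3 := pow_le_pow_of_le_one (abs_nonneg y) hy (by norm_num)
    have h5 : Real.exp r * r - y - y ^ 2 / 2 = r * (Real.exp r - 1 - r) + (-(y ^ 3) + y ^ 4 / 4) := by
      rw [hr]; ring
    rw [h5]
    have h6 : |(-(y ^ 3) + y ^ 4 / 4)| ≤ 2 * |y| ^ 3 := by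
      calc _ ≤ |-(y ^ 3)| + |y ^ 4 / 4| := abs_add_le _ _
        _ = |y| ^ 3 + |y| ^ 4 / 4 := by rw [abs_neg, abs_div, abs_pow, abs_pow]; norm_num
        _ ≤ _ := by nlinarith [pow_nonneg (abs_nonneg y) 3]
    have h7 : |r * (Real.exp r - 1 - r)| ≤ (3 / 2 * |y|) ^ 3 * Real.exp 4 := by
      rw [abs_mul]
      calc _ ≤ |r| * (|r| ^ 2 * Real.exp |r|) := by gcongr
        _ = |r| ^ 3 * Real.exp |r| := by ring
        _ ≤ _ := by gcongr
    refine (abs_add_le _ _).trans ?_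
    unfold KK
    nlinarith [pow_nonneg (abs_nonneg y) 3, mul_le_mul_of_nonneg_left e4 (pow_nonneg (abs_nonneg y) 3)]
  · intro hy
    have h1 := powexp 1 (by norm_num) (r := r) (by rw [hr]; nlinarith [sq_nonneg (y - 1)])
    have h2 : |y ^ 2 / 2| = |y| ^ 2 / 2 := by rw [abs_div, abs_pow]; norm_num
    have h3 : |Real.exp r * r| ≤ 6 := by
      rw [abs_mul, abs_of_pos (Real.exp_pos r)]; simpa using h1
    calc _ ≤ |Real.exp r * r| + |y| + |y ^ 2 / 2| := by
          refine (abs_sub _ _).trans ?_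
          gcongr
          exact abs_sub _ _
      _ ≤ _ := by nlinarith

lemma E2b {p : ℝ} (hp2 : 2 ≤ p) (hp3 : p ≤ 3) (y : ℝ) :
    |Real.exp (y - y ^ 2 / 2) * (y - y ^ 2 / 2) ^ 2 - y ^ 2| ≤ KK * |y| ^ p := by
  set r := y - y ^ 2 / 2 with hr
  have e4 : 1 ≤ Real.exp 4 := Real.one_le_exp (by norm_num)
  have hK := KK_ge
  apply small_large hp2 hp3 (by linarith)
  · intro hy
    have hb := rbound hy
    rw [← hr] at hb
    have h1 := exp_taylor0 r
    have h2 : Real.exp |r| ≤ Real.exp 4 := Real.exp_le_exp.2 (by linarith)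
    have hy3 : |y| ^ 4 ≤ |y| ^ 3 := pow_le_pow_of_le_one (abs_nonneg y) hy (by norm_num)
    have h5 : Real.exp r * r ^ 2 - y ^ 2 = r ^ 2 * (Real.exp r - 1) + (-(y ^ 3) + y ^ 4 / 4) := by
      rw [hr]; ring
    rw [h5]
    have h6 : |(-(y ^ 3) + y ^ 4 / 4)| ≤ 2 * |y| ^ 3 := by
      calc _ ≤ |-(y ^ 3)| + |y ^ 4 / 4| := abs_add_le _ _
        _ = |y| ^ 3 + |y| ^ 4 / 4 := by rw [abs_neg, abs_div, abs_pow, abs_pow]; norm_num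
        _ ≤ _ := by nlinarith [pow_nonneg (abs_nonneg y) 3]
    have h7 : |r ^ 2 * (Real.exp r - 1)| ≤ (3 / 2 * |y|) ^ 3 * Real.exp 4 := by
      rw [abs_mul, abs_pow]
      calc _ ≤ |r| ^ 2 * (|r| * Real.exp |r|) := by gcongr
        _ = |r| ^ 3 * Real.exp |r| := by ring
        _ ≤ _ := by gcongr
    refine (abs_add_le _ _).trans ?_
    unfold KK
    nlinarith [pow_nonneg (abs_nonneg y) 3, mul_le_mul_of_nonneg_left e4 (pow_nonneg (abs_nonneg y) 3)]
  · intro hy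
    have h1 := powexp 2 (by norm_num) (r := r) (by rw [hr]; nlinarith [sq_nonneg (y - 1)])
    have h3 : |Real.exp r * r ^ 2| ≤ 6 := by
      rw [abs_mul, abs_of_pos (Real.exp_pos r), abs_pow]; exact h1
    calc _ ≤ |Real.exp r * r ^ 2| + |y ^ 2| := abs_sub _ _
      _ = |Real.exp r * r ^ 2| + |y| ^ 2 := by rw [abs_pow y]
      _ ≤ _ := by nlinarith

lemma E2c {p : ℝ} (hp2 : 2 ≤ p) (hp3 : p ≤ 3) (y : ℝ) :
    Real.exp (y - y ^ 2 / 2) * |y - y ^ 2 / 2| ^ 3 ≤ KK * |y| ^ p := by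
  set r := y - y ^ 2 / 2 with hr
  have e4 : 1 ≤ Real.exp 4 := Real.one_le_exp (by norm_num)
  have hK := KK_ge
  apply small_large hp2 hp3 (by linarith)
  · intro hy
    have hb := rbound hy
    rw [← hr] at hb
    have h2 : Real.exp r ≤ Real.exp 4 := Real.exp_le_exp.2 (by linarith [le_abs_self r])
    calc _ ≤ Real.exp 4 * (3 / 2 * |y|) ^ 3 := by gcongr
      _ ≤ _ := by unfold KK; nlinarith [mul_nonneg (Real.exp_pos 4).le (pow_nonneg (abs_nonneg y) 3)]
  · intro hy
    have h1 := powexp 3 (by norm_num) (r := r) (by rw [hr]; nlinarith [sq_nonneg (y - 1)])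
    nlinarith

/-- main complex expansion -/
lemma E3 {p : ℝ} (hp2 : 2 ≤ p) (hp3 : p ≤ 3) (s y : ℝ) :
    ‖Complex.exp ((1 + Complex.I * s) * ((y - y ^ 2 / 2 : ℝ) : ℂ)) - 1 - (1 + Complex.I * s) * y
      - ((Complex.I * s - s ^ 2) / 2) * y ^ 2‖ ≤ 4 * KK * (1 + |s|) ^ 3 * |y| ^ p := by
  have ha := E2a hp2 hp3 y
  have hb := E2b hp2 hp3 y
  have hc := E2c hp2 hp3 y
  have h0 := E1 hp2 hp3 (l := 1 / 2) (by norm_num) (by norm_num) y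
  have e0 : y - 1 / 2 * y ^ 2 = y - y ^ 2 / 2 := by ring
  rw [e0] at h0
  have hq := iexp2 (s * (y - y ^ 2 / 2))
  set r := y - y ^ 2 / 2 with hr
  have hK := KK_ge
  have hy0 : 0 ≤ |y| ^ p := Real.rpow_nonneg (abs_nonneg y) p
  have key : Complex.exp ((1 + Complex.I * s) * (r : ℂ)) - 1 - (1 + Complex.I * s) * y
      - ((Complex.I * s - s ^ 2) / 2) * y ^ 2 =
      (Real.exp r : ℂ) * (Complex.exp (Complex.I * ((s * r : ℝ) : ℂ)) - 1 - Complex.I * ((s * r : ℝ) : ℂ)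
        + ((s * r : ℝ) : ℂ) ^ 2 / 2)
      + ((Real.exp r - 1 - y - (1 / 2 - 1 / 2) * y ^ 2 : ℝ) : ℂ)
      + Complex.I * s * ((Real.exp r * r - y - y ^ 2 / 2 : ℝ) : ℂ)
      - (s : ℂ) ^ 2 / 2 * ((Real.exp r * r ^ 2 - y ^ 2 : ℝ) : ℂ) := by
    have : Complex.exp ((1 + Complex.I * s) * (r : ℂ)) =
        (Real.exp r : ℂ) * Complex.exp (Complex.I * ((s * r : ℝ) : ℂ)) := by
      rw [Complex.ofReal_exp, ← Complex.exp_add]; congr 1; push_cast; ring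
    rw [this]; push_cast; ring
  rw [key]
  have n1 : ‖(Real.exp r : ℂ) * (Complex.exp (Complex.I * ((s * r : ℝ) : ℂ)) - 1 - Complex.I * ((s * r : ℝ) : ℂ)
        + ((s * r : ℝ) : ℂ) ^ 2 / 2)‖ ≤ 4 * |s| ^ 3 * (KK * |y| ^ p) := by
    rw [norm_mul, Complex.norm_real, Real.norm_eq_abs, abs_of_pos (Real.exp_pos r)]
    calc _ ≤ Real.exp r * (4 * |s * r| ^ 3) := by gcongr
      _ = 4 * |s| ^ 3 * (Real.exp r * |r| ^ 3) := by rw [abs_mul]; ring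
      _ ≤ _ := by gcongr
  have n2 : ‖((Real.exp r - 1 - y - (1 / 2 - 1 / 2) * y ^ 2 : ℝ) : ℂ)‖ ≤ KK * |y| ^ p := by
    rw [Complex.norm_real]; exact h0
  have n3 : ‖Complex.I * s * ((Real.exp r * r - y - y ^ 2 / 2 : ℝ) : ℂ)‖ ≤ |s| * (KK * |y| ^ p) := by
    rw [norm_mul, norm_mul, Complex.norm_I, Complex.norm_real, Complex.norm_real, one_mul, Real.norm_eq_abs]
    gcongr; exact ha
  have n4 : ‖(s : ℂ) ^ 2 / 2 * ((Real.exp r * r ^ 2 - y ^ 2 : ℝ) : ℂ)‖ ≤ |s| ^ 2 / 2 * (KK * |y| ^ p) := by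
    rw [norm_mul, norm_div, norm_pow, Complex.norm_real, Complex.norm_real, Real.norm_eq_abs]
    simp only [RCLike.norm_ofNat]
    gcongr; exact hb
  have hA : 0 ≤ KK * |y| ^ p := by positivity
  calc _ ≤ 4 * |s| ^ 3 * (KK * |y| ^ p) + KK * |y| ^ p + |s| * (KK * |y| ^ p)
        + |s| ^ 2 / 2 * (KK * |y| ^ p) := by
        refine (norm_sub_le _ _).trans (add_le_add ((norm_add_le _ _).trans (add_le_add ((norm_add_le _ _).trans (add_le_add n1 n2)) n3)) n4)
    _ = (4 * |s| ^ 3 + 1 + |s| + |s| ^ 2 / 2) * (KK * |y| ^ p) := by ring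
    _ ≤ (4 * (1 + |s|) ^ 3) * (KK * |y| ^ p) := by
        gcongr; nlinarith [abs_nonneg s, sq_nonneg (|s|)]
    _ = _ := by ring

lemma E4 {p : ℝ} (hp2 : 2 ≤ p) (hp3 : p ≤ 3) (s y : ℝ) :
    ‖Complex.exp (Complex.I * (s * y : ℝ)) - 1 - (Complex.I * s) * y
      - (-(s : ℂ) ^ 2 / 2) * y ^ 2‖ ≤ 4 * (1 + |s|) ^ 3 * |y| ^ p := by
  have e : Complex.exp (Complex.I * (s * y : ℝ)) - 1 - (Complex.I * s) * y
      - (-(s : ℂ) ^ 2 / 2) * y ^ 2 = Complex.exp (Complex.I * (s * y : ℝ)) - 1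
      - Complex.I * (s * y : ℝ) + ((s * y : ℝ) : ℂ) ^ 2 / 2 := by push_cast; ring
  rw [e]
  have hs := abs_nonneg s
  apply small_large hp2 hp3 (by positivity)
  · intro _
    refine (iexp2 _).trans ?_
    rw [abs_mul, mul_pow, ← mul_assoc]
    gcongr; linarith
  · intro hy
    have h1 : ‖Complex.exp (Complex.I * (s * y : ℝ))‖ = 1 := by
      rw [mul_comm]; exact Complex.norm_exp_ofReal_mul_I _
    calc _ ≤ ‖Complex.exp (Complex.I * (s * y : ℝ))‖ + ‖(1:ℂ)‖ + ‖Complex.I * (s * y : ℝ)‖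
          + ‖((s * y : ℝ) : ℂ) ^ 2 / 2‖ := by
          refine (norm_add_le _ _).trans ?_
          gcongr
          refine (norm_sub_le _ _).trans ?_
          gcongr
          exact norm_sub_le _ _
      _ = 1 + 1 + |s| * |y| + |s| ^ 2 * |y| ^ 2 / 2 := by
          rw [h1]; simp [abs_mul, mul_pow]
      _ ≤ 4 * (1 + |s|) ^ 3 * |y| ^ 2 := by
          have hy1 : 1 ≤ |y| ^ 2 := one_le_pow₀ hy
          have hy2 : |y| ≤ |y| ^ 2 := by nlinarith
          have : |s| * |y| ≤ |s| * |y| ^ 2 := by gcongr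
          have h3 : (2 + |s| + |s| ^ 2 / 2) * |y| ^ 2 ≤ 4 * (1 + |s|) ^ 3 * |y| ^ 2 := by
            gcongr; nlinarith [pow_nonneg hs 3, pow_nonneg hs 2]
          nlinarith

lemma E5 {p : ℝ} (hp2 : 2 ≤ p) (hp3 : p ≤ 3) (s y : ℝ) :
    ‖Complex.exp (Complex.I * (s * y ^ 2 : ℝ)) - 1 - 0 * y
      - (Complex.I * s) * y ^ 2‖ ≤ 4 * (1 + |s|) ^ 3 * |y| ^ p := by
  have e : Complex.exp (Complex.I * (s * y ^ 2 : ℝ)) - 1 - 0 * y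
      - (Complex.I * s) * y ^ 2 = Complex.exp (Complex.I * (s * y ^ 2 : ℝ)) - 1
      - Complex.I * (s * y ^ 2 : ℝ) := by push_cast; ring
  rw [e]
  have hs := abs_nonneg s
  apply small_large hp2 hp3 (by positivity)
  · intro hy
    refine (iexp1 _).trans ?_
    rw [abs_mul, abs_pow]
    have hy3 : |y| ^ 4 ≤ |y| ^ 3 := pow_le_pow_of_le_one (abs_nonneg y) hy (by norm_num)
    calc 4 * (|s| * |y| ^ 2) ^ 2 = 4 * |s| ^ 2 * |y| ^ 4 := by ring
      _ ≤ 4 * |s| ^ 2 * |y| ^ 3 := by gcongr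
      _ ≤ _ := by gcongr; nlinarith [pow_nonneg hs 3, pow_nonneg hs 2]
  · intro hy
    have h1 : ‖Complex.exp (Complex.I * (s * y ^ 2 : ℝ))‖ = 1 := by
      rw [mul_comm]; exact Complex.norm_exp_ofReal_mul_I _
    calc _ ≤ ‖Complex.exp (Complex.I * (s * y ^ 2 : ℝ))‖ + ‖(1:ℂ)‖ + ‖Complex.I * (s * y ^ 2 : ℝ)‖ := by
          refine (norm_sub_le _ _).trans ?_
          gcongr
          exact norm_sub_le _ _
      _ = 1 + 1 + |s| * |y| ^ 2 := by
          rw [h1]; simp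
      _ ≤ 4 * (1 + |s|) ^ 3 * |y| ^ 2 := by
          have hy1 : 1 ≤ |y| ^ 2 := one_le_pow₀ hy
          have h3 : (2 + |s|) * |y| ^ 2 ≤ 4 * (1 + |s|) ^ 3 * |y| ^ 2 := by
            gcongr; nlinarith [pow_nonneg hs 3, pow_nonneg hs 2]
          nlinarith

end CMD
end

open MeasureTheory Filter Asymptotics Set
noncomputable section
namespace CMD

structure Good (p C : ℝ) (ν : Measure ℝ) : Prop where
  prob : IsProbabilityMeasure ν
  i1 : Integrable (fun x : ℝ => x) ν
  m1 : ∫ x, x ∂ν = 0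
  i2 : Integrable (fun x : ℝ => x ^ 2) ν
  m2 : ∫ x, x ^ 2 ∂ν = 1
  ip : Integrable (fun x : ℝ => |x| ^ p) ν
  mp : ∫ x, |x| ^ p ∂ν ≤ C

lemma Good.C_nonneg {p C : ℝ} {ν : Measure ℝ} (h : Good p C ν) : 0 ≤ C :=
  le_trans (integral_nonneg fun x => by positivity) h.mp

lemma expand_int {𝕜 : Type*} [RCLike 𝕜] {p C : ℝ} {ν : Measure ℝ} (h : Good p C ν)
    {Ψ : ℝ → 𝕜} (hΨ : Measurable Ψ) {A B : 𝕜} {K : ℝ}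
    (hE : ∀ y : ℝ, ‖Ψ y - 1 - A * (y : 𝕜) - B * (y : 𝕜) ^ 2‖ ≤ K * |y| ^ p) (b : ℝ) :
    Integrable (fun x => Ψ (b * x)) ν ∧
    ‖∫ x, Ψ (b * x) ∂ν - 1 - B * (b : 𝕜) ^ 2‖ ≤ K * C * |b| ^ p := by
  have := h.prob
  have hK : 0 ≤ K := by
    have := (norm_nonneg _).trans (hE 1)
    simpa using this
  have i0 : Integrable (fun x : ℝ => (1 : 𝕜)) ν := integrable_const _
  have i1 : Integrable (fun x : ℝ => A * ((b * x : ℝ) : 𝕜)) ν :=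
    ((h.i1.const_mul b).ofReal (𝕜 := 𝕜)).const_mul A
  have i2 : Integrable (fun x : ℝ => B * ((b * x : ℝ) : 𝕜) ^ 2) ν := by
    have := ((h.i2.const_mul (b ^ 2)).ofReal (𝕜 := 𝕜)).const_mul B
    refine this.congr (ae_of_all _ fun x => ?_)
    simp only
    push_cast; ring
  have hb : Integrable (fun x => K * |b| ^ p * |x| ^ p) ν := h.ip.const_mul _
  have hbd : ∀ x : ℝ, ‖Ψ (b * x) - 1 - A * ((b * x : ℝ) : 𝕜) - B * ((b * x : ℝ) : 𝕜) ^ 2‖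
      ≤ K * |b| ^ p * |x| ^ p := by
    intro x
    refine (hE (b * x)).trans (le_of_eq ?_)
    rw [abs_mul, Real.mul_rpow (abs_nonneg _) (abs_nonneg _)]; ring
  have hm : Measurable fun x : ℝ => Ψ (b * x) := hΨ.comp (measurable_const.mul measurable_id)
  have iD : Integrable (fun x : ℝ => Ψ (b * x) - 1 - A * ((b * x : ℝ) : 𝕜)
      - B * ((b * x : ℝ) : 𝕜) ^ 2) ν := by
    refine hb.mono' ?_ (ae_of_all _ hbd)
    exact ((hm.aestronglyMeasurable.sub i0.1).sub i1.1).sub i2.1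
  have iΨ : Integrable (fun x => Ψ (b * x)) ν := by
    refine (((iD.add i2).add i1).add i0).congr (ae_of_all _ fun x => ?_)
    simp
  refine ⟨iΨ, ?_⟩
  have e : ∫ x, (Ψ (b * x) - 1 - A * ((b * x : ℝ) : 𝕜) - B * ((b * x : ℝ) : 𝕜) ^ 2) ∂ν
      = ∫ x, Ψ (b * x) ∂ν - 1 - B * (b : 𝕜) ^ 2 := by
    have j1 : Integrable (fun x : ℝ => Ψ (b * x) - 1) ν := iΨ.sub i0
    have j2 : Integrable (fun x : ℝ => Ψ (b * x) - 1 - A * ((b * x : ℝ) : 𝕜)) ν := j1.sub i1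
    rw [integral_sub j2 i2, integral_sub j1 i1, integral_sub iΨ i0]
    have e1 : ∫ x, A * ((b * x : ℝ) : 𝕜) ∂ν = 0 := by
      rw [integral_const_mul, integral_ofReal, integral_const_mul, h.m1]; simp
    have e2 : ∫ x, B * ((b * x : ℝ) : 𝕜) ^ 2 ∂ν = B * (b : 𝕜) ^ 2 := by
      rw [integral_const_mul]
      congr 1
      have : ∀ x : ℝ, ((b * x : ℝ) : 𝕜) ^ 2 = ((b ^ 2 * x ^ 2 : ℝ) : 𝕜) := by
        intro x; push_cast; ring
      simp_rw [this]
      rw [integral_ofReal, integral_const_mul, h.m2]; simp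
    rw [e1, e2]; simp
  rw [← e]
  refine (norm_integral_le_of_norm_le hb (ae_of_all _ hbd)).trans ?_
  rw [integral_const_mul]
  calc K * |b| ^ p * ∫ x, |x| ^ p ∂ν ≤ K * |b| ^ p * C := by
        gcongr; exact h.mp
    _ = _ := by ring

def PI (k : ℕ) (ν : Measure ℝ) : Measure (Fin k → ℝ) := Measure.pi (fun _ : Fin k => ν)

instance (k : ℕ) (ν : Measure ℝ) [IsProbabilityMeasure ν] : IsProbabilityMeasure (PI k ν) := by
  unfold PI; infer_instance

def SS {k : ℕ} (x : Fin k → ℝ) : ℝ := ∑ i, x i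
def QQ {k : ℕ} (x : Fin k → ℝ) : ℝ := ∑ i, x i ^ 2

@[fun_prop] lemma meas_SS {k : ℕ} : Measurable (SS (k := k)) := by unfold SS; fun_prop
@[fun_prop] lemma meas_QQ {k : ℕ} : Measurable (QQ (k := k)) := by unfold QQ; fun_prop
lemma QQ_nonneg {k : ℕ} (x : Fin k → ℝ) : 0 ≤ QQ x := Finset.sum_nonneg fun i _ => sq_nonneg _

lemma PI_prod {𝕜 : Type*} [RCLike 𝕜] (k : ℕ) (ν : Measure ℝ) [IsProbabilityMeasure ν] (g : ℝ → 𝕜) :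
    ∫ x, ∏ i, g (x i) ∂(PI k ν) = (∫ x, g x ∂ν) ^ k := by
  unfold PI
  rw [integral_fintype_prod_eq_prod (𝕜 := 𝕜) (f := fun _ => g)]
  simp

lemma PI_prod_int {𝕜 : Type*} [RCLike 𝕜] (k : ℕ) (ν : Measure ℝ) [IsProbabilityMeasure ν] (g : ℝ → 𝕜)
    (hg : Integrable g ν) :
    Integrable (fun x => ∏ i, g (x i)) (PI k ν) := by
  unfold PI
  exact Integrable.fintype_prod (f := fun _ => g) (fun _ => hg)

/-- exponential functional -/
lemma PI_cexp (k : ℕ) (ν : Measure ℝ) [IsProbabilityMeasure ν] (α β : ℂ) :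
    ∫ x : Fin k → ℝ, Complex.exp (α * SS x + β * QQ x) ∂(PI k ν)
      = (∫ x : ℝ, Complex.exp (α * x + β * x ^ 2) ∂ν) ^ k := by
  rw [← PI_prod]
  congr 1; ext x
  rw [← Complex.exp_sum, SS, QQ]
  congr 1
  push_cast
  rw [Finset.mul_sum, Finset.mul_sum, ← Finset.sum_add_distrib]

lemma PI_rexp (k : ℕ) (ν : Measure ℝ) [IsProbabilityMeasure ν] (α β : ℝ) :
    ∫ x : Fin k → ℝ, Real.exp (α * SS x + β * QQ x) ∂(PI k ν)
      = (∫ x : ℝ, Real.exp (α * x + β * x ^ 2) ∂ν) ^ k := by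
  rw [← PI_prod]
  congr 1; ext x
  rw [← Real.exp_sum, SS, QQ]
  congr 1
  rw [Finset.mul_sum, Finset.mul_sum, ← Finset.sum_add_distrib]

lemma PI_rexp_int (k : ℕ) (ν : Measure ℝ) [IsProbabilityMeasure ν] (α β : ℝ)
    (h : Integrable (fun x : ℝ => Real.exp (α * x + β * x ^ 2)) ν) :
    Integrable (fun x : Fin k → ℝ => Real.exp (α * SS x + β * QQ x)) (PI k ν) := by
  refine (PI_prod_int k ν _ h).congr (ae_of_all _ fun x => ?_)
  simp only
  rw [← Real.exp_sum, SS, QQ]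
  congr 1
  rw [Finset.mul_sum, Finset.mul_sum, ← Finset.sum_add_distrib]

lemma norm_pow_sub {a b : ℂ} {M : ℝ} (hM : 1 ≤ M) (ha : ‖a‖ ≤ M) (hb : ‖b‖ ≤ M) (k : ℕ) :
    ‖a ^ k - b ^ k‖ ≤ k * M ^ k * ‖a - b‖ := by
  induction k with
  | zero => simp
  | succ k ih =>
    have e : a ^ (k + 1) - b ^ (k + 1) = a * (a ^ k - b ^ k) + (a - b) * b ^ k := by ring
    rw [e]
    refine (norm_add_le _ _).trans ?_
    rw [norm_mul, norm_mul, norm_pow]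
    have h1 : ‖b‖ ^ k ≤ M ^ k := pow_le_pow_left₀ (norm_nonneg _) hb k
    have h2 : M ^ k ≤ M ^ (k+1) := pow_le_pow_right₀ hM (by omega)
    have h3 : ‖a‖ * ‖a ^ k - b ^ k‖ ≤ M * (k * M ^ k * ‖a - b‖) := by gcongr
    have h4 : ‖a - b‖ * ‖b‖ ^ k ≤ ‖a - b‖ * M ^ (k+1) := by gcongr; exact h1.trans h2
    push_cast
    calc _ ≤ M * (k * M ^ k * ‖a - b‖) + ‖a - b‖ * M ^ (k+1) := add_le_add h3 h4
      _ = _ := by ring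

lemma pow_lim {k : ℕ → ℕ} (hk : Tendsto k atTop atTop) {z : ℕ → ℂ} {w : ℂ}
    (h : Tendsto (fun n => (k n : ℂ) * z n) atTop (nhds w)) :
    Tendsto (fun n => (1 + z n) ^ k n) atTop (nhds (Complex.exp w)) := by
  have hkR : Tendsto (fun n => (k n : ℝ)) atTop atTop := tendsto_natCast_atTop_atTop.comp hk
  have h1 : Tendsto (fun n => Complex.exp ((k n : ℂ) * z n)) atTop (nhds (Complex.exp w)) :=
    (Complex.continuous_exp.tendsto w).comp h
  have hn : Tendsto (fun n => (k n : ℝ) * ‖z n‖) atTop (nhds ‖w‖) := by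
    refine h.norm.congr fun n => ?_
    simp
  have hz2 : Tendsto (fun n => (k n : ℝ) * ‖z n‖ ^ 2) atTop (nhds 0) := by
    have : Tendsto (fun n => ((k n : ℝ) * ‖z n‖) * ((k n : ℝ) * ‖z n‖) * (k n : ℝ)⁻¹) atTop
      (nhds (‖w‖ * ‖w‖ * 0)) := (hn.mul hn).mul (tendsto_inv_atTop_zero.comp hkR)
    rw [mul_zero] at this
    refine this.congr' ?_
    filter_upwards [hkR.eventually_gt_atTop 0] with n hn
    field_simp
  have hz : Tendsto (fun n => ‖z n‖) atTop (nhds 0) := by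
    have : Tendsto (fun n => ((k n : ℝ) * ‖z n‖) * (k n : ℝ)⁻¹) atTop
      (nhds (‖w‖ * 0)) := hn.mul (tendsto_inv_atTop_zero.comp hkR)
    rw [mul_zero] at this
    refine this.congr' ?_
    filter_upwards [hkR.eventually_gt_atTop 0] with n hn
    field_simp
  have hdiff : Tendsto (fun n => (1 + z n) ^ k n - Complex.exp ((k n : ℂ) * z n)) atTop (nhds 0) := by
    rw [tendsto_zero_iff_norm_tendsto_zero]
    have hb : Tendsto (fun n => Real.exp (k n * ‖z n‖) * ((k n : ℝ) * ‖z n‖ ^ 2)) atTop (nhds 0) := by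
      have := ((Real.continuous_exp.tendsto _).comp hn).mul hz2
      simpa using this
    refine squeeze_zero' (Eventually.of_forall fun n => norm_nonneg _) ?_ hb
    filter_upwards [hz.eventually_le_const (show (0:ℝ) < 1 by norm_num)] with n hn1
    have e : Complex.exp ((k n : ℂ) * z n) = Complex.exp (z n) ^ k n := by
      rw [← Complex.exp_nat_mul]
    rw [e]
    have hM : 1 ≤ Real.exp ‖z n‖ := Real.one_le_exp (norm_nonneg _)
    have ha : ‖1 + z n‖ ≤ Real.exp ‖z n‖ := by
      refine (norm_add_le _ _).trans ?_
      rw [norm_one, add_comm]; exact Real.add_one_le_exp _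
    have hb : ‖Complex.exp (z n)‖ ≤ Real.exp ‖z n‖ := by
      rw [Complex.norm_exp]; exact Real.exp_le_exp.2 (Complex.re_le_norm _)
    refine (norm_pow_sub hM ha hb _).trans ?_
    have hc : ‖1 + z n - Complex.exp (z n)‖ ≤ ‖z n‖ ^ 2 := by
      rw [norm_sub_rev]
      have := Complex.norm_exp_sub_one_sub_id_le hn1
      rwa [sub_sub] at this
    rw [← Real.exp_nat_mul]
    calc _ ≤ (k n : ℝ) * Real.exp (k n * ‖z n‖) * ‖z n‖ ^ 2 := by gcongr
      _ = _ := by ring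
  have := hdiff.add h1
  simpa using this

lemma pow_lim' {k : ℕ → ℕ} (hk : Tendsto k atTop atTop) {I : ℕ → ℂ} {w : ℂ} {v : ℕ → ℂ} {e : ℕ → ℝ}
    (hI : ∀ᶠ n in atTop, ‖I n - 1 - v n‖ ≤ e n)
    (hv : Tendsto (fun n => (k n : ℂ) * v n) atTop (nhds w))
    (he : Tendsto (fun n => (k n : ℝ) * e n) atTop (nhds 0)) :
    Tendsto (fun n => (I n) ^ k n) atTop (nhds (Complex.exp w)) := by
  have : Tendsto (fun n => (1 + (I n - 1)) ^ k n) atTop (nhds (Complex.exp w)) := by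
    apply pow_lim hk
    have h0 : Tendsto (fun n => (k n : ℂ) * (I n - 1 - v n)) atTop (nhds 0) := by
      rw [tendsto_zero_iff_norm_tendsto_zero]
      refine squeeze_zero' (Eventually.of_forall fun n => norm_nonneg _) ?_ he
      filter_upwards [hI] with n hn
      rw [norm_mul, Complex.norm_natCast]
      gcongr
    have := h0.add hv
    rw [zero_add] at this
    refine this.congr fun n => ?_
    ring
  simpa using this

end CMD
end

open MeasureTheory Filter Asymptotics Set
noncomputable section
namespace CMD
open ProbabilityTheory

def gT (x : ℝ) : ℝ := 1 - stdGaussCDF x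

def gp (t : ℝ) : ℝ := (Real.sqrt (2 * Real.pi))⁻¹ * Real.exp (-(t ^ 2) / 2)

lemma gp_eq : gp = gaussianPDFReal 0 1 := by
  ext x; simp [gp, gaussianPDFReal]

lemma gp_int : Integrable gp := by rw [gp_eq]; exact integrable_gaussianPDFReal _ _

lemma gp_total : ∫ x, gp x = 1 := by
  rw [gp_eq]; exact integral_gaussianPDFReal_eq_one 0 (by norm_num)

lemma gp_pos (x : ℝ) : 0 < gp x := by unfold gp; positivity

lemma gp_cont : Continuous gp := by unfold gp; fun_prop

lemma gT_int (x : ℝ) : gT x = ∫ t in Ioi x, gp t := by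
  have h := intervalIntegral.integral_Iic_add_Ioi (f := gp) (b := x) (μ := volume)
    gp_int.integrableOn gp_int.integrableOn
  rw [gp_total] at h
  unfold gT stdGaussCDF
  unfold gp at *
  linarith

lemma gT_gauss (x : ℝ) : gT x = (gaussianReal 0 1).real (Ici x) := by
  rw [gT_int, Measure.real, gaussianReal_apply_eq_integral _ (by norm_num), ENNReal.toReal_ofReal,
    integral_Ici_eq_integral_Ioi, gp_eq]
  exact integral_nonneg fun x => gaussianPDFReal_nonneg _ _ _

lemma gT_pos (x : ℝ) : 0 < gT x := by
  rw [gT_int]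
  rw [setIntegral_pos_iff_support_of_nonneg_ae (ae_of_all _ fun x => (gp_pos x).le) gp_int.integrableOn]
  have : Function.support gp = univ := by
    ext x; simp [(gp_pos x).ne']
  rw [this]; simp

lemma gT_cont : Continuous gT := by
  have : gT = fun x => gT 0 - ∫ t in (0:ℝ)..x, gp t := by
    ext x
    have := intervalIntegral.integral_Iic_sub_Iic (f := gp) (μ := volume) (a := 0) (b := x)
      gp_int.integrableOn gp_int.integrableOn
    rw [← this]
    unfold gT stdGaussCDF gp
    ring
  rw [this]
  exact continuous_const.sub (intervalIntegral.continuous_primitive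
    (fun a b => gp_int.intervalIntegrable) 0)

lemma mills_aux {x : ℝ} (hx : 0 < x) :
    IntegrableOn (fun t : ℝ => Real.exp (-(t ^ 2) / 2) * (1 + (t ^ 2)⁻¹)) (Ioi x) ∧
    ∫ t in Ioi x, Real.exp (-(t ^ 2) / 2) * (1 + (t ^ 2)⁻¹) = Real.exp (-(x ^ 2) / 2) / x := by
  have hd : ∀ t ∈ Ici x, HasDerivAt (fun t : ℝ => -(Real.exp (-(t ^ 2) / 2) * t⁻¹))
      (Real.exp (-(t ^ 2) / 2) * (1 + (t ^ 2)⁻¹)) t := by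
    intro t ht
    have ht0 : t ≠ 0 := (hx.trans_le ht).ne'
    have h1 : HasDerivAt (fun t : ℝ => -(t ^ 2) / 2) (-t) t := by
      have := ((hasDerivAt_pow 2 t).neg).div_const 2
      refine this.congr_deriv ?_
      simp; ring
    have := (h1.exp.mul (hasDerivAt_inv ht0)).neg
    refine this.congr_deriv ?_
    field_simp
    ring
  have hl : Tendsto (fun t : ℝ => -(Real.exp (-(t ^ 2) / 2) * t⁻¹)) atTop (nhds 0) := by
    have : Tendsto (fun t : ℝ => Real.exp (-(t ^ 2) / 2) * t⁻¹) atTop (nhds (0 * 0)) := by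
      refine Tendsto.mul ?_ tendsto_inv_atTop_zero
      refine Real.tendsto_exp_atBot.comp ?_
      have : Tendsto (fun t : ℝ => t ^ 2 / 2) atTop atTop :=
        (tendsto_pow_atTop (by norm_num)).atTop_div_const (by norm_num)
      refine (tendsto_neg_atTop_atBot.comp this).congr fun t => ?_
      simp; ring
    simpa using this.neg
  have hpos : ∀ t ∈ Ioi x, 0 ≤ Real.exp (-(t ^ 2) / 2) * (1 + (t ^ 2)⁻¹) := fun t _ => by positivity
  refine ⟨integrableOn_Ioi_deriv_of_nonneg' hd hpos hl, ?_⟩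
  rw [integral_Ioi_of_hasDerivAt_of_nonneg' hd hpos hl]
  simp [div_eq_mul_inv]

lemma mills : Tendsto (fun x : ℝ => gT x * (x * Real.exp (x ^ 2 / 2))) atTop
    (nhds (Real.sqrt (2 * Real.pi))⁻¹) := by
  have key : ∀ x : ℝ, 0 < x →
      (Real.sqrt (2 * Real.pi))⁻¹ * (1 + (x ^ 2)⁻¹)⁻¹ ≤ gT x * (x * Real.exp (x ^ 2 / 2)) ∧
      gT x * (x * Real.exp (x ^ 2 / 2)) ≤ (Real.sqrt (2 * Real.pi))⁻¹ := by
    intro x hx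
    obtain ⟨hi, he⟩ := mills_aux hx
    have hgi : IntegrableOn (fun t : ℝ => Real.exp (-(t ^ 2) / 2)) (Ioi x) := by
      have := (gp_int.const_mul (Real.sqrt (2 * Real.pi))).integrableOn (s := Ioi x)
      refine this.congr (ae_of_all _ fun t => ?_)
      unfold gp
      have : Real.sqrt (2 * Real.pi) ≠ 0 := by positivity
      field_simp
    have e1 : gT x = (Real.sqrt (2 * Real.pi))⁻¹ * ∫ t in Ioi x, Real.exp (-(t ^ 2) / 2) := by
      rw [gT_int, ← integral_const_mul]; rfl
    have u1 : ∫ t in Ioi x, Real.exp (-(t ^ 2) / 2) ≤ Real.exp (-(x ^ 2) / 2) / x := by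
      rw [← he]
      refine setIntegral_mono_on hgi hi measurableSet_Ioi fun t ht => ?_
      have : 0 ≤ (t ^ 2)⁻¹ := by positivity
      nlinarith [Real.exp_pos (-(t ^ 2) / 2)]
    have u2 : Real.exp (-(x ^ 2) / 2) / x ≤
        (1 + (x ^ 2)⁻¹) * ∫ t in Ioi x, Real.exp (-(t ^ 2) / 2) := by
      rw [← he, ← integral_const_mul]
      refine setIntegral_mono_on hi (hgi.const_mul _) measurableSet_Ioi fun t ht => ?_
      have ht' : x < t := ht
      rw [mul_comm]
      gcongr
    have hc : 0 < (Real.sqrt (2 * Real.pi))⁻¹ := by positivity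
    have hee : Real.exp (-(x ^ 2) / 2) / x * (x * Real.exp (x ^ 2 / 2)) = 1 := by
      have : Real.exp (-(x ^ 2) / 2) * Real.exp (x ^ 2 / 2) = 1 := by
        rw [← Real.exp_add, ← Real.exp_zero]; congr 1; ring
      field_simp
      field_simp at this
      linarith
    have hq : 0 < x * Real.exp (x ^ 2 / 2) := by positivity
    have hr : 0 < 1 + (x ^ 2)⁻¹ := by positivity
    rw [e1]
    set J := ∫ t in Ioi x, Real.exp (-(t ^ 2) / 2)
    constructor
    · rw [mul_assoc]
      refine mul_le_mul_of_nonneg_left ?_ hc.le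
      rw [inv_le_iff_one_le_mul₀' hr]
      have := mul_le_mul_of_nonneg_right u2 hq.le
      rw [hee] at this
      calc (1:ℝ) ≤ _ := this
        _ = _ := by ring
    · rw [mul_assoc]
      have := mul_le_mul_of_nonneg_right u1 hq.le
      rw [hee] at this
      nlinarith
  refine tendsto_of_tendsto_of_tendsto_of_le_of_le' (g := fun x : ℝ => (Real.sqrt (2 * Real.pi))⁻¹ * (1 + (x ^ 2)⁻¹)⁻¹)
    (h := fun _ => (Real.sqrt (2 * Real.pi))⁻¹) ?_ tendsto_const_nhds
    ((eventually_gt_atTop 0).mono fun x hx => (key x hx).1)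
    ((eventually_gt_atTop 0).mono fun x hx => (key x hx).2)
  have h1 : Tendsto (fun x : ℝ => 1 + (x ^ 2)⁻¹) atTop (nhds (1 + 0)) :=
    tendsto_const_nhds.add (tendsto_inv_atTop_zero.comp (tendsto_pow_atTop (by norm_num)))
  have := (h1.inv₀ (by norm_num)).const_mul (Real.sqrt (2 * Real.pi))⁻¹
  simpa using this

end CMD
end

open MeasureTheory Filter Asymptotics Set
noncomputable section
namespace CMD
open ProbabilityTheory

def Pr (k : ℕ) (ν : Measure ℝ) (t : ℝ) : ℝ := (PI k ν).real {x | t ≤ SS x / √(QQ x)}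

lemma k_rpow_lim {k : ℕ → ℕ} (hk : Tendsto k atTop atTop) {p : ℝ} (hp : 2 < p) :
    Tendsto (fun n => (k n : ℝ) * |(√(k n : ℝ))⁻¹| ^ p) atTop (nhds 0) := by
  have hkR : Tendsto (fun n => (k n : ℝ)) atTop atTop := tendsto_natCast_atTop_atTop.comp hk
  have h := (tendsto_rpow_neg_atTop (show 0 < p / 2 - 1 by linarith)).comp hkR
  refine h.congr' ?_
  filter_upwards [hkR.eventually_gt_atTop 0] with n hn
  simp only [Function.comp]
  rw [abs_of_nonneg (by positivity), Real.sqrt_eq_rpow, ← Real.rpow_neg hn.le, ← Real.rpow_mul hn.le]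
  conv_rhs => rw [← Real.rpow_one_add' hn.le (by linarith)]
  congr 1; ring

lemma pow_lim_sqrt {p C : ℝ} (hp2 : 2 < p) {k : ℕ → ℕ} (hk : Tendsto k atTop atTop)
    {ν : ℕ → Measure ℝ} (hν : ∀ n, Good p C (ν n)) {Ψ : ℝ → ℂ} (hΨ : Measurable Ψ) {A B : ℂ} {K : ℝ}
    (hE : ∀ y : ℝ, ‖Ψ y - 1 - A * (y : ℂ) - B * (y : ℂ) ^ 2‖ ≤ K * |y| ^ p) :
    Tendsto (fun n => (∫ x, Ψ ((√(k n : ℝ))⁻¹ * x) ∂(ν n)) ^ k n) atTop (nhds (Complex.exp B)) := by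
  have hkR : Tendsto (fun n => (k n : ℝ)) atTop atTop := tendsto_natCast_atTop_atTop.comp hk
  refine pow_lim' hk (v := fun n => B * (((√(k n : ℝ))⁻¹ : ℝ) : ℂ) ^ 2)
    (e := fun n => K * C * |(√(k n : ℝ))⁻¹| ^ p)
    (Eventually.of_forall fun n => (expand_int (hν n) hΨ hE _).2) ?_ ?_
  · refine tendsto_const_nhds.congr' ?_
    filter_upwards [hkR.eventually_gt_atTop 0] with n hn
    rw [← Complex.ofReal_pow, inv_pow, Real.sq_sqrt hn.le]
    push_cast
    have : (k n : ℂ) ≠ 0 := by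
      have : (k n : ℝ) ≠ 0 := hn.ne'
      exact_mod_cast this
    field_simp
  · have := (k_rpow_lim hk hp2).const_mul (K * C)
    rw [mul_zero] at this
    refine this.congr fun n => ?_
    ring

lemma S_tail_lim {p C : ℝ} (hp2 : 2 < p) (hp3 : p ≤ 3) {k : ℕ → ℕ} (hk : Tendsto k atTop atTop)
    {ν : ℕ → Measure ℝ} (hν : ∀ n, Good p C (ν n)) (τ : ℝ) :
    Tendsto (fun n => (PI (k n) (ν n)).real {x | τ ≤ (√(k n : ℝ))⁻¹ * SS x}) atTop (nhds (gT τ)) := by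
  have hpr : ∀ n, IsProbabilityMeasure (ν n) := fun n => (hν n).prob
  have hm : ∀ n, Measurable (fun x : Fin (k n) → ℝ => (√(k n : ℝ))⁻¹ * SS x) := fun n => by fun_prop
  let μ : ℕ → ProbabilityMeasure ℝ := fun n => ⟨(PI (k n) (ν n)).map (fun x => (√(k n : ℝ))⁻¹ * SS x),
    Measure.isProbabilityMeasure_map (hm n).aemeasurable⟩
  let μ₀ : ProbabilityMeasure ℝ := ⟨gaussianReal 0 1, inferInstance⟩
  have hlim : Tendsto μ atTop (nhds μ₀) := by
    apply ProbabilityMeasure.tendsto_of_tendsto_charFun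
    intro u
    have h1 := pow_lim_sqrt hp2 hk hν (Ψ := fun y => Complex.exp (Complex.I * (u * y : ℝ)))
      (by fun_prop) (E4 hp2.le hp3 u)
    have e0 : charFun (μ₀ : Measure ℝ) u = Complex.exp (-(u:ℂ) ^ 2 / 2) := by
      change charFun (gaussianReal 0 1) u = _
      rw [charFun_gaussianReal]; simp; ring_nf
    rw [e0]
    refine h1.congr fun n => ?_
    change _ = charFun ((PI (k n) (ν n)).map (fun x => (√(k n : ℝ))⁻¹ * SS x)) u
    rw [charFun_apply_real, integral_map (hm n).aemeasurable (by fun_prop)]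
    have := PI_cexp (k n) (ν n) (Complex.I * u * ((√(k n : ℝ))⁻¹ : ℝ)) 0
    simp only [zero_mul, add_zero] at this
    calc _ = (∫ x : ℝ, Complex.exp (Complex.I * u * ((√(k n : ℝ))⁻¹ : ℝ) * x) ∂(ν n)) ^ k n := by
          congr 2; ext x; congr 1; push_cast; ring
      _ = _ := this.symm
      _ = _ := by congr 1; ext x; congr 1; push_cast; ring
  have := ProbabilityMeasure.tendsto_measure_of_null_frontier_of_tendsto' hlim (E := Ici τ) (by
    rw [frontier_Ici]
    change gaussianReal 0 1 {τ} = 0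
    have := nullSingletonClass_gaussianReal (μ := 0) (v := 1) (by norm_num)
    exact measure_singleton τ)
  rw [gT_gauss]
  have h2 := (ENNReal.tendsto_toReal (measure_ne_top _ _)).comp this
  refine h2.congr fun n => ?_
  simp only [Function.comp]
  change (((PI (k n) (ν n)).map (fun x => (√(k n : ℝ))⁻¹ * SS x)) (Ici τ)).toReal = _
  rw [Measure.map_apply (hm n) measurableSet_Ici]
  rfl

lemma Q_lim {p C : ℝ} (hp2 : 2 < p) (hp3 : p ≤ 3) {k : ℕ → ℕ} (hk : Tendsto k atTop atTop)
    {ν : ℕ → Measure ℝ} (hν : ∀ n, Good p C (ν n)) {δ : ℝ} (hδ : 0 < δ) :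
    Tendsto (fun n => (PI (k n) (ν n)).real {x | δ ≤ |((k n : ℝ))⁻¹ * QQ x - 1|}) atTop (nhds 0) := by
  have hpr : ∀ n, IsProbabilityMeasure (ν n) := fun n => (hν n).prob
  have hm : ∀ n, Measurable (fun x : Fin (k n) → ℝ => ((k n : ℝ))⁻¹ * QQ x) := fun n => by fun_prop
  let μ : ℕ → ProbabilityMeasure ℝ := fun n => ⟨(PI (k n) (ν n)).map (fun x => ((k n : ℝ))⁻¹ * QQ x),
    Measure.isProbabilityMeasure_map (hm n).aemeasurable⟩
  let μ₀ : ProbabilityMeasure ℝ := ⟨Measure.dirac 1, inferInstance⟩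
  have hlim : Tendsto μ atTop (nhds μ₀) := by
    apply ProbabilityMeasure.tendsto_of_tendsto_charFun
    intro u
    have h1 := pow_lim_sqrt hp2 hk hν (Ψ := fun y => Complex.exp (Complex.I * (u * y ^ 2 : ℝ)))
      (by fun_prop) (E5 hp2.le hp3 u)
    have e0 : charFun (μ₀ : Measure ℝ) u = Complex.exp (Complex.I * u) := by
      change charFun (Measure.dirac 1) u = _
      rw [charFun_dirac]; simp; ring_nf
    rw [e0]
    refine h1.congr fun n => ?_
    change _ = charFun ((PI (k n) (ν n)).map (fun x => ((k n : ℝ))⁻¹ * QQ x)) u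
    rw [charFun_apply_real, integral_map (hm n).aemeasurable (by fun_prop)]
    have := PI_cexp (k n) (ν n) 0 (Complex.I * u * (((k n : ℝ))⁻¹ : ℝ))
    simp only [zero_mul, zero_add] at this
    calc _ = (∫ x : ℝ, Complex.exp (Complex.I * u * (((k n : ℝ))⁻¹ : ℝ) * x ^ 2) ∂(ν n)) ^ k n := by
          congr 2; ext x; congr 1
          rw [mul_pow, inv_pow, Real.sq_sqrt (by positivity)]
          push_cast; ring
      _ = _ := this.symm
      _ = _ := by congr 1; ext x; congr 1; push_cast; ring
  have hc : IsClosed {y : ℝ | δ ≤ |y - 1|} := isClosed_le continuous_const (by fun_prop)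
  have := ProbabilityMeasure.tendsto_measure_of_null_frontier_of_tendsto' hlim (E := {y : ℝ | δ ≤ |y - 1|}) (by
    change Measure.dirac 1 _ = 0
    rw [Measure.dirac_apply' _ isClosed_frontier.measurableSet, indicator_of_notMem]
    intro h
    have := hc.frontier_subset h
    simp at this
    linarith)
  have e0 : (μ₀ : Measure ℝ) {y : ℝ | δ ≤ |y - 1|} = 0 := by
    change Measure.dirac 1 _ = 0
    rw [Measure.dirac_apply' _ hc.measurableSet, indicator_of_notMem]
    simp [hδ]
  rw [e0] at this
  have h2 := (ENNReal.tendsto_toReal ENNReal.zero_ne_top).comp this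
  refine h2.congr fun n => ?_
  simp only [Function.comp]
  change (((PI (k n) (ν n)).map (fun x => ((k n : ℝ))⁻¹ * QQ x)) {y : ℝ | δ ≤ |y - 1|}).toReal = _
  rw [Measure.map_apply (hm n) hc.measurableSet]
  rfl

lemma sqrt_near {q δ : ℝ} (hq : |q - 1| < δ) (hδ : δ < 1) :
    1 - δ ≤ √q ∧ √q ≤ 1 + δ ∧ 0 < √q := by
  rw [abs_lt] at hq
  have h0 : 0 < q := by linarith
  have hs : 0 < √q := Real.sqrt_pos.2 h0
  have he : √q ^ 2 = q := Real.sq_sqrt h0.le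
  refine ⟨?_, ?_, hs⟩ <;> nlinarith

lemma regimeA {p C : ℝ} (hp2 : 2 < p) (hp3 : p ≤ 3) {k : ℕ → ℕ} (hk : Tendsto k atTop atTop)
    {ν : ℕ → Measure ℝ} (hν : ∀ n, Good p C (ν n)) {t : ℕ → ℝ} (ht : ∀ n, 0 ≤ t n) {τ : ℝ}
    (htl : Tendsto t atTop (nhds τ)) :
    Tendsto (fun n => Pr (k n) (ν n) (t n)) atTop (nhds (gT τ)) := by
  have hpr : ∀ n, IsProbabilityMeasure (ν n) := fun n => (hν n).prob
  have hτ : 0 ≤ τ := ge_of_tendsto' htl ht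
  have hkR : Tendsto (fun n => (k n : ℝ)) atTop atTop := tendsto_natCast_atTop_atTop.comp hk
  -- sandwich
  have key : ∀ η : ℝ, 0 < η → ∃ bad : ℕ → ℝ, Tendsto bad atTop (nhds 0) ∧ ∀ᶠ n in atTop,
      (PI (k n) (ν n)).real {x | τ + η ≤ (√(k n : ℝ))⁻¹ * SS x} - bad n ≤ Pr (k n) (ν n) (t n) ∧
      Pr (k n) (ν n) (t n) ≤ (PI (k n) (ν n)).real {x | τ - η ≤ (√(k n : ℝ))⁻¹ * SS x} + bad n := by
    intro η hη
    obtain ⟨δ, hδ0, hδ1, hδ2⟩ : ∃ δ : ℝ, 0 < δ ∧ δ < 1 ∧ (τ + 1) * δ < η / 2 := by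
      refine ⟨min (1/2) (η / (4 * (τ + 1))), by positivity, ?_, ?_⟩
      · exact (min_le_left _ _).trans_lt (by norm_num)
      · have : (τ + 1) * min (1/2) (η / (4 * (τ + 1))) ≤ (τ + 1) * (η / (4 * (τ + 1))) := by
          gcongr; exact min_le_right _ _
        have e : (τ + 1) * (η / (4 * (τ + 1))) = η / 4 := by field_simp
        linarith
    refine ⟨_, Q_lim hp2 hp3 hk hν hδ0, ?_⟩
    have a1 : ∀ᶠ n in atTop, t n * (1 + δ) < τ + η := by
      refine (htl.mul_const (1 + δ)).eventually_lt_const ?_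
      nlinarith
    have a2 : ∀ᶠ n in atTop, τ - η < t n * (1 - δ) := by
      refine (htl.mul_const (1 - δ)).eventually_const_lt ?_
      nlinarith
    filter_upwards [a1, a2, hkR.eventually_gt_atTop 0] with n h1 h2 h3
    have hs : 0 < √(k n : ℝ) := Real.sqrt_pos.2 h3
    have hsq : ∀ x : Fin (k n) → ℝ, √(((k n : ℝ))⁻¹ * QQ x) = (√(k n : ℝ))⁻¹ * √(QQ x) := by
      intro x
      rw [Real.sqrt_mul (by positivity), Real.sqrt_inv]
    have hW : ∀ x : Fin (k n) → ℝ, SS x / √(QQ x) =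
        ((√(k n : ℝ))⁻¹ * SS x) / √(((k n : ℝ))⁻¹ * QQ x) := by
      intro x
      rw [hsq, mul_div_mul_left _ _ (by positivity)]
    constructor
    · rw [sub_le_iff_le_add]
      refine (measureReal_mono ?_).trans (measureReal_union_le _ _)
      intro x hx
      by_cases hb : δ ≤ |((k n : ℝ))⁻¹ * QQ x - 1|
      · right; exact hb
      · left
        obtain ⟨b1, b2, b3⟩ := sqrt_near (not_le.1 hb) hδ1
        simp only [mem_setOf_eq] at hx ⊢
        rw [hW, le_div_iff₀ b3]
        have := mul_le_mul_of_nonneg_left b2 (ht n)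
        linarith
    · refine (measureReal_mono ?_).trans (measureReal_union_le _ _)
      intro x hx
      by_cases hb : δ ≤ |((k n : ℝ))⁻¹ * QQ x - 1|
      · right; exact hb
      · left
        obtain ⟨b1, b2, b3⟩ := sqrt_near (not_le.1 hb) hδ1
        simp only [mem_setOf_eq] at hx ⊢
        rw [hW, le_div_iff₀ b3] at hx
        have := mul_le_mul_of_nonneg_left b1 (ht n)
        linarith
  rw [Metric.tendsto_atTop']
  intro ε hε
  have hcont := gT_cont.continuousAt (x := τ)
  rw [Metric.continuousAt_iff] at hcont
  obtain ⟨d, hd, hdd⟩ := hcont (ε / 3) (by positivity)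
  obtain ⟨bad, hbad, hev⟩ := key (d / 2) (by positivity)
  have c1 := hdd (x := τ + d / 2) (by simp [Real.dist_eq, abs_of_pos hd]; linarith)
  have c2 := hdd (x := τ - d / 2) (by simp [Real.dist_eq, abs_of_pos hd]; linarith)
  rw [Real.dist_eq, abs_lt] at c1 c2
  have l1 := (S_tail_lim hp2 hp3 hk hν (τ + d / 2)).eventually_const_lt (u := gT τ - ε/3 ) (by linarith)
  have l2 := (S_tail_lim hp2 hp3 hk hν (τ - d / 2)).eventually_lt_const (u := gT τ + ε/3 ) (by linarith)
  have l3 := hbad.eventually_lt_const (u := ε / 3) (by positivity)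
  have : ∀ᶠ n in atTop, dist (Pr (k n) (ν n) (t n)) (gT τ) < ε := by
    filter_upwards [hev, l1, l2, l3] with n h0 h1 h2 h3
    rw [Real.dist_eq, abs_lt]
    constructor <;> linarith [h0.1, h0.2]
  obtain ⟨N, hN⟩ := eventually_atTop.1 this
  exact ⟨N, fun n hn => hN n hn.le⟩

end CMD
end

open MeasureTheory Filter Asymptotics Set
noncomputable section
namespace CMD
open ProbabilityTheory

lemma expabs_int : Integrable (fun s : ℝ => Real.exp (-|s|)) := by
  rw [← integrableOn_univ, ← Iic_union_Ioi (a := (0:ℝ)), integrableOn_union]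
  constructor
  · refine (integrableOn_exp_mul_Iic (a := 1) one_pos 0).congr_fun (fun s hs => ?_) measurableSet_Iic
    have : s ≤ 0 := hs
    simp [abs_of_nonpos this]
  · refine (integrableOn_exp_mul_Ioi (a := -1) (by norm_num) 0).congr_fun (fun s hs => ?_) measurableSet_Ioi
    have : 0 < s := hs
    simp [abs_of_pos this]

/-- Laplace transform. -/
lemma laplace (y : ℝ) : ∫ s : ℝ, Complex.exp (Complex.I * (y * s : ℝ)) * (Real.exp (-|s|) : ℂ)
    = ((2 * (1 + y ^ 2)⁻¹ : ℝ) : ℂ) := by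
  have hi : Integrable (fun s : ℝ => Complex.exp (Complex.I * (y * s : ℝ)) * (Real.exp (-|s|) : ℂ)) := by
    refine expabs_int.mono' (by fun_prop) (ae_of_all _ fun s => ?_)
    rw [norm_mul, mul_comm Complex.I, Complex.norm_exp_ofReal_mul_I, one_mul, Complex.norm_real,
      Real.norm_of_nonneg (Real.exp_pos _).le]
  rw [← intervalIntegral.integral_Iic_add_Ioi (b := 0) hi.integrableOn hi.integrableOn]
  have h1 : ∫ s in Iic (0:ℝ), Complex.exp (Complex.I * (y * s : ℝ)) * (Real.exp (-|s|) : ℂ)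
      = ∫ s in Iic (0:ℝ), Complex.exp ((1 + y * Complex.I) * s) := by
    refine setIntegral_congr_fun measurableSet_Iic fun s hs => ?_
    have : s ≤ 0 := hs
    rw [abs_of_nonpos this, Complex.ofReal_exp, ← Complex.exp_add]
    congr 1; push_cast; ring
  have h2 : ∫ s in Ioi (0:ℝ), Complex.exp (Complex.I * (y * s : ℝ)) * (Real.exp (-|s|) : ℂ)
      = ∫ s in Ioi (0:ℝ), Complex.exp ((-1 + y * Complex.I) * s) := by
    refine setIntegral_congr_fun measurableSet_Ioi fun s hs => ?_
    have : 0 < s := hs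
    rw [abs_of_pos this, Complex.ofReal_exp, ← Complex.exp_add]
    congr 1; push_cast; ring
  rw [h1, h2, integral_exp_mul_complex_Iic (by simp), integral_exp_mul_complex_Ioi (by simp)]
  have n1 : (1 + y * Complex.I : ℂ) ≠ 0 := by
    intro h; have := congrArg Complex.re h; simp at this
  have n2 : (-1 + y * Complex.I : ℂ) ≠ 0 := by
    intro h; have := congrArg Complex.re h; simp at this
  have n3 : (1 + (y:ℂ) ^ 2) ≠ 0 := by
    have : (1 + y ^ 2 : ℝ) ≠ 0 := by positivity
    exact_mod_cast this
  simp only [Complex.ofReal_zero, mul_zero, Complex.exp_zero]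
  push_cast
  field_simp
  ring_nf
  simp only [Complex.I_sq]
  ring

def Cau : Measure ℝ := volume.withDensity (fun y => ENNReal.ofReal (Real.pi⁻¹ * (1 + y ^ 2)⁻¹))

instance : IsProbabilityMeasure Cau := by
  constructor
  unfold Cau
  rw [withDensity_apply _ MeasurableSet.univ, setLIntegral_univ, ← ofReal_integral_eq_lintegral_ofReal]
  · rw [integral_const_mul, integral_univ_inv_one_add_sq, inv_mul_cancel₀ Real.pi_ne_zero]; simp
  · exact integrable_inv_one_add_sq.const_mul _
  · exact ae_of_all _ fun y => by positivity

lemma Cau_integral {E : Type*} [NormedAddCommGroup E] [NormedSpace ℝ E] (g : ℝ → E) :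
    ∫ y, g y ∂Cau = ∫ y, (Real.pi⁻¹ * (1 + y ^ 2)⁻¹) • g y := by
  unfold Cau
  rw [integral_withDensity_eq_integral_toReal_smul (by fun_prop) (ae_of_all _ fun _ => by simp)]
  congr 1; ext y
  rw [ENNReal.toReal_ofReal (by positivity)]

open FourierTransform in
lemma Cau_charFun (v : ℝ) : charFun Cau v = (Real.exp (-|v|) : ℂ) := by
  let f : ℝ → ℂ := fun s => (Real.exp (-|s|) : ℂ)
  have hF : ∀ w : ℝ, 𝓕 f w = ((2 * (1 + (2 * Real.pi * w) ^ 2)⁻¹ : ℝ) : ℂ) := by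
    intro w
    rw [Real.fourier_real_eq_integral_exp_smul]
    have := laplace (-2 * Real.pi * w)
    rw [show (-2 * Real.pi * w) ^ 2 = (2 * Real.pi * w) ^ 2 by ring] at this
    rw [← this]
    congr 1; ext s
    rw [smul_eq_mul]
    congr 2
    push_cast; ring
  have hfi : Integrable f := expabs_int.ofReal
  have hFi : Integrable (𝓕 f) := by
    have h0 : Integrable (fun w : ℝ => (2 * (1 + (2 * Real.pi * w) ^ 2)⁻¹ : ℝ)) :=
      (integrable_inv_one_add_sq.comp_mul_left' (by positivity)).const_mul 2
    have : 𝓕 f = fun w : ℝ => ((2 * (1 + (2 * Real.pi * w) ^ 2)⁻¹ : ℝ) : ℂ) := funext hF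
    rw [this]
    exact h0.ofReal
  have hinv := Integrable.fourierInv_fourier_eq hfi hFi (v := v) (by
    have : Continuous f := by fun_prop
    exact this.continuousAt)
  rw [charFun_apply_real, Cau_integral]
  change _ = f v
  rw [← hinv, Real.fourierInv_eq']
  simp_rw [hF]
  have hsub := Measure.integral_comp_mul_left
    (fun y : ℝ => Complex.exp (((y * v : ℝ) : ℂ) * Complex.I) • ((2 * (1 + y ^ 2)⁻¹ : ℝ) : ℂ)) (2 * Real.pi)
  have e : ∀ w : ℝ, Complex.exp (((2 * Real.pi * inner ℝ w v : ℝ) : ℂ) * Complex.I)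
      = Complex.exp (((2 * Real.pi * w * v : ℝ) : ℂ) * Complex.I) := by
    intro w
    rw [show inner ℝ w v = v * w from rfl]
    congr 2; push_cast; ring
  simp_rw [e]
  rw [hsub, ← integral_smul]
  congr 1; ext y
  rw [abs_of_pos (by positivity)]
  simp only [Complex.real_smul, smul_eq_mul]
  push_cast
  have : (Real.pi : ℂ) ≠ 0 := by exact_mod_cast Real.pi_ne_zero
  rw [mul_comm (v:ℂ) y]
  field_simp

/-- Fubini identity. -/
lemma cauchy_fub (lam : Measure ℝ) [IsFiniteMeasure lam] (v : ℝ) :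
    ∫ y, ((1 + y ^ 2)⁻¹ : ℝ) * Complex.exp (v * y * Complex.I) ∂lam
      = (1 / 2 : ℂ) * ∫ s : ℝ, (Real.exp (-|s - v|) : ℂ) * charFun lam s := by
  have h1 : ∀ y : ℝ, (((1 + y ^ 2)⁻¹ : ℝ) : ℂ) * Complex.exp (v * y * Complex.I)
      = (1 / 2 : ℂ) * ∫ s : ℝ, Complex.exp (s * y * Complex.I) * (Real.exp (-|s - v|) : ℂ) := by
    intro y
    have hl := laplace y
    have e : ∫ s : ℝ, Complex.exp (s * y * Complex.I) * (Real.exp (-|s - v|) : ℂ)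
        = ∫ s : ℝ, Complex.exp ((s + v : ℝ) * y * Complex.I) * (Real.exp (-|s|) : ℂ) := by
      rw [← integral_add_right_eq_self _ v]
      simp
    have e2 : ∫ s : ℝ, Complex.exp ((s + v : ℝ) * y * Complex.I) * (Real.exp (-|s|) : ℂ)
        = Complex.exp (v * y * Complex.I) * ∫ s : ℝ, Complex.exp (Complex.I * (y * s : ℝ)) * (Real.exp (-|s|) : ℂ) := by
      rw [← integral_const_mul]
      congr 1; ext s
      rw [← mul_assoc, ← Complex.exp_add]
      congr 2; push_cast; ring
    rw [e, e2, hl]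
    push_cast; ring
  simp_rw [h1]
  rw [integral_const_mul]
  congr 1
  rw [integral_integral_swap]
  · congr 1; ext s
    rw [charFun_apply_real, integral_mul_const, mul_comm]
  · have hi : Integrable (fun z : ℝ × ℝ => (1:ℝ) * Real.exp (-|z.2 - v|)) (lam.prod volume) :=
      Integrable.mul_prod (integrable_const (1:ℝ)) (expabs_int.comp_sub_right v)
    refine hi.mono' ?_ (ae_of_all _ fun z => ?_)
    · apply Continuous.aestronglyMeasurable
      simp only [Function.uncurry_def]
      fun_prop
    · rw [Function.uncurry_def]
      simp only [norm_mul]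
      rw [← Complex.ofReal_mul, Complex.norm_exp_ofReal_mul_I, Complex.norm_real,
        Real.norm_of_nonneg (Real.exp_pos _).le]

lemma gauss_total : ∫ u : ℝ, (Real.exp (-(u ^ 2) / 2) : ℂ) = (√(2 * Real.pi) : ℝ) := by
  rw [integral_complex_ofReal]
  refine congrArg _ ?_
  have := integral_gaussian (1/2)
  rw [show Real.pi / (1/2) = 2 * Real.pi by ring] at this
  rw [← this]
  congr 1; ext u; congr 1; ring

/-- x * Fourier functional limit -/
lemma local_fourier {lam : ℕ → Measure ℝ} [∀ n, IsFiniteMeasure (lam n)] {x : ℕ → ℝ}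
    (hx : Tendsto x atTop atTop) {D : ℝ → ℝ} (hD : Integrable D)
    (hdom : ∀ᶠ n in atTop, ∀ u, Real.exp (-|u / x n|) * ‖charFun (lam n) (u / x n)‖ ≤ D u)
    (hlim : ∀ u, Tendsto (fun n => charFun (lam n) (u / x n)) atTop (nhds (Real.exp (-(u ^ 2) / 2) : ℂ)))
    (v : ℝ) :
    Tendsto (fun n => (x n : ℂ) * ∫ y, ((1 + y ^ 2)⁻¹ : ℝ) * Complex.exp (v * y * Complex.I) ∂(lam n))
      atTop (nhds ((√(2 * Real.pi) / 2 : ℝ) * (Real.exp (-|v|) : ℂ))) := by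
  have h1 : ∀ᶠ n in atTop, (1 / 2 : ℂ) * ∫ u : ℝ, (Real.exp (-|u / x n - v|) : ℂ) * charFun (lam n) (u / x n)
      = (x n : ℂ) * ∫ y, ((1 + y ^ 2)⁻¹ : ℝ) * Complex.exp (v * y * Complex.I) ∂(lam n) := by
    filter_upwards [hx.eventually_gt_atTop 0] with n hn
    rw [cauchy_fub]
    have := Measure.integral_comp_div (fun s : ℝ => (Real.exp (-|s - v|) : ℂ) * charFun (lam n) s) (x n)
    rw [this, abs_of_pos hn, Complex.real_smul]
    ring
  refine Tendsto.congr' h1 ?_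
  have h2 : Tendsto (fun n => ∫ u : ℝ, (Real.exp (-|u / x n - v|) : ℂ) * charFun (lam n) (u / x n)) atTop
      (nhds (∫ u : ℝ, (Real.exp (-|v|) : ℂ) * (Real.exp (-(u ^ 2) / 2) : ℂ))) := by
    refine tendsto_integral_filter_of_dominated_convergence (fun u => Real.exp |v| * D u) ?_ ?_
      (hD.const_mul _) ?_
    · refine Eventually.of_forall fun n => ?_
      refine Continuous.aestronglyMeasurable ?_
      have : Continuous (charFun (lam n)) := continuous_charFun
      fun_prop
    · filter_upwards [hdom] with n hn
      refine ae_of_all _ fun u => ?_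
      rw [norm_mul, Complex.norm_real, Real.norm_of_nonneg (Real.exp_pos _).le]
      have : Real.exp (-|u / x n - v|) ≤ Real.exp |v| * Real.exp (-|u / x n|) := by
        rw [← Real.exp_add]
        apply Real.exp_le_exp.2
        have := abs_sub_abs_le_abs_sub (u / x n) v
        linarith
      calc _ ≤ Real.exp |v| * Real.exp (-|u / x n|) * ‖charFun (lam n) (u / x n)‖ := by gcongr
        _ = Real.exp |v| * (Real.exp (-|u / x n|) * ‖charFun (lam n) (u / x n)‖) := by ring
        _ ≤ _ := by gcongr; exact hn u
    · refine ae_of_all _ fun u => ?_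
      refine Tendsto.mul ?_ (hlim u)
      have h3 : Tendsto (fun n => u / x n) atTop (nhds 0) := hx.const_div_atTop u
      have : Continuous fun w : ℝ => (Real.exp (-|w - v|) : ℂ) := by fun_prop
      have h4 := (this.tendsto 0).comp h3
      simp only [zero_sub, abs_neg] at h4
      exact h4
  rw [integral_const_mul, gauss_total] at h2
  have := h2.const_mul (1 / 2 : ℂ)
  convert this using 2
  push_cast; ring

lemma local_lim {lam : ℕ → Measure ℝ} [∀ n, IsFiniteMeasure (lam n)] [∀ n, NeZero (lam n)] {x : ℕ → ℝ}
    (hx : Tendsto x atTop atTop) {D : ℝ → ℝ} (hD : Integrable D)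
    (hdom : ∀ᶠ n in atTop, ∀ u, Real.exp (-|u / x n|) * ‖charFun (lam n) (u / x n)‖ ≤ D u)
    (hlim : ∀ u, Tendsto (fun n => charFun (lam n) (u / x n)) atTop (nhds (Real.exp (-(u ^ 2) / 2) : ℂ)))
    (g : BoundedContinuousFunction ℝ ℝ) :
    Tendsto (fun n => x n * ∫ y, (1 + y ^ 2)⁻¹ * g y ∂(lam n))
      atTop (nhds (√(2 * Real.pi) / 2 * ∫ y, g y ∂Cau)) := by
  let f : ℝ → ℝ := fun y => -Real.log (1 + y ^ 2)
  have hf : ∀ y, Real.exp (f y) = (1 + y ^ 2)⁻¹ := fun y => by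
    simp only [f]; rw [Real.exp_neg, Real.exp_log (by positivity)]
  have hfm : Measurable f := by fun_prop
  have hintg : ∀ n, Integrable (fun y => Real.exp (f y)) (lam n) := fun n => by
    simp_rw [hf]
    refine (integrable_const (1:ℝ)).mono' (by fun_prop) (ae_of_all _ fun y => ?_)
    rw [Real.norm_of_nonneg (by positivity)]
    exact inv_le_one_of_one_le₀ (by nlinarith [sq_nonneg y])
  let κ : ℕ → ProbabilityMeasure ℝ := fun n => ⟨(lam n).tilted f, isProbabilityMeasure_tilted (hintg n)⟩
  let μ₀ : ProbabilityMeasure ℝ := ⟨Cau, inferInstance⟩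
  set Z : ℕ → ℝ := fun n => ∫ y, (1 + y ^ 2)⁻¹ ∂(lam n) with hZ
  have hLF := local_fourier hx hD hdom hlim
  have hZl : Tendsto (fun n => x n * Z n) atTop (nhds (√(2 * Real.pi) / 2)) := by
    have h0 := hLF 0
    have h1 := (Complex.continuous_re.tendsto _).comp h0
    simp only [abs_zero, neg_zero, Real.exp_zero, Complex.ofReal_one, mul_one, Complex.ofReal_re] at h1
    refine h1.congr fun n => ?_
    simp only [Function.comp, Complex.ofReal_zero, zero_mul, Complex.exp_zero, mul_one]
    rw [integral_complex_ofReal, ← Complex.ofReal_mul, Complex.ofReal_re]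
  have hc : (√(2 * Real.pi) / 2 : ℝ) ≠ 0 := by positivity
  have hZx : ∀ᶠ n in atTop, x n * Z n ≠ 0 := hZl.eventually_ne hc
  have hκ : Tendsto κ atTop (nhds μ₀) := by
    apply ProbabilityMeasure.tendsto_of_tendsto_charFun
    intro v
    change Tendsto _ _ (nhds (charFun Cau v))
    rw [Cau_charFun]
    have h1 : Tendsto (fun n => ((x n * Z n : ℝ) : ℂ)⁻¹ *
        ((x n : ℂ) * ∫ y, ((1 + y ^ 2)⁻¹ : ℝ) * Complex.exp (v * y * Complex.I) ∂(lam n))) atTop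
        (nhds (((√(2 * Real.pi) / 2 : ℝ) : ℂ)⁻¹ * ((√(2 * Real.pi) / 2 : ℝ) * (Real.exp (-|v|) : ℂ)))) :=
      (((Complex.continuous_ofReal.tendsto _).comp hZl).inv₀ (by exact_mod_cast hc)).mul (hLF v)
    rw [inv_mul_cancel_left₀ (by exact_mod_cast hc)] at h1
    refine h1.congr' ?_
    filter_upwards [hZx] with n hn
    change _ = charFun ((lam n).tilted f) v
    rw [charFun_apply_real, integral_tilted]
    simp_rw [hf]
    change _ = ∫ y, ((1 + y ^ 2)⁻¹ / Z n) • Complex.exp (v * y * Complex.I) ∂(lam n)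
    rw [← mul_assoc, ← integral_const_mul]
    congr 1; ext y
    have hx0 : (x n : ℂ) ≠ 0 := by exact_mod_cast left_ne_zero_of_mul hn
    have hz0 : (Z n : ℂ) ≠ 0 := by exact_mod_cast right_ne_zero_of_mul hn
    rw [Complex.real_smul]
    push_cast
    field_simp
  have hg := (ProbabilityMeasure.tendsto_iff_forall_integral_tendsto.1 hκ) g
  have := hZl.mul hg
  refine this.congr' ?_
  filter_upwards [hZx] with n hn
  change x n * Z n * ∫ y, g y ∂((lam n).tilted f) = _
  rw [integral_tilted]
  simp_rw [hf]
  change x n * Z n * ∫ y, ((1 + y ^ 2)⁻¹ / Z n) • g y ∂(lam n) = _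
  have hz0 : Z n ≠ 0 := right_ne_zero_of_mul hn
  have e : ∀ y : ℝ, ((1 + y ^ 2)⁻¹ / Z n) • g y = (Z n)⁻¹ * ((1 + y ^ 2)⁻¹ * g y) := by
    intro y; rw [smul_eq_mul]; ring
  simp_rw [e]
  rw [integral_const_mul, mul_assoc, mul_inv_cancel_left₀ hz0]

end CMD
end

open MeasureTheory Filter Asymptotics Set
noncomputable section
namespace CMD
open ProbabilityTheory

def ramp (c h y : ℝ) : ℝ := max 0 (min 1 ((y - (c - h)) / h))

lemma ramp_nonneg (c h y : ℝ) : 0 ≤ ramp c h y := le_max_left _ _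
lemma ramp_le_one (c h y : ℝ) : ramp c h y ≤ 1 := max_le (by norm_num) (min_le_left _ _)
lemma ramp_cont (c h : ℝ) : Continuous (ramp c h) := by unfold ramp; fun_prop
lemma ramp_one {c h y : ℝ} (hh : 0 < h) (hy : c ≤ y) : ramp c h y = 1 := by
  unfold ramp
  have : 1 ≤ (y - (c - h)) / h := by rw [le_div_iff₀ hh]; linarith
  rw [min_eq_left this]; norm_num
lemma ramp_zero {c h y : ℝ} (hh : 0 < h) (hy : y ≤ c - h) : ramp c h y = 0 := by
  unfold ramp
  have : (y - (c - h)) / h ≤ 0 := div_nonpos_of_nonpos_of_nonneg (by linarith) hh.le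
  rw [min_eq_right (by linarith), max_eq_left this]

def gfun (c h y : ℝ) : ℝ := Real.exp (-(max y (c - h))) * (1 + (max y (c - h)) ^ 2) * ramp c h y

lemma gfun_eq {c h : ℝ} (hh : 0 < h) (y : ℝ) : gfun c h y = Real.exp (-y) * (1 + y ^ 2) * ramp c h y := by
  unfold gfun
  rcases le_total y (c - h) with hy | hy
  · rw [ramp_zero hh hy]; simp
  · rw [max_eq_left hy]

lemma ez_bound {d z : ℝ} (hz : d ≤ z) : Real.exp (-z) * (1 + z ^ 2) ≤ Real.exp |d| * (1 + d ^ 2) + 3 := by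
  rcases le_total 0 z with h0 | h0
  · have h1 := Real.quadratic_le_exp_of_nonneg h0
    have h2 : Real.exp (-z) * Real.exp z = 1 := by rw [← Real.exp_add]; simp
    have h3 := Real.exp_pos (-z)
    have : Real.exp (-z) * (1 + z ^ 2) ≤ Real.exp (-z) * (2 * Real.exp z) := by
      gcongr; nlinarith
    have h4 : 0 ≤ Real.exp |d| * (1 + d ^ 2) := by positivity
    nlinarith
  · have h1 : |d| = -d := abs_of_nonpos (hz.trans h0)
    have h2 : Real.exp (-z) ≤ Real.exp |d| := by rw [h1]; apply Real.exp_le_exp.2; linarith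
    have h3 : 1 + z ^ 2 ≤ 1 + d ^ 2 := by nlinarith
    have : Real.exp (-z) * (1 + z ^ 2) ≤ Real.exp |d| * (1 + d ^ 2) := by gcongr
    linarith

def gB (c h : ℝ) : BoundedContinuousFunction ℝ ℝ :=
  BoundedContinuousFunction.ofNormedAddCommGroup (gfun c h)
    (by have := ramp_cont c h; unfold gfun; fun_prop)
    (Real.exp |c - h| * (1 + (c - h) ^ 2) + 3) (by
      intro y
      have h0 := ramp_nonneg c h y
      have h1 := ramp_le_one c h y
      have h2 := ez_bound (le_max_right y (c - h))
      unfold gfun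
      rw [Real.norm_of_nonneg (by positivity)]
      refine (mul_le_of_le_one_right (by positivity) h1).trans h2)

lemma exp_ind_int (lam : Measure ℝ) [IsFiniteMeasure lam] (c : ℝ) :
    IntegrableOn (fun y => Real.exp (-y)) (Ici c) lam := by
  have : IntegrableOn (fun _ : ℝ => Real.exp (-c)) (Ici c) lam := integrable_const _
  refine this.mono' (by fun_prop) ((ae_restrict_iff' measurableSet_Ici).2 (ae_of_all _ fun y hy => ?_))
  rw [Real.norm_of_nonneg (Real.exp_pos _).le]
  exact Real.exp_le_exp.2 (by have : c ≤ y := hy; linarith)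

lemma local_tail {lam : ℕ → Measure ℝ} [∀ n, IsFiniteMeasure (lam n)] [∀ n, NeZero (lam n)] {x : ℕ → ℝ}
    (hx : Tendsto x atTop atTop) {D : ℝ → ℝ} (hD : Integrable D)
    (hdom : ∀ᶠ n in atTop, ∀ u, Real.exp (-|u / x n|) * ‖charFun (lam n) (u / x n)‖ ≤ D u)
    (hlim : ∀ u, Tendsto (fun n => charFun (lam n) (u / x n)) atTop (nhds (Real.exp (-(u ^ 2) / 2) : ℂ)))
    (c : ℝ) :
    Tendsto (fun n => x n * ∫ y in Ici c, Real.exp (-y) ∂(lam n))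
      atTop (nhds ((√(2 * Real.pi))⁻¹ * Real.exp (-c))) := by
  set q : ℝ := (√(2 * Real.pi))⁻¹ with hq
  have hq0 : 0 < q := by positivity
  -- general ramp limits
  have hr : ∀ c h : ℝ, 0 < h → ∃ J : ℝ, q * Real.exp (-c) ≤ J ∧ J ≤ q * Real.exp (-(c - h)) ∧
      Tendsto (fun n => x n * ∫ y, Real.exp (-y) * ramp c h y ∂(lam n)) atTop (nhds J) := by
    intro c h hh
    have hl := local_lim hx hD hdom hlim (gB c h)
    have hid : ∀ y : ℝ, (1 + y ^ 2)⁻¹ * gB c h y = Real.exp (-y) * ramp c h y := by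
      intro y
      change (1 + y ^ 2)⁻¹ * gfun c h y = _
      rw [gfun_eq hh]
      have : (1 + y ^ 2) ≠ 0 := by positivity
      field_simp
    simp_rw [hid] at hl
    have hI1 : IntegrableOn (fun y : ℝ => Real.exp (-y)) (Ioi c) := integrableOn_exp_neg_Ioi c
    have hI2 : IntegrableOn (fun y : ℝ => Real.exp (-y)) (Ioi (c - h)) := integrableOn_exp_neg_Ioi _
    have hsup : ∀ y : ℝ, Real.exp (-y) * ramp c h y ≤ (Ioi (c - h)).indicator (fun y => Real.exp (-y)) y := by
      intro y
      by_cases hy : c - h < y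
      · rw [indicator_of_mem (by exact hy)]
        exact mul_le_of_le_one_right (Real.exp_pos _).le (ramp_le_one _ _ _)
      · rw [indicator_of_notMem (by exact hy), ramp_zero hh (not_lt.1 hy)]; simp
    have hinf : ∀ y : ℝ, (Ioi c).indicator (fun y => Real.exp (-y)) y ≤ Real.exp (-y) * ramp c h y := by
      intro y
      by_cases hy : c < y
      · rw [indicator_of_mem (by exact hy), ramp_one hh hy.le, mul_one]
      · rw [indicator_of_notMem (by exact hy)]
        exact mul_nonneg (Real.exp_pos _).le (ramp_nonneg _ _ _)
    have hI : Integrable (fun y : ℝ => Real.exp (-y) * ramp c h y) := by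
      refine ((integrable_indicator_iff measurableSet_Ioi).2 hI2).mono' ?_ (ae_of_all _ fun y => ?_)
      · have := ramp_cont c h
        exact Continuous.aestronglyMeasurable (by fun_prop)
      · rw [Real.norm_of_nonneg (mul_nonneg (Real.exp_pos _).le (ramp_nonneg _ _ _))]
        exact hsup y
    have e1 : ∫ y, gB c h y ∂Cau = Real.pi⁻¹ * ∫ y, Real.exp (-y) * ramp c h y := by
      rw [Cau_integral, ← integral_const_mul]
      congr 1; ext y
      rw [smul_eq_mul, mul_assoc, hid]
    have b1 : Real.exp (-c) ≤ ∫ y, Real.exp (-y) * ramp c h y := by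
      rw [← integral_exp_neg_Ioi c, ← integral_indicator measurableSet_Ioi]
      exact integral_mono ((integrable_indicator_iff measurableSet_Ioi).2 hI1) hI hinf
    have b2 : ∫ y, Real.exp (-y) * ramp c h y ≤ Real.exp (-(c - h)) := by
      rw [← integral_exp_neg_Ioi (c - h), ← integral_indicator measurableSet_Ioi]
      exact integral_mono hI ((integrable_indicator_iff measurableSet_Ioi).2 hI2) hsup
    have hqe : √(2 * Real.pi) / 2 * Real.pi⁻¹ = q := by
      have hs : √(2 * Real.pi) * √(2 * Real.pi) = 2 * Real.pi := Real.mul_self_sqrt (by positivity)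
      have hs0 : √(2 * Real.pi) ≠ 0 := by positivity
      have := Real.pi_ne_zero
      rw [hq]
      field_simp
      rw [sq, hs]
    rw [e1, ← mul_assoc, hqe] at hl
    exact ⟨_, mul_le_mul_of_nonneg_left b1 hq0.le, mul_le_mul_of_nonneg_left b2 hq0.le, hl⟩
  have hsq : ∀ c h : ℝ, 0 < h → ∀ n, 
      ∫ y, Real.exp (-y) * ramp (c + h) h y ∂(lam n) ≤ ∫ y in Ici c, Real.exp (-y) ∂(lam n) ∧
      ∫ y in Ici c, Real.exp (-y) ∂(lam n) ≤ ∫ y, Real.exp (-y) * ramp c h y ∂(lam n) := by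
    intro c h hh n
    have hintg : ∀ c h : ℝ, 0 < h → Integrable (fun y : ℝ => Real.exp (-y) * ramp c h y) (lam n) := by
      intro c h hh
      refine ((integrable_indicator_iff measurableSet_Ici).2 (exp_ind_int (lam n) (c - h))).mono' ?_
        (ae_of_all _ fun y => ?_)
      · have := ramp_cont c h
        exact Continuous.aestronglyMeasurable (by fun_prop)
      · rw [Real.norm_of_nonneg (mul_nonneg (Real.exp_pos _).le (ramp_nonneg _ _ _))]
        by_cases hy : c - h ≤ y
        · rw [indicator_of_mem (by exact hy)]
          exact mul_le_of_le_one_right (Real.exp_pos _).le (ramp_le_one _ _ _)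
        · rw [indicator_of_notMem (by exact hy), ramp_zero hh (not_le.1 hy).le]; simp
    rw [← integral_indicator measurableSet_Ici]
    have hi := (integrable_indicator_iff measurableSet_Ici).2 (exp_ind_int (lam n) c)
    refine ⟨integral_mono (hintg _ _ hh) hi fun y => ?_, integral_mono hi (hintg _ _ hh) fun y => ?_⟩
    · by_cases hy : c ≤ y
      · simp only
        rw [indicator_of_mem (by exact hy)]
        exact mul_le_of_le_one_right (Real.exp_pos _).le (ramp_le_one _ _ _)
      · simp only
        rw [indicator_of_notMem (by exact hy), ramp_zero hh (by linarith)]; simp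
    · by_cases hy : c ≤ y
      · simp only
        rw [indicator_of_mem (by exact hy), ramp_one hh hy, mul_one]
      · simp only
        rw [indicator_of_notMem (by exact hy)]
        exact mul_nonneg (Real.exp_pos _).le (ramp_nonneg _ _ _)
  rw [tendsto_order]
  have hcont : Continuous fun h : ℝ => q * Real.exp (-(c + h)) := by fun_prop
  have hxp := hx.eventually_gt_atTop 0
  constructor
  · intro a ha
    have h1 : ∀ᶠ h in nhds (0:ℝ), a < q * Real.exp (-(c + h)) :=
      (hcont.tendsto 0).eventually_const_lt (by simpa using ha)
    have h2 : ∃ h : ℝ, 0 < h ∧ a < q * Real.exp (-(c + h)) := by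
      have := (h1.filter_mono (nhdsWithin_le_nhds (s := Ioi 0))).and self_mem_nhdsWithin
      obtain ⟨h, h3, h4⟩ := this.exists
      exact ⟨h, h4, h3⟩
    obtain ⟨h, hh, hha⟩ := h2
    obtain ⟨J, j1, j2, j3⟩ := hr (c + h) h hh
    filter_upwards [j3.eventually_const_lt (hha.trans_le j1), hxp] with n hn hn0
    exact hn.trans_le (mul_le_mul_of_nonneg_left (hsq c h hh n).1 hn0.le)
  · intro a ha
    have h1 : ∀ᶠ h in nhds (0:ℝ), q * Real.exp (-(c + h)) < a :=
      (hcont.tendsto 0).eventually_lt_const (by simpa using ha)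
    have h2 : ∃ h : ℝ, h < 0 ∧ q * Real.exp (-(c + h)) < a := by
      have := (h1.filter_mono (nhdsWithin_le_nhds (s := Iio 0))).and self_mem_nhdsWithin
      obtain ⟨h, h3, h4⟩ := this.exists
      exact ⟨h, h4, h3⟩
    obtain ⟨h, hh, hha⟩ := h2
    obtain ⟨J, j1, j2, j3⟩ := hr c (-h) (by linarith)
    rw [sub_neg_eq_add] at j2
    filter_upwards [j3.eventually_lt_const (j2.trans_lt hha), hxp] with n hn hn0
    exact (mul_le_mul_of_nonneg_left (hsq c (-h) (by linarith) n).2 hn0.le).trans_lt hn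

end CMD
end

open MeasureTheory Filter Asymptotics Set
noncomputable section
namespace CMD
open ProbabilityTheory

def RR {k : ℕ} (b : ℝ) (x : Fin k → ℝ) : ℝ := b * SS x + (-(b ^ 2) / 2) * QQ x

@[fun_prop] lemma meas_RR {k : ℕ} (b : ℝ) : Measurable (RR (k := k) b) := by unfold RR; fun_prop

def lamM (k : ℕ) (ν : Measure ℝ) (b X : ℝ) : Measure ℝ :=
  ((PI k ν).withDensity (fun x => ENNReal.ofReal (Real.exp (RR b x)))).map (fun x => RR b x - X ^ 2 / 2)

lemma exp_int1 {p C : ℝ} (hp2 : 2 ≤ p) (hp3 : p ≤ 3) {ν : Measure ℝ} (h : Good p C ν) {l : ℝ}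
    (hl : 1 / 8 ≤ l) (hl' : l ≤ 3 / 2) (b : ℝ) :
    Integrable (fun y : ℝ => Real.exp (b * y + (-(l * b ^ 2)) * y ^ 2)) ν ∧
    |∫ y : ℝ, Real.exp (b * y + (-(l * b ^ 2)) * y ^ 2) ∂ν - 1 - (1 / 2 - l) * b ^ 2| ≤ KK * C * |b| ^ p := by
  have := expand_int (𝕜 := ℝ) h (Ψ := fun y => Real.exp (y - l * y ^ 2)) (by fun_prop) (A := 1) (B := 1 / 2 - l) (K := KK)
    (fun y => by
      have := E1 hp2 hp3 hl hl' y
      simpa using this) b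
  have e : ∀ y : ℝ, b * y - l * (b * y) ^ 2 = b * y + (-(l * b ^ 2)) * y ^ 2 := fun y => by ring
  simp only [e] at this
  simpa using this

lemma expR_int {p C : ℝ} (hp2 : 2 ≤ p) (hp3 : p ≤ 3) {ν : Measure ℝ} (h : Good p C ν) (k : ℕ) (b : ℝ) :
    Integrable (fun x : Fin k → ℝ => Real.exp (RR b x)) (PI k ν) := by
  have := h.prob
  have h1 := (exp_int1 hp2 hp3 h (l := 1/2) (by norm_num) (by norm_num) b).1
  refine PI_rexp_int k ν b (-(b ^ 2) / 2) ?_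
  rw [show -(b ^ 2) / 2 = -(1 / 2 * b ^ 2) by ring]
  exact h1

lemma lamM_fin {p C : ℝ} (hp2 : 2 ≤ p) (hp3 : p ≤ 3) {ν : Measure ℝ} (h : Good p C ν) (k : ℕ) (b X : ℝ) :
    IsFiniteMeasure (lamM k ν b X) := by
  unfold lamM
  have : IsFiniteMeasure ((PI k ν).withDensity (fun x => ENNReal.ofReal (Real.exp (RR b x)))) :=
    isFiniteMeasure_withDensity_ofReal (expR_int hp2 hp3 h k b).2
  infer_instance

lemma lamM_nz {p C : ℝ} {ν : Measure ℝ} (h : Good p C ν) (k : ℕ) (b X : ℝ) :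
    NeZero (lamM k ν b X) := by
  have := h.prob
  constructor
  unfold lamM
  rw [Ne, Measure.map_eq_zero_iff (by fun_prop), withDensity_eq_zero_iff (by fun_prop)]
  intro h0
  have : ∀ᵐ x ∂(PI k ν), False := by
    filter_upwards [h0] with x hx
    have := Real.exp_pos (RR b x)
    simp at hx
    linarith
  simp at this
  exact IsProbabilityMeasure.ne_zero _ this

lemma lamM_integral {E : Type*} [NormedAddCommGroup E] [NormedSpace ℝ E] (k : ℕ) (ν : Measure ℝ)
    (b X : ℝ) {f : ℝ → E} (hf : StronglyMeasurable f) :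
    ∫ y, f y ∂(lamM k ν b X) = ∫ x, Real.exp (RR b x) • f (RR b x - X ^ 2 / 2) ∂(PI k ν) := by
  unfold lamM
  rw [integral_map (by fun_prop) hf.aestronglyMeasurable,
    integral_withDensity_eq_integral_toReal_smul (by fun_prop) (ae_of_all _ fun _ => by simp)]
  congr 1; ext x
  rw [ENNReal.toReal_ofReal (Real.exp_pos _).le]

def φt (ν : Measure ℝ) (b s : ℝ) : ℂ :=
  Complex.exp (-(Complex.I * (s * b ^ 2 / 2 : ℝ))) *
    ∫ y : ℝ, Complex.exp ((1 + Complex.I * s) * ((b * y - (b * y) ^ 2 / 2 : ℝ) : ℂ)) ∂ν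

lemma lamM_charFun (k : ℕ) (ν : Measure ℝ) [IsProbabilityMeasure ν] {b X : ℝ} (hX : k * b ^ 2 = X ^ 2) (s : ℝ) :
    charFun (lamM k ν b X) s = φt ν b s ^ k := by
  rw [charFun_apply_real, lamM_integral k ν b X (Continuous.stronglyMeasurable (by fun_prop))]
  unfold φt
  have h1 := PI_cexp k ν ((1 + Complex.I * s) * b) ((1 + Complex.I * s) * (-(b ^ 2) / 2))
  rw [mul_pow, ← Complex.exp_nat_mul]
  have e2 : ∀ y : ℝ, ((1 + Complex.I * s) * ((b * y - (b * y) ^ 2 / 2 : ℝ) : ℂ)) =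
      (1 + Complex.I * s) * b * y + (1 + Complex.I * s) * (-(b ^ 2) / 2) * y ^ 2 := by
    intro y; push_cast; ring
  simp_rw [e2]
  rw [← h1, ← integral_const_mul]
  congr 1; ext x
  rw [Complex.real_smul, Complex.ofReal_exp, ← Complex.exp_add, ← Complex.exp_add]
  congr 1
  have hX' : (k : ℂ) * (b : ℂ) ^ 2 = (X : ℂ) ^ 2 := by exact_mod_cast hX
  unfold RR
  push_cast
  rw [← hX']
  ring

lemma bpow4 {b p : ℝ} (hb0 : 0 < b) (hb1 : b ≤ 1) (hp3 : p ≤ 3) : b ^ 4 ≤ b ^ p := by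
  rw [← Real.rpow_natCast b 4]
  exact Real.rpow_le_rpow_of_exponent_ge hb0 hb1 (by norm_num; linarith)

lemma phi_bound {p C : ℝ} (hp2 : 2 ≤ p) (hp3 : p ≤ 3) {ν : Measure ℝ} (h : Good p C ν) {b : ℝ}
    (hb0 : 0 < b) (hb1 : b ≤ 1) (s : ℝ) :
    ‖φt ν b s - 1 - ((-(s ^ 2 * b ^ 2 / 2) : ℝ) : ℂ)‖ ≤ (4 * KK * C + 1) * (1 + |s|) ^ 3 * b ^ p := by
  have h1 := (expand_int (𝕜 := ℂ) h (Ψ := fun y => Complex.exp ((1 + Complex.I * s) * ((y - y ^ 2 / 2 : ℝ) : ℂ)))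
    (by fun_prop) (E3 hp2 hp3 s) b).2
  rw [abs_of_pos hb0] at h1
  set J := ∫ y : ℝ, Complex.exp ((1 + Complex.I * s) * ((b * y - (b * y) ^ 2 / 2 : ℝ) : ℂ)) ∂ν with hJ
  set θ : ℝ := s * b ^ 2 / 2 with hθ
  have e1n : ‖Complex.exp (-(Complex.I * (θ : ℝ)))‖ = 1 := by
    rw [show -(Complex.I * (θ : ℂ)) = ((-θ : ℝ) : ℂ) * Complex.I by push_cast; ring]
    exact Complex.norm_exp_ofReal_mul_I _
  have hs : 0 ≤ |s| := abs_nonneg s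
  -- |e^{-iθ} - 1| ≤ |θ|, |e^{-iθ}(1+iθ) - 1| ≤ θ²
  have hA : ‖Complex.exp (-(Complex.I * (θ : ℝ))) - 1‖ ≤ |θ| := by
    rw [show -(Complex.I * (θ : ℂ)) = Complex.I * ((-θ : ℝ) : ℂ) by push_cast; ring]
    have := Real.norm_exp_I_mul_ofReal_sub_one_le (x := -θ)
    simpa using this
  have hB : ‖Complex.exp (-(Complex.I * (θ : ℝ))) * (1 + Complex.I * θ) - 1‖ ≤ 4 * θ ^ 2 := by
    have e : Complex.exp (-(Complex.I * (θ : ℝ))) * (1 + Complex.I * θ) - 1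
        = - (Complex.exp (-(Complex.I * (θ : ℝ))) * (Complex.exp (Complex.I * (θ : ℝ)) - 1 - Complex.I * θ)) := by
      have : Complex.exp (-(Complex.I * (θ : ℝ))) * Complex.exp (Complex.I * (θ : ℝ)) = 1 := by
        rw [← Complex.exp_add]; simp
      linear_combination this
    rw [e, norm_neg, norm_mul, e1n, one_mul]
    have := iexp1 θ
    rwa [sq_abs] at this
  have hφ : φt ν b s = Complex.exp (-(Complex.I * (θ : ℝ))) * J := rfl
  have dec : φt ν b s - 1 - ((-(s ^ 2 * b ^ 2 / 2) : ℝ) : ℂ) =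
      Complex.exp (-(Complex.I * (θ : ℝ))) * (J - 1 - ((Complex.I * s - s ^ 2) / 2) * (b : ℂ) ^ 2)
      + (Complex.exp (-(Complex.I * (θ : ℝ))) * (1 + Complex.I * θ) - 1)
      - ((s ^ 2 * b ^ 2 / 2 : ℝ) : ℂ) * (Complex.exp (-(Complex.I * (θ : ℝ))) - 1) := by
    rw [hφ, hθ]; push_cast; ring
  rw [dec]
  have hC := h.C_nonneg
  have hK := KK_ge
  calc _ ≤ 1 * (4 * KK * (1 + |s|) ^ 3 * C * b ^ p) + 4 * θ ^ 2 + (s ^ 2 * b ^ 2 / 2) * |θ| := by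
        refine (norm_sub_le _ _).trans (add_le_add ((norm_add_le _ _).trans (add_le_add ?_ hB)) ?_)
        · rw [norm_mul, e1n]
          gcongr
          exact h1
        · rw [norm_mul, Complex.norm_real, Real.norm_of_nonneg (by positivity)]
          gcongr
    _ ≤ 1 * (4 * KK * (1 + |s|) ^ 3 * C * b ^ p) + (1 + |s|) ^ 3 * b ^ p := by
        rw [add_assoc]
        gcongr
        have hθa : |θ| = |s| * b ^ 2 / 2 := by
          rw [hθ, abs_div, abs_mul, abs_of_pos (pow_pos hb0 2)]; norm_num
        rw [hθa, ← sq_abs θ, hθa, ← sq_abs s]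
        calc 4 * (|s| * b ^ 2 / 2) ^ 2 + |s| ^ 2 * b ^ 2 / 2 * (|s| * b ^ 2 / 2)
            = (|s| ^ 2 + |s| ^ 3 / 4) * b ^ 4 := by ring
          _ ≤ (1 + |s|) ^ 3 * b ^ 4 := by
              gcongr
              nlinarith [pow_nonneg hs 2, pow_nonneg hs 3]
          _ ≤ _ := by
              gcongr
              exact bpow4 hb0 hb1 hp3
    _ = _ := by ring

lemma phi_mod1 {p C : ℝ} (hp2 : 2 ≤ p) (hp3 : p ≤ 3) {ν : Measure ℝ} (h : Good p C ν) {b : ℝ}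
    (hb0 : 0 < b) (hb1 : b ≤ 1) {s : ℝ} (hs : 16 * (4 * KK * C + 1) * |s| * b ^ (p - 2) ≤ 1) :
    ‖φt ν b s‖ ≤ Real.exp (-(s ^ 2 * b ^ 2 / 4) + 4 * (4 * KK * C + 1) * b ^ p) := by
  have hb := phi_bound hp2 hp3 h hb0 hb1 s
  have hC := h.C_nonneg
  have hK := KK_ge
  set K1 := 4 * KK * C + 1 with hK1
  have hK1' : 1 ≤ K1 := by rw [hK1]; nlinarith [mul_nonneg (by linarith : 0 ≤ KK) hC]
  have hs0 : 0 ≤ |s| := abs_nonneg s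
  have hbp : b ^ p = b ^ 2 * b ^ (p - 2) := by
    rw [← Real.rpow_natCast b 2, ← Real.rpow_add hb0]; congr 1; push_cast; ring
  have hbp0 : 0 < b ^ (p - 2) := Real.rpow_pos_of_pos hb0 _
  have hbb : b ≤ b ^ (p - 2) := by
    conv_lhs => rw [← Real.rpow_one b]
    exact Real.rpow_le_rpow_of_exponent_ge hb0 hb1 (by linarith)
  have hsb : |s| * b ≤ 1 := by
    have : |s| * b ≤ |s| * b ^ (p - 2) := by gcongr
    have h2 : 0 ≤ |s| * b ^ (p - 2) := by positivity
    nlinarith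
  have hsb2 : s ^ 2 * b ^ 2 ≤ 1 := by
    rw [← sq_abs s, ← mul_pow]
    exact pow_le_one₀ (by positivity) hsb
  have h3 : (1 + |s|) ^ 3 ≤ 4 * (1 + |s| ^ 3) := by nlinarith [mul_nonneg (add_nonneg zero_le_one hs0) (sq_nonneg (|s| - 1))]
  have h4 : 4 * K1 * |s| ^ 3 * b ^ p ≤ s ^ 2 * b ^ 2 / 4 := by
    rw [hbp, ← sq_abs s]
    have : 4 * K1 * |s| ^ 3 * (b ^ 2 * b ^ (p - 2)) = (|s| ^ 2 * b ^ 2 / 4) * (16 * K1 * |s| * b ^ (p - 2)) := by ring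
    rw [this]
    exact mul_le_of_le_one_right (by positivity) hs
  have h5 : ‖φt ν b s‖ ≤ ‖φt ν b s - 1 - ((-(s ^ 2 * b ^ 2 / 2) : ℝ) : ℂ)‖ + ‖((1 - s ^ 2 * b ^ 2 / 2 : ℝ) : ℂ)‖ := by
    refine le_trans (le_of_eq ?_) (norm_add_le _ _)
    congr 1; push_cast; ring
  rw [Complex.norm_real, Real.norm_of_nonneg (by linarith)] at h5
  have h6 : K1 * (1 + |s|) ^ 3 * b ^ p ≤ K1 * (4 * (1 + |s| ^ 3)) * b ^ p := by gcongr
  refine le_trans ?_ (Real.add_one_le_exp _)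
  nlinarith

lemma phi_mod2 {p C : ℝ} (hp2 : 2 ≤ p) (hp3 : p ≤ 3) {ν : Measure ℝ} (h : Good p C ν) {b : ℝ}
    (hb0 : 0 < b) (s : ℝ) :
    ‖φt ν b s‖ ≤ Real.exp (KK * C * b ^ p) := by
  have h1 := (exp_int1 hp2 hp3 h (l := 1/2) (by norm_num) (by norm_num) b).2
  rw [abs_of_pos hb0, abs_le] at h1
  unfold φt
  rw [norm_mul, show -(Complex.I * ((s * b ^ 2 / 2 : ℝ) : ℂ)) = ((-(s * b ^ 2 / 2) : ℝ) : ℂ) * Complex.I by push_cast; ring,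
    Complex.norm_exp_ofReal_mul_I, one_mul]
  refine (norm_integral_le_integral_norm _).trans ?_
  have e : ∀ y : ℝ, ‖Complex.exp ((1 + Complex.I * s) * ((b * y - (b * y) ^ 2 / 2 : ℝ) : ℂ))‖ =
      Real.exp (b * y + (-(1 / 2 * b ^ 2)) * y ^ 2) := by
    intro y
    rw [Complex.norm_exp, Complex.re_mul_ofReal]
    congr 1
    simp
    ring
  simp_rw [e]
  refine le_trans ?_ (Real.add_one_le_exp _)
  linarith [h1.2]


/-- Standing assumptions for the large deviation regime. -/
structure RegB (p C : ℝ) (k : ℕ → ℕ) (ν : ℕ → Measure ℝ) (b x : ℕ → ℝ) : Prop where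
  hp2 : 2 < p
  hp3 : p ≤ 3
  hν : ∀ n, Good p C (ν n)
  hk : Tendsto k atTop atTop
  hb : ∀ n, 0 < b n
  hx : Tendsto x atTop atTop
  hkb : ∀ n, k n * b n ^ 2 = x n ^ 2
  hd : Tendsto (fun n => k n * b n ^ p) atTop (nhds 0)

namespace RegB
variable {p C : ℝ} {k : ℕ → ℕ} {ν : ℕ → Measure ℝ} {b x : ℕ → ℝ}

lemma kbp (h : RegB p C k ν b x) (n : ℕ) : k n * b n ^ p = x n ^ 2 * b n ^ (p - 2) := by
  rw [← h.hkb n, mul_assoc]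
  congr 1
  rw [← Real.rpow_natCast (b n) 2, ← Real.rpow_add (h.hb n)]; congr 1; push_cast; ring

lemma b_le (h : RegB p C k ν b x) : ∀ᶠ n in atTop, b n ≤ 1 := by
  filter_upwards [h.hd.eventually_lt_const (show (0:ℝ) < 1 by norm_num), h.hx.eventually_ge_atTop 1] with n h1 h2
  rw [h.kbp n] at h1
  by_contra hc
  push Not at hc
  have : 1 ≤ b n ^ (p - 2) := Real.one_le_rpow hc.le (by linarith [h.hp2])
  nlinarith

lemma charLim (h : RegB p C k ν b x) (u : ℝ) :
    Tendsto (fun n => charFun (lamM (k n) (ν n) (b n) (x n)) (u / x n)) atTop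
      (nhds (Real.exp (-(u ^ 2) / 2) : ℂ)) := by
  have hpr : ∀ n, IsProbabilityMeasure (ν n) := fun n => (h.hν n).prob
  simp_rw [lamM_charFun _ _ (h.hkb _)]
  rw [Complex.ofReal_exp]
  have hC := (h.hν 0).C_nonneg
  have hK := KK_ge
  refine pow_lim' h.hk (v := fun n => ((-((u / x n) ^ 2 * b n ^ 2 / 2) : ℝ) : ℂ))
    (e := fun n => (4 * KK * C + 1) * (1 + |u|) ^ 3 * b n ^ p) ?_ ?_ ?_
  · filter_upwards [h.b_le, h.hx.eventually_ge_atTop 1] with n h1 h2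
    refine (phi_bound h.hp2.le h.hp3 (h.hν n) (h.hb n) h1 _).trans ?_
    have hbp : 0 < b n ^ p := Real.rpow_pos_of_pos (h.hb n) _
    have : |u / x n| ≤ |u| := by
      rw [abs_div, abs_of_pos (by linarith : 0 < x n)]
      exact div_le_self (abs_nonneg _) h2
    gcongr
  · refine tendsto_const_nhds.congr' ?_
    filter_upwards [h.hx.eventually_ge_atTop 1] with n h2
    have h3 := h.hkb n
    have hx0 : x n ≠ 0 := by positivity
    have : -(u ^ 2) / 2 = (k n : ℝ) * (-((u / x n) ^ 2 * b n ^ 2 / 2)) := by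
      have : (k n : ℝ) * (-((u / x n) ^ 2 * b n ^ 2 / 2)) = - ((u / x n) ^ 2 * (k n * b n ^ 2) / 2) := by ring
      rw [this, h3]
      field_simp
    rw [this]
    push_cast
    rfl
  · have := h.hd.const_mul ((4 * KK * C + 1) * (1 + |u|) ^ 3)
    rw [mul_zero] at this
    refine this.congr fun n => ?_
    ring

def DD (u : ℝ) : ℝ := 2 * Real.exp (-(1/4) * u ^ 2) + 2 * Real.exp (-√|u|)

lemma DD_int : Integrable DD := by
  unfold DD
  refine ((integrable_exp_neg_mul_sq (by norm_num)).const_mul 2).add (Integrable.const_mul ?_ 2)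
  have h1 : IntegrableOn (fun u : ℝ => Real.exp (-√|u|)) (Ioi 0) := by
    have := integrableOn_rpow_mul_exp_neg_rpow (s := 0) (p := 1/2) (by norm_num) (by norm_num)
    refine this.congr_fun (fun u hu => ?_) measurableSet_Ioi
    have hu' : 0 < u := hu
    simp only [Real.rpow_zero, one_mul]
    rw [abs_of_pos hu', Real.sqrt_eq_rpow]
  rw [← integrableOn_univ, ← Iic_union_Ioi (a := (0:ℝ)), integrableOn_union]
  refine ⟨?_, h1⟩
  have h2 : IntegrableOn (fun u : ℝ => Real.exp (-√|u|)) (Iio 0) := by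
    have := IntegrableOn.comp_neg_Iio (c := 0) (f := fun u : ℝ => Real.exp (-√|u|)) (by simpa using h1)
    simpa using this
  exact (integrableOn_Iic_iff_integrableOn_Iio (by simp)).2 h2

lemma charDom (h : RegB p C k ν b x) : ∀ᶠ n in atTop, ∀ u,
    Real.exp (-|u / x n|) * ‖charFun (lamM (k n) (ν n) (b n) (x n)) (u / x n)‖ ≤ DD u := by
  have hpr : ∀ n, IsProbabilityMeasure (ν n) := fun n => (h.hν n).prob
  simp_rw [lamM_charFun _ _ (h.hkb _)]
  have hC := (h.hν 0).C_nonneg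
  have hK := KK_ge
  have hKC : 0 ≤ KK * C := mul_nonneg (by linarith) hC
  have hd1 : ∀ᶠ n in atTop, 16 * (4 * KK * C + 1) * (k n * b n ^ p) < Real.log 2 := by
    have := h.hd.const_mul (16 * (4 * KK * C + 1))
    rw [mul_zero] at this
    exact this.eventually_lt_const (Real.log_pos (by norm_num))
  filter_upwards [h.b_le, h.hx.eventually_ge_atTop 1, hd1] with n h1 h2 h3 u
  have hxp : 0 < x n := by linarith
  have hb := h.hb n
  have hkbp := h.kbp n
  have hl2 : Real.log 2 < 1 := by linarith [Real.log_two_lt_d9]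
  have hkp0 : 0 ≤ k n * b n ^ p := by positivity
  rw [norm_pow]
  by_cases hs : 16 * (4 * KK * C + 1) * |u / x n| * b n ^ (p - 2) ≤ 1
  · have h4 := phi_mod1 h.hp2.le h.hp3 (h.hν n) hb h1 hs
    have h5 : ‖φt (ν n) (b n) (u / x n)‖ ^ k n ≤ 2 * Real.exp (-(1/4) * u ^ 2) := by
      refine (pow_le_pow_left₀ (norm_nonneg _) h4 _).trans ?_
      rw [← Real.exp_nat_mul]
      have e0 : (2:ℝ) * Real.exp (-(1/4) * u ^ 2) = Real.exp (Real.log 2 + -(1/4) * u ^ 2) := by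
        rw [Real.exp_add, Real.exp_log (by norm_num)]
      rw [e0]
      apply Real.exp_le_exp.2
      have e : (k n : ℝ) * (-((u / x n) ^ 2 * b n ^ 2 / 4) + 4 * (4 * KK * C + 1) * b n ^ p) =
        -(1/4) * ((u / x n) ^ 2 * (k n * b n ^ 2)) + 4 * (4 * KK * C + 1) * (k n * b n ^ p) := by ring
      rw [e, h.hkb n]
      have e2 : (u / x n) ^ 2 * x n ^ 2 = u ^ 2 := by field_simp
      rw [e2]
      nlinarith
    have h6 : Real.exp (-|u / x n|) ≤ 1 := Real.exp_le_one_iff.2 (by simp)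
    unfold DD
    have : 0 ≤ 2 * Real.exp (-√|u|) := by positivity
    have h7 := mul_le_mul h6 h5 (by positivity) zero_le_one
    linarith
  · push Not at hs
    have h4 := phi_mod2 h.hp2.le h.hp3 (h.hν n) hb (u / x n)
    have h5 : ‖φt (ν n) (b n) (u / x n)‖ ^ k n ≤ 2 := by
      refine (pow_le_pow_left₀ (norm_nonneg _) h4 _).trans ?_
      rw [← Real.exp_nat_mul]
      conv_rhs => rw [← Real.exp_log (show (0:ℝ) < 2 by norm_num)]
      apply Real.exp_le_exp.2
      have : (k n : ℝ) * (KK * C * b n ^ p) = KK * C * (k n * b n ^ p) := by ring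
      rw [this]
      nlinarith
    -- |u / x| ≥ x²
    have h6 : x n ^ 2 ≤ |u / x n| := by
      by_contra hc
      push Not at hc
      have hbp : 0 < b n ^ (p - 2) := Real.rpow_pos_of_pos hb _
      have : 16 * (4 * KK * C + 1) * |u / x n| * b n ^ (p - 2) ≤ 16 * (4 * KK * C + 1) * x n ^ 2 * b n ^ (p - 2) := by
        gcongr
      rw [hkbp] at h3
      nlinarith
    have h7 : √|u| ≤ |u / x n| := by
      apply Real.sqrt_le_iff.2
      refine ⟨abs_nonneg _, ?_⟩
      have e : |u| = |u / x n| * x n := by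
        rw [abs_div, abs_of_pos hxp]; field_simp
      rw [e, sq]
      gcongr
      nlinarith
    unfold DD
    have : 0 ≤ 2 * Real.exp (-(1/4) * u ^ 2) := by positivity
    have h8 : Real.exp (-|u / x n|) ≤ Real.exp (-√|u|) := Real.exp_le_exp.2 (by linarith)
    have h9 := mul_le_mul h8 h5 (by positivity) (Real.exp_pos _).le
    linarith

/-- Sharp tail of R. -/
lemma tailR (h : RegB p C k ν b x) (c : ℝ) :
    Tendsto (fun n => x n * Real.exp (x n ^ 2 / 2) *
      (PI (k n) (ν n)).real {ω | x n ^ 2 / 2 + c ≤ RR (b n) ω})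
      atTop (nhds ((√(2 * Real.pi))⁻¹ * Real.exp (-c))) := by
  have i1 : ∀ n, IsFiniteMeasure (lamM (k n) (ν n) (b n) (x n)) :=
    fun n => lamM_fin h.hp2.le h.hp3 (h.hν n) _ _ _
  have i2 : ∀ n, NeZero (lamM (k n) (ν n) (b n) (x n)) := fun n => lamM_nz (h.hν n) _ _ _
  have hpr : ∀ n, IsProbabilityMeasure (ν n) := fun n => (h.hν n).prob
  have := local_tail h.hx DD_int h.charDom h.charLim c
  refine this.congr fun n => ?_
  rw [mul_assoc]
  congr 1
  rw [← integral_indicator measurableSet_Ici, lamM_integral]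
  · have hm : MeasurableSet {ω : Fin (k n) → ℝ | x n ^ 2 / 2 + c ≤ RR (b n) ω} :=
      measurableSet_le measurable_const (by fun_prop)
    rw [← integral_indicator_one hm, ← integral_const_mul]
    congr 1; ext ω
    by_cases hω : x n ^ 2 / 2 + c ≤ RR (b n) ω
    · rw [indicator_of_mem (show RR (b n) ω - x n ^ 2 / 2 ∈ Ici c by simp; linarith), indicator_of_mem (by exact hω)]
      rw [smul_eq_mul, ← Real.exp_add]
      simp
    · rw [indicator_of_notMem (show RR (b n) ω - x n ^ 2 / 2 ∉ Ici c by simp; linarith), indicator_of_notMem (by exact hω)]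
      simp
  · refine StronglyMeasurable.indicator ?_ measurableSet_Ici
    exact Continuous.stronglyMeasurable (by fun_prop)

end RegB

end CMD
end

open MeasureTheory Filter Asymptotics Set
noncomputable section
namespace CMD
open ProbabilityTheory

lemma cheb {Ω : Type*} [MeasurableSpace Ω] {P : Measure Ω} [IsFiniteMeasure P] {E : Set Ω} {g : Ω → ℝ}
    (hg : Integrable g P) (h0 : ∀ ω, 0 ≤ g ω) {c M : ℝ} (hc : 0 < c) (hE : ∀ ω ∈ E, c ≤ g ω)
    (hM : ∫ ω, g ω ∂P ≤ M) : P.real E ≤ M / c := by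
  rw [le_div_iff₀ hc]
  have h1 := mul_meas_ge_le_integral_of_nonneg (ae_of_all _ h0) hg c
  have h2 : P.real E ≤ P.real {x | c ≤ g x} := measureReal_mono (fun ω hω => hE ω hω)
  have h3 : P.real {x | c ≤ g x} = (P {x | c ≤ g x}).toReal := rfl
  nlinarith

section
variable {p C : ℝ} {ν : Measure ℝ}

lemma momInt (hp2 : 2 ≤ p) (hp3 : p ≤ 3) (h : Good p C ν) {l : ℝ} (hl : 1 / 8 ≤ l) (hl' : l ≤ 3 / 2)
    (b : ℝ) (k : ℕ) :
    Integrable (fun x : Fin k → ℝ => Real.exp (b * SS x + (-(l * b ^ 2)) * QQ x)) (PI k ν) := by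
  have := h.prob
  exact PI_rexp_int k ν _ _ (exp_int1 hp2 hp3 h hl hl' b).1

lemma m_le (hp2 : 2 ≤ p) (hp3 : p ≤ 3) (h : Good p C ν) {l : ℝ} (hl : 1 / 8 ≤ l) (hl' : l ≤ 3 / 2)
    {b : ℝ} (hb : 0 ≤ b) (k : ℕ) :
    (∫ y : ℝ, Real.exp (b * y + (-(l * b ^ 2)) * y ^ 2) ∂ν) ^ k ≤
      Real.exp ((1 / 2 - l) * (k * b ^ 2) + KK * C * (k * b ^ p)) := by
  have h1 := (abs_le.1 (exp_int1 hp2 hp3 h hl hl' b).2).2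
  rw [abs_of_nonneg hb] at h1
  have h2 := Real.add_one_le_exp ((1 / 2 - l) * b ^ 2 + KK * C * b ^ p)
  refine (pow_le_pow_left₀ (integral_nonneg fun _ => (Real.exp_pos _).le)
    (show _ ≤ Real.exp ((1 / 2 - l) * b ^ 2 + KK * C * b ^ p) by linarith) k).trans (le_of_eq ?_)
  rw [← Real.exp_nat_mul]; congr 1; ring

lemma momLe (hp2 : 2 ≤ p) (hp3 : p ≤ 3) (h : Good p C ν) {l : ℝ} (hl : 1 / 8 ≤ l) (hl' : l ≤ 3 / 2)
    {b : ℝ} (hb : 0 ≤ b) (k : ℕ) :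
    ∫ x : Fin k → ℝ, Real.exp (b * SS x + (-(l * b ^ 2)) * QQ x) ∂(PI k ν) ≤
      Real.exp ((1 / 2 - l) * (k * b ^ 2) + KK * C * (k * b ^ p)) := by
  have := h.prob
  rw [PI_rexp]
  exact m_le hp2 hp3 h hl hl' hb k

lemma bsq {k : ℕ} (b : ℝ) (ω : Fin k → ℝ) : (b * √(QQ ω)) ^ 2 = b ^ 2 * QQ ω := by
  rw [mul_pow, Real.sq_sqrt (QQ_nonneg _)]

lemma bd1 (hp2 : 2 ≤ p) (hp3 : p ≤ 3) (h : Good p C ν) {k : ℕ} {b x ε : ℝ} (hb : 0 < b) (hx : 0 < x)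
    (hkb : k * b ^ 2 = x ^ 2) (hε : 0 < ε) :
    (PI k ν).real {ω | x * √(QQ ω) ≤ SS ω ∧ x + ε < b * √(QQ ω) ∧ b * √(QQ ω) ≤ 3 * x} ≤
      Real.exp (-x ^ 2 / 2 - ε * x / 4 + KK * C * (k * b ^ p)) := by
  have := h.prob
  have := cheb (momInt hp2 hp3 h (l := 1/8) (by norm_num) (by norm_num) b k) (fun _ => (Real.exp_pos _).le)
    (E := {ω | x * √(QQ ω) ≤ SS ω ∧ x + ε < b * √(QQ ω) ∧ b * √(QQ ω) ≤ 3 * x})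
    (c := Real.exp (7 / 8 * x ^ 2 + ε * x / 4)) (Real.exp_pos _) ?_
    (momLe hp2 hp3 h (l := 1/8) (by norm_num) (by norm_num) hb.le k)
  · refine this.trans (le_of_eq ?_)
    rw [← Real.exp_sub, hkb]; congr 1; ring
  · rintro ω ⟨h1, h2, h3⟩
    apply Real.exp_le_exp.2
    have e := bsq b ω
    have h4 : x * (b * √(QQ ω)) ≤ b * SS ω := by nlinarith
    set v := b * √(QQ ω)
    nlinarith [mul_pos hε hx, mul_nonneg (show 0 ≤ v - x - ε by linarith) hx.le,
      mul_nonneg (show 0 ≤ v - x by linarith) (show 0 ≤ 3 * x - v by linarith)]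

lemma bd2 (hp2 : 2 ≤ p) (hp3 : p ≤ 3) (h : Good p C ν) {k : ℕ} {b x ε : ℝ} (hb : 0 < b) (hx : 0 < x)
    (hkb : k * b ^ 2 = x ^ 2) (hε : 0 < ε) :
    (PI k ν).real {ω | x * √(QQ ω) ≤ SS ω ∧ b * √(QQ ω) < x - ε} ≤
      Real.exp (-x ^ 2 / 2 - ε * x / 2 + KK * C * (k * b ^ p)) := by
  have := h.prob
  have := cheb (momInt hp2 hp3 h (l := 3/2) (by norm_num) (by norm_num) b k) (fun _ => (Real.exp_pos _).le)
    (E := {ω | x * √(QQ ω) ≤ SS ω ∧ b * √(QQ ω) < x - ε})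
    (c := Real.exp (-x ^ 2 / 2 + ε * x / 2)) (Real.exp_pos _) ?_
    (momLe hp2 hp3 h (l := 3/2) (by norm_num) (by norm_num) hb.le k)
  · refine this.trans (le_of_eq ?_)
    rw [← Real.exp_sub, hkb]; congr 1; ring
  · rintro ω ⟨h1, h2⟩
    apply Real.exp_le_exp.2
    have e := bsq b ω
    have h4 : x * (b * √(QQ ω)) ≤ b * SS ω := by nlinarith
    have h5 : 0 ≤ b * √(QQ ω) := by positivity
    set v := b * √(QQ ω)
    nlinarith [mul_pos hε hx, mul_nonneg (show 0 ≤ x - ε - v by linarith) hx.le,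
      mul_nonneg (show 0 ≤ x - ε - v by linarith) h5, mul_nonneg hε.le h5]

lemma pow_diff_le {a c M : ℝ} (h0 : 0 ≤ c) (hca : c ≤ a) (haM : a ≤ M) (hM : 1 ≤ M) (k : ℕ) :
    a ^ k - c ^ k ≤ k * (a - c) * M ^ k := by
  induction k with
  | zero => simp
  | succ k ih =>
    have h1 : c ^ k ≤ M ^ k := pow_le_pow_left₀ h0 (hca.trans haM) k
    have h2 : 0 < M ^ k := by positivity
    have e : a ^ (k+1) - c ^ (k+1) = a * (a ^ k - c ^ k) + (a - c) * c ^ k := by ring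
    rw [e]
    have h3 : a * (a ^ k - c ^ k) ≤ M * (k * (a - c) * M ^ k) := by
      have : 0 ≤ a ^ k - c ^ k := sub_nonneg.2 (pow_le_pow_left₀ h0 hca k)
      exact mul_le_mul haM ih this (by linarith)
    have h4 : (a - c) * c ^ k ≤ (a - c) * (M * M ^ k) := by
      apply mul_le_mul_of_nonneg_left _ (by linarith)
      nlinarith
    push_cast
    rw [pow_succ]
    nlinarith

set_option maxHeartbeats 1000000 in
lemma bd3j (hp2 : 2 ≤ p) (hp3 : p ≤ 3) (h : Good p C ν) {k : ℕ} {b x : ℝ} (hb : 0 < b) (hx : 2 ≤ x)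
    (hkb : k * b ^ 2 = x ^ 2) (j : ℕ) :
    (PI k ν).real {ω | x * √(QQ ω) ≤ SS ω ∧ 3 ^ (j+1) * x ≤ b * √(QQ ω) ∧ b * √(QQ ω) ≤ 3 ^ (j+2) * x} ≤
      2 * (x ^ 2 + 2 * (KK * C) * (k * b ^ p)) * Real.exp (-(5/6) * x ^ 2 + KK * C * (k * b ^ p)) * (1/9) ^ (j+1) := by
  have hpr := h.prob
  have hD : 0 ≤ KK * C := mul_nonneg (by linarith [KK_ge]) h.C_nonneg
  set b' : ℝ := b / 3 ^ (j+1) with hb'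
  have hb'0 : 0 < b' := by positivity
  have h3 : (1:ℝ) ≤ 3 ^ (j+1) := one_le_pow₀ (by norm_num)
  have hb2 : b' ^ 2 = b ^ 2 * (1/9) ^ (j+1) := by
    rw [hb', div_pow, ← pow_mul, mul_comm (j+1) 2, pow_mul]; norm_num; rw [div_eq_mul_inv, one_div, inv_pow]
  have hbp : b' ^ p ≤ b ^ p * (1/9) ^ (j+1) := by
    have e : b' ^ p = b' ^ 2 * b' ^ (p - 2) := by
      rw [← Real.rpow_natCast b' 2, ← Real.rpow_add hb'0]; congr 1; push_cast; ring
    have e' : b ^ p = b ^ 2 * b ^ (p - 2) := by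
      rw [← Real.rpow_natCast b 2, ← Real.rpow_add hb]; congr 1; push_cast; ring
    rw [e, e', hb2]
    have : b' ^ (p-2) ≤ b ^ (p-2) :=
      Real.rpow_le_rpow hb'0.le (div_le_self hb.le h3) (by linarith)
    calc _ ≤ b ^ 2 * (1/9) ^ (j+1) * b ^ (p-2) := by gcongr
      _ = _ := by ring
  have h9 : ((1:ℝ)/9) ^ (j+1) ≤ 1/9 := by
    rw [pow_succ]; have : ((1:ℝ)/9)^j ≤ 1 := pow_le_one₀ (by norm_num) (by norm_num)
    nlinarith
  have h90 : 0 < ((1:ℝ)/9) ^ (j+1) := by positivity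
  set q : ℝ := (1/9) ^ (j+1)
  have hδ : 0 ≤ k * b ^ p := by positivity
  have i1 := momInt hp2 hp3 h (l := 1/8) (by norm_num) (by norm_num) b' k
  have i2 := momInt hp2 hp3 h (l := 1/2) (by norm_num) (by norm_num) b' k
  have key := cheb (i1.sub i2) ?_
    (E := {ω | x * √(QQ ω) ≤ SS ω ∧ 3 ^ (j+1) * x ≤ b * √(QQ ω) ∧ b * √(QQ ω) ≤ 3 ^ (j+2) * x})
    (c := 1 / 2 * Real.exp (7 / 8 * x ^ 2)) (by positivity) ?_
    (M := (x ^ 2 + 2 * (KK * C) * (k * b ^ p)) * q * Real.exp (x ^ 2 / 24 + KK * C * (k * b ^ p))) ?_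
  · refine key.trans (le_of_eq ?_)
    have e : Real.exp (-(5/6) * x ^ 2 + KK * C * (k * b ^ p)) =
      Real.exp (x ^ 2 / 24 + KK * C * (k * b ^ p)) / Real.exp (7 / 8 * x ^ 2) := by
      rw [← Real.exp_sub]; congr 1; ring
    rw [e]; field_simp
  · intro ω
    simp only [Pi.sub_apply]
    rw [sub_nonneg]
    apply Real.exp_le_exp.2
    have := QQ_nonneg ω
    nlinarith [mul_nonneg (sq_nonneg b') this]
  · rintro ω ⟨h1, h2, h3'⟩
    simp only [Pi.sub_apply]
    have e := bsq b' ω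
    have h4 : x * (b' * √(QQ ω)) ≤ b' * SS ω := by nlinarith
    have ev : b' * √(QQ ω) = (b * √(QQ ω)) / 3 ^ (j+1) := by rw [hb']; ring
    have h5 : x ≤ b' * √(QQ ω) := by rw [ev, le_div_iff₀ (by positivity)]; linarith
    have h6 : b' * √(QQ ω) ≤ 3 * x := by
      rw [ev, div_le_iff₀ (by positivity)]; rw [pow_succ] at h3'; linarith
    have e1 : Real.exp (b' * SS ω + -(1 / 2 * b' ^ 2) * QQ ω) =
      Real.exp (b' * SS ω + -(1 / 8 * b' ^ 2) * QQ ω) * Real.exp (-(3/8) * (b' ^ 2 * QQ ω)) := by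
      rw [← Real.exp_add]; congr 1; ring
    rw [← e] at e1
    have e2 : -(1 / 8 * b' ^ 2) * QQ ω = -(1/8) * (b' * √(QQ ω)) ^ 2 := by rw [e]; ring
    rw [e1, e2]
    set v := b' * √(QQ ω)
    have g1 : Real.exp (-(3/8) * v ^ 2) ≤ 1 / 2 := by
      have : -(3/8) * v ^ 2 ≤ -1 := by nlinarith
      refine (Real.exp_le_exp.2 this).trans ?_
      linarith [Real.exp_neg_one_lt_d9]
    have g2 : Real.exp (7 / 8 * x ^ 2) ≤ Real.exp (b' * SS ω + -(1/8) * v ^ 2) := by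
      apply Real.exp_le_exp.2
      nlinarith [mul_nonneg (show 0 ≤ v - x by linarith) (show 0 ≤ 3 * x - v by linarith)]
    have g3 := Real.exp_pos (b' * SS ω + -(1/8) * v ^ 2)
    nlinarith
  · simp only [Pi.sub_apply]
    rw [integral_sub i1 i2, PI_rexp, PI_rexp]
    have j1 := exp_int1 hp2 hp3 h (l := 1/8) (by norm_num) (by norm_num) b'
    have j2 := exp_int1 hp2 hp3 h (l := 1/2) (by norm_num) (by norm_num) b'
    have hle : ∫ y : ℝ, Real.exp (b' * y + -(1/2 * b' ^ 2) * y ^ 2) ∂ν ≤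
        ∫ y : ℝ, Real.exp (b' * y + -(1/8 * b' ^ 2) * y ^ 2) ∂ν := by
      apply integral_mono j2.1 j1.1
      intro y
      apply Real.exp_le_exp.2
      nlinarith [mul_nonneg (sq_nonneg b') (sq_nonneg y)]
    have a1 := abs_le.1 j1.2
    have a2 := abs_le.1 j2.2
    rw [abs_of_pos hb'0] at a1 a2
    have hup : ∫ y : ℝ, Real.exp (b' * y + -(1/8 * b' ^ 2) * y ^ 2) ∂ν ≤
        Real.exp (3/8 * b' ^ 2 + KK * C * b' ^ p) := by
      have := Real.add_one_le_exp (3/8 * b' ^ 2 + KK * C * b' ^ p)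
      linarith
    have h0 : 0 ≤ ∫ y : ℝ, Real.exp (b' * y + -(1/2 * b' ^ 2) * y ^ 2) ∂ν :=
      integral_nonneg fun _ => (Real.exp_pos _).le
    have fin := pow_diff_le h0 hle hup (Real.one_le_exp (by positivity)) k
    refine fin.trans ?_
    rw [← Real.exp_nat_mul]
    have hDb : KK * C * b' ^ p ≤ KK * C * (b ^ p * q) := mul_le_mul_of_nonneg_left hbp hD
    have hDk : k * (KK * C * b' ^ p) ≤ k * (KK * C * (b ^ p * q)) :=
      mul_le_mul_of_nonneg_left hDb (by positivity)
    have hkb' : k * b' ^ 2 = x ^ 2 * q := by rw [hb2, ← hkb]; ring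
    have f1 : (k:ℝ) * (∫ y : ℝ, Real.exp (b' * y + -(1/8 * b' ^ 2) * y ^ 2) ∂ν -
        ∫ y : ℝ, Real.exp (b' * y + -(1/2 * b' ^ 2) * y ^ 2) ∂ν) ≤
        (x ^ 2 + 2 * (KK * C) * (k * b ^ p)) * q := by
      have : ∫ y : ℝ, Real.exp (b' * y + -(1/8 * b' ^ 2) * y ^ 2) ∂ν -
        ∫ y : ℝ, Real.exp (b' * y + -(1/2 * b' ^ 2) * y ^ 2) ∂ν ≤ 3/8 * b' ^ 2 + 2 * (KK * C * b' ^ p) := by linarith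
      have h7 := mul_le_mul_of_nonneg_left this (show (0:ℝ) ≤ k by positivity)
      refine h7.trans ?_
      have h8 : 0 ≤ x ^ 2 * q := by positivity
      have e3 : (k:ℝ) * (3/8 * b' ^ 2 + 2 * (KK * C * b' ^ p)) = 3/8 * (k * b' ^ 2) + 2 * (k * (KK * C * b' ^ p)) := by ring
      have e4 : (x ^ 2 + 2 * (KK * C) * (k * b ^ p)) * q = x ^ 2 * q + 2 * (k * (KK * C * (b ^ p * q))) := by ring
      rw [e3, e4, hkb']
      linarith only [h8, hDk]
    have f2 : (k:ℝ) * (3/8 * b' ^ 2 + KK * C * b' ^ p) ≤ x ^ 2 / 24 + KK * C * (k * b ^ p) := by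
      have h8 : x ^ 2 * q ≤ x ^ 2 * (1/9) := by gcongr
      have h10 : (KK * C * (k * b ^ p)) * q ≤ (KK * C * (k * b ^ p)) * 1 :=
        mul_le_mul_of_nonneg_left (by linarith only [h9]) (by positivity)
      have e3 : (k:ℝ) * (3/8 * b' ^ 2 + KK * C * b' ^ p) = 3/8 * (k * b' ^ 2) + (k * (KK * C * b' ^ p)) := by ring
      have e4 : (KK * C * (k * b ^ p)) * q = (k * (KK * C * (b ^ p * q))) := by ring
      rw [e3, hkb']
      linarith only [h8, h10, hDk, e4]
    exact mul_le_mul f1 (Real.exp_le_exp.2 f2) (Real.exp_pos _).le (by positivity)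

lemma bd3 (hp2 : 2 ≤ p) (hp3 : p ≤ 3) (h : Good p C ν) {k : ℕ} {b x : ℝ} (hb : 0 < b) (hx : 2 ≤ x)
    (hkb : k * b ^ 2 = x ^ 2) :
    (PI k ν).real {ω | x * √(QQ ω) ≤ SS ω ∧ 3 * x < b * √(QQ ω)} ≤
      (x ^ 2 + 2 * (KK * C) * (k * b ^ p)) * Real.exp (-(5/6) * x ^ 2 + KK * C * (k * b ^ p)) := by
  have hpr := h.prob
  have hD : 0 ≤ KK * C := mul_nonneg (by linarith [KK_ge]) h.C_nonneg
  set A := (x ^ 2 + 2 * (KK * C) * (k * b ^ p)) * Real.exp (-(5/6) * x ^ 2 + KK * C * (k * b ^ p)) with hA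
  have hA0 : 0 ≤ A := by positivity
  have hsub : {ω : Fin k → ℝ | x * √(QQ ω) ≤ SS ω ∧ 3 * x < b * √(QQ ω)} ⊆
      ⋃ j : ℕ, {ω | x * √(QQ ω) ≤ SS ω ∧ 3 ^ (j+1) * x ≤ b * √(QQ ω) ∧ b * √(QQ ω) ≤ 3 ^ (j+2) * x} := by
    rintro ω ⟨h1, h2⟩
    have hx0 : 0 < 3 * x := by linarith
    obtain ⟨j, h3, h4⟩ := exists_nat_pow_near (x := b * √(QQ ω) / (3 * x)) (y := 3)
      ((one_le_div hx0).2 h2.le) (by norm_num)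
    rw [le_div_iff₀ hx0] at h3
    rw [div_lt_iff₀ hx0] at h4
    refine mem_iUnion.2 ⟨j, h1, ?_, ?_⟩
    · rw [pow_succ]; linarith
    · rw [pow_succ]; linarith
  have hs : Summable (fun j : ℕ => 2 * A * ((1:ℝ)/9) ^ (j+1)) := by
    have := (summable_geometric_of_lt_one (r := (1:ℝ)/9) (by norm_num) (by norm_num)).mul_left (2 * A * (1/9))
    refine this.congr fun j => ?_
    rw [pow_succ]; ring
  have hsum : ∑' j : ℕ, 2 * A * ((1:ℝ)/9) ^ (j+1) ≤ A := by
    have : ∀ j : ℕ, 2 * A * ((1:ℝ)/9) ^ (j+1) = (2 * A * (1/9)) * (1/9) ^ j := fun j => by rw [pow_succ]; ring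
    simp_rw [this]
    rw [tsum_mul_left, tsum_geometric_of_lt_one (by norm_num) (by norm_num)]
    norm_num; linarith
  have h1 : (PI k ν) {ω | x * √(QQ ω) ≤ SS ω ∧ 3 * x < b * √(QQ ω)} ≤ ENNReal.ofReal A := by
    refine (measure_mono hsub).trans ((measure_iUnion_le _).trans ?_)
    refine le_trans ?_ (ENNReal.ofReal_le_ofReal hsum)
    rw [ENNReal.ofReal_tsum_of_nonneg (fun j => by positivity) hs]
    refine ENNReal.tsum_le_tsum fun j => ?_
    rw [ENNReal.le_ofReal_iff_toReal_le (measure_ne_top _ _) (by positivity)]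
    refine (bd3j hp2 hp3 h hb hx hkb j).trans (le_of_eq ?_)
    rw [hA]; ring
  exact ENNReal.toReal_le_of_le_ofReal hA0 h1

/-- One-step upper bound. -/
lemma upper (hp2 : 2 ≤ p) (hp3 : p ≤ 3) (h : Good p C ν) {k : ℕ} {b x ε : ℝ} (hb : 0 < b) (hx : 2 ≤ x)
    (hkb : k * b ^ 2 = x ^ 2) (hε : 0 < ε) :
    Pr k ν x ≤ (PI k ν).real {ω | x ^ 2 / 2 + (-(ε ^ 2) / 2) ≤ RR b ω} +
      (2 * Real.exp (-x ^ 2 / 2 - ε * x / 4 + KK * C * (k * b ^ p)) +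
      (x ^ 2 + 2 * (KK * C) * (k * b ^ p)) * Real.exp (-(5/6) * x ^ 2 + KK * C * (k * b ^ p))) := by
  have hpr := h.prob
  have hx0 : 0 < x := by linarith
  have b1 := bd1 hp2 hp3 h hb hx0 hkb hε
  have b2 := bd2 hp2 hp3 h hb hx0 hkb hε
  have b3 := bd3 hp2 hp3 h hb hx hkb
  have b2' : Real.exp (-x ^ 2 / 2 - ε * x / 2 + KK * C * (k * b ^ p)) ≤
     Real.exp (-x ^ 2 / 2 - ε * x / 4 + KK * C * (k * b ^ p)) := by
    apply Real.exp_le_exp.2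
    nlinarith [mul_pos hε hx0]
  have hsub : {ω : Fin k → ℝ | x ≤ SS ω / √(QQ ω)} ⊆
      {ω | x ^ 2 / 2 + (-(ε ^ 2) / 2) ≤ RR b ω} ∪ ({ω | x * √(QQ ω) ≤ SS ω ∧ x + ε < b * √(QQ ω) ∧ b * √(QQ ω) ≤ 3 * x}
      ∪ ({ω | x * √(QQ ω) ≤ SS ω ∧ b * √(QQ ω) < x - ε} ∪ {ω | x * √(QQ ω) ≤ SS ω ∧ 3 * x < b * √(QQ ω)})) := by
    intro ω hω
    have hω' : x ≤ SS ω / √(QQ ω) := hω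
    have hV : 0 < √(QQ ω) := by
      rcases (Real.sqrt_nonneg (QQ ω)).eq_or_lt with h0 | h0
      · rw [← h0, div_zero] at hω'; linarith
      · exact h0
    have h1 : x * √(QQ ω) ≤ SS ω := (le_div_iff₀ hV).1 hω'
    by_cases c1 : b * √(QQ ω) < x - ε
    · exact Or.inr (Or.inr (Or.inl ⟨h1, c1⟩))
    by_cases c2 : 3 * x < b * √(QQ ω)
    · exact Or.inr (Or.inr (Or.inr ⟨h1, c2⟩))
    by_cases c3 : x + ε < b * √(QQ ω)
    · exact Or.inr (Or.inl ⟨h1, c3, not_lt.1 c2⟩)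
    left
    push Not at c1 c2 c3
    show _ ≤ b * SS ω + (-(b ^ 2) / 2) * QQ ω
    have e := bsq b ω
    have h4 : x * (b * √(QQ ω)) ≤ b * SS ω := by nlinarith
    set v := b * √(QQ ω)
    nlinarith
  unfold Pr
  refine (measureReal_mono hsub).trans ?_
  refine (measureReal_union_le _ _).trans ?_
  have u1 := measureReal_union_le (μ := PI k ν) {ω | x * √(QQ ω) ≤ SS ω ∧ x + ε < b * √(QQ ω) ∧ b * √(QQ ω) ≤ 3 * x}
      ({ω | x * √(QQ ω) ≤ SS ω ∧ b * √(QQ ω) < x - ε} ∪ {ω | x * √(QQ ω) ≤ SS ω ∧ 3 * x < b * √(QQ ω)})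
  have u2 := measureReal_union_le (μ := PI k ν) {ω | x * √(QQ ω) ≤ SS ω ∧ b * √(QQ ω) < x - ε}
     {ω | x * √(QQ ω) ≤ SS ω ∧ 3 * x < b * √(QQ ω)}
  linarith

lemma lower [IsProbabilityMeasure ν] {k : ℕ} {b x : ℝ} (hb : 0 < b) (hx : 0 < x) :
    (PI k ν).real {ω | x ^ 2 / 2 + 0 ≤ RR b ω} ≤ Pr k ν x := by
  refine measureReal_mono ?_
  intro ω hω
  have h1 : x ^ 2 / 2 + 0 ≤ b * SS ω + (-(b ^ 2) / 2) * QQ ω := hω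
  have e := bsq b ω
  have hQ := QQ_nonneg ω
  show x ≤ SS ω / √(QQ ω)
  have hV : 0 < √(QQ ω) := by
    rcases hQ.eq_or_lt with h0 | h0
    · exfalso
      have : ∀ i, ω i = 0 := by
        have h00 : ∑ i, ω i ^ 2 = 0 := h0.symm
        rw [Finset.sum_eq_zero_iff_of_nonneg (fun i _ => sq_nonneg _)] at h00
        intro i
        simpa using h00 i (Finset.mem_univ i)
      have hs : SS ω = 0 := by unfold SS; simp [this]
      rw [hs, ← h0] at h1
      nlinarith
    · exact Real.sqrt_pos.2 h0
  rw [le_div_iff₀ hV]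
  have : x * (b * √(QQ ω)) ≤ b * SS ω := by
    set v := b * √(QQ ω)
    nlinarith [sq_nonneg (v - x)]
  have h3 : b * (x * √(QQ ω)) ≤ b * SS ω := by linarith
  exact le_of_mul_le_mul_left h3 hb

end

lemma expo_small {x : ℕ → ℝ} (hx : Tendsto x atTop atTop) {a : ℝ} (ha : 0 < a) (s : ℕ) :
    Tendsto (fun n => x n ^ s * Real.exp (-(a * x n))) atTop (nhds 0) := by
  have := (Real.tendsto_pow_mul_exp_neg_atTop_nhds_zero s).comp (hx.const_mul_atTop ha)
  have h2 := this.const_mul ((a ^ s)⁻¹)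
  rw [mul_zero] at h2
  refine h2.congr fun n => ?_
  simp only [Function.comp]
  rw [mul_pow]
  field_simp

lemma RegB.final {p C : ℝ} {k : ℕ → ℕ} {ν : ℕ → Measure ℝ} {b x : ℕ → ℝ} (h : RegB p C k ν b x) :
    Tendsto (fun n => Pr (k n) (ν n) (x n) / gT (x n)) atTop (nhds 1) := by
  have hpr : ∀ n, IsProbabilityMeasure (ν n) := fun n => (h.hν n).prob
  set L : ℝ := (√(2 * Real.pi))⁻¹ with hL
  have hL0 : 0 < L := by positivity
  have hM := mills.comp h.hx
  suffices hS : Tendsto (fun n => x n * Real.exp (x n ^ 2 / 2) * Pr (k n) (ν n) (x n)) atTop (nhds L) by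
    have := hS.div hM hL0.ne'
    rw [div_self hL0.ne'] at this
    refine this.congr' ?_
    filter_upwards [h.hx.eventually_gt_atTop 0] with n hn
    have := gT_pos (x n)
    have := Real.exp_pos (x n ^ 2 / 2)
    simp only [Function.comp, Pi.div_apply]
    field_simp
  have hlow := h.tailR 0
  rw [neg_zero, Real.exp_zero, mul_one] at hlow
  rw [tendsto_order]
  constructor
  · intro a ha
    filter_upwards [hlow.eventually_const_lt ha, h.hx.eventually_gt_atTop 0] with n h1 h2
    refine h1.trans_le ?_
    have := lower (ν := ν n) (k := k n) (h.hb n) h2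
    gcongr
  · intro a ha
    obtain ⟨ε, hε, hεa⟩ : ∃ ε : ℝ, 0 < ε ∧ L * Real.exp (-(-(ε^2)/2)) < a := by
      have hc : Tendsto (fun ε : ℝ => L * Real.exp (-(-(ε^2)/2))) (nhdsWithin 0 (Ioi 0)) (nhds L) := by
        have : Continuous (fun ε : ℝ => L * Real.exp (-(-(ε^2)/2))) := by fun_prop
        have := this.tendsto 0
        simp only [ne_eq, OfNat.ofNat_ne_zero, not_false_eq_true, zero_pow, neg_zero, zero_div, Real.exp_zero, mul_one] at this
        exact this.mono_left nhdsWithin_le_nhds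
      obtain ⟨ε, h1, h2⟩ := ((hc.eventually_lt_const ha).and self_mem_nhdsWithin).exists
      exact ⟨ε, h2, h1⟩
    have hup := h.tailR (-(ε ^ 2) / 2)
    have hδ := h.hd
    have hE : Tendsto (fun n => Real.exp (KK * C * (k n * b n ^ p))) atTop (nhds 1) := by
      have := (Real.continuous_exp.tendsto _).comp (hδ.const_mul (KK * C))
      rw [mul_zero, Real.exp_zero] at this
      exact this
    have r1 : Tendsto (fun n => 2 * (x n ^ 1 * Real.exp (-((ε / 4) * x n))) * Real.exp (KK * C * (k n * b n ^ p))) atTop (nhds 0) := by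
      have := ((expo_small h.hx (a := ε/4) (by linarith) 1).const_mul 2).mul hE
      simpa using this
    have r2 : Tendsto (fun n => (x n ^ 3 * Real.exp (-((1 / 3) * x n)) + (x n ^ 1 * Real.exp (-((1 / 3) * x n))) * (2 * (KK * C) * (k n * b n ^ p))) *
        Real.exp (KK * C * (k n * b n ^ p))) atTop (nhds 0) := by
      have := ((expo_small h.hx (a := 1/3) (by norm_num) 3).add
        ((expo_small h.hx (a := 1/3) (by norm_num) 1).mul (hδ.const_mul (2 * (KK * C))))).mul hE
      simpa using this
    have tot := (hup.add (r1.add r2))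
    rw [add_zero, add_zero] at tot
    filter_upwards [tot.eventually_lt_const hεa, h.hx.eventually_ge_atTop 2] with n h1 h2
    refine lt_of_le_of_lt ?_ h1
    have hxn : 0 < x n := by linarith
    have hu := upper h.hp2.le h.hp3 (h.hν n) (h.hb n) h2 (h.hkb n) hε
    refine (mul_le_mul_of_nonneg_left hu (by positivity)).trans ?_
    rw [mul_add]
    refine add_le_add le_rfl ?_
    rw [mul_add]
    have hD : 0 ≤ KK * C := mul_nonneg (by linarith [KK_ge]) (h.hν n).C_nonneg
    have hb := h.hb n
    refine add_le_add ?_ ?_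
    · apply le_of_eq
      have e : Real.exp (-x n ^ 2 / 2 - ε * x n / 4 + KK * C * (k n * b n ^ p)) =
        (Real.exp (x n ^ 2 / 2))⁻¹ * Real.exp (-((ε / 4) * x n)) * Real.exp (KK * C * (k n * b n ^ p)) := by
        rw [← Real.exp_neg, ← Real.exp_add, ← Real.exp_add]; congr 1; ring
      rw [e]; field_simp
    · have e : Real.exp (-(5/6) * x n ^ 2 + KK * C * (k n * b n ^ p)) ≤
        (Real.exp (x n ^ 2 / 2))⁻¹ * Real.exp (-((1/3) * x n)) * Real.exp (KK * C * (k n * b n ^ p)) := by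
        rw [← Real.exp_neg, ← Real.exp_add, ← Real.exp_add]; apply Real.exp_le_exp.2; nlinarith
      calc _ ≤ x n * Real.exp (x n ^ 2 / 2) * ((x n ^ 2 + 2 * (KK * C) * (k n * b n ^ p)) *
            ((Real.exp (x n ^ 2 / 2))⁻¹ * Real.exp (-((1/3) * x n)) * Real.exp (KK * C * (k n * b n ^ p)))) := by gcongr
        _ = _ := by field_simp

end CMD
end

open MeasureTheory Filter Asymptotics Set
noncomputable section
namespace CMD
open ProbabilityTheory

theorem iid_cramer {p C : ℝ} {k : ℕ → ℕ} {ν : ℕ → Measure ℝ} {t : ℕ → ℝ} (hp2 : 2 < p) (hp3 : p ≤ 3)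
    (hk : Tendsto k atTop atTop) (hν : ∀ n, Good p C (ν n)) (ht : ∀ n, 0 ≤ t n)
    (hd : Tendsto (fun n => k n * (t n / √(k n)) ^ p) atTop (nhds 0)) :
    Tendsto (fun n => Pr (k n) (ν n) (t n) / gT (t n)) atTop (nhds 1) := by
  refine tendsto_of_subseq_tendsto fun ns hns => ?_
  by_cases hT : Tendsto (fun n => t (ns n)) atTop atTop
  · have h1 : ∀ᶠ n in atTop, 0 < t (ns n) ∧ 0 < k (ns n) :=
      (hT.eventually_gt_atTop 0).and ((hk.comp hns).eventually_gt_atTop 0)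
    obtain ⟨N, hN⟩ := eventually_atTop.1 h1
    have hms : Tendsto (fun n => n + N) atTop atTop := tendsto_add_atTop_nat N
    refine ⟨fun n => n + N, ?_⟩
    have hR : RegB p C (fun n => k (ns (n + N))) (fun n => ν (ns (n + N)))
      (fun n => t (ns (n+N)) / √(k (ns (n+N)))) (fun n => t (ns (n+N))) := by
      refine ⟨hp2, hp3, fun n => hν _, hk.comp (hns.comp hms), fun n => ?_, hT.comp hms, fun n => ?_, ?_⟩
      · obtain ⟨h2, h3⟩ := hN (n+N) (by omega)
        have : (0:ℝ) < k (ns (n+N)) := by exact_mod_cast h3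
        positivity
      · obtain ⟨h2, h3⟩ := hN (n+N) (by omega)
        have : (0:ℝ) < k (ns (n+N)) := by exact_mod_cast h3
        rw [div_pow, Real.sq_sqrt this.le]
        field_simp
      · exact hd.comp (hns.comp hms)
    exact hR.final
  · rw [tendsto_atTop] at hT
    push Not at hT
    obtain ⟨A, hA⟩ := hT
    obtain ⟨φ, hφ, hφ2⟩ := extraction_of_frequently_atTop hA
    have hcpt := (isCompact_Icc (a := (0:ℝ)) (b := A)).tendsto_subseq (x := fun n => t (ns (φ n)))
      (fun n => ⟨ht _, (hφ2 n).le⟩)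
    obtain ⟨τ, _, ψ, hψ, hlim⟩ := hcpt
    refine ⟨fun n => φ (ψ n), ?_⟩
    have hsub : Tendsto (fun n => ns (φ (ψ n))) atTop atTop :=
      hns.comp (hφ.tendsto_atTop.comp hψ.tendsto_atTop)
    have h1 := regimeA hp2 hp3 (hk.comp hsub) (fun n => hν (ns (φ (ψ n)))) (fun n => ht (ns (φ (ψ n)))) hlim
    have h2 := (gT_cont.tendsto τ).comp hlim
    have := h1.div h2 (gT_pos τ).ne'
    rw [div_self (gT_pos τ).ne'] at this
    exact this

end CMD
end

open MeasureTheory Filter Asymptotics Set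
noncomputable section
namespace CMD
open ProbabilityTheory

abbrev II : Set ℝ := Ioo (0:ℝ) 1

def br (a : ℕ) (y : ℝ) : ℝ := ((a:ℝ) + 1 + y)⁻¹
def wt (a : ℕ) (y : ℝ) : ℝ := (1 + y) / (((a:ℝ) + 1 + y) * ((a:ℝ) + 2 + y))

@[fun_prop] lemma br_meas (a : ℕ) : Measurable (br a) := by unfold br; fun_prop
@[fun_prop] lemma wt_meas (a : ℕ) : Measurable (wt a) := by unfold wt; fun_prop
@[fun_prop] lemma gm_meas : Measurable gaussMap := by
  unfold gaussMap; exact measurable_fract.comp measurable_inv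

lemma br_mem {a : ℕ} {y : ℝ} (hy : y ∈ II) : br a y ∈ II := by
  obtain ⟨h1, h2⟩ := hy
  have ha : (0:ℝ) ≤ a := by positivity
  refine ⟨by unfold br; positivity, ?_⟩
  unfold br
  exact inv_lt_one_of_one_lt₀ (by linarith)

lemma wt_pos {a : ℕ} {y : ℝ} (hy : y ∈ II) : 0 < wt a y := by
  have h1 := hy.1
  unfold wt; positivity

lemma T_br {a : ℕ} {y : ℝ} (hy : y ∈ II) : gaussMap (br a y) = y := by
  unfold gaussMap br
  rw [inv_inv, show (a:ℝ) + 1 + y = y + ((a + 1 : ℕ) : ℝ) by push_cast; ring, Int.fract_add_natCast]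
  exact Int.fract_eq_self.2 ⟨hy.1.le, hy.2⟩

lemma floor_br {a : ℕ} {y : ℝ} (hy : y ∈ II) : ⌊(br a y)⁻¹⌋₊ = a + 1 := by
  unfold br
  rw [inv_inv, show (a:ℝ) + 1 + y = y + ((a + 1 : ℕ) : ℝ) by push_cast; ring,
    Nat.floor_add_natCast hy.1.le, Nat.floor_eq_zero.2 hy.2, zero_add]

lemma br_inj (a : ℕ) : InjOn (br a) II := by
  intro x _ y _ h
  unfold br at h
  have := inv_injective h
  linarith

lemma br_image_disj : Pairwise (Function.onFun Disjoint (fun a : ℕ => br a '' II)) := by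
  intro a c hac
  rw [Function.onFun, Set.disjoint_left]
  rintro z ⟨x, hx, rfl⟩ ⟨y, hy, h⟩
  have h1 := floor_br (a := a) hx
  have h2 := floor_br (a := c) hy
  rw [h, h1] at h2
  omega

lemma br_image_union : (⋃ a : ℕ, br a '' II) =ᵐ[volume] II := by
  have hsub : (⋃ a : ℕ, br a '' II) ⊆ II := by
    rintro z hz
    obtain ⟨a, x, hx, rfl⟩ := mem_iUnion.1 hz
    exact br_mem hx
  have hcover : II ⊆ (⋃ a : ℕ, br a '' II) ∪ range (fun n : ℕ => ((n:ℝ))⁻¹) := by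
    intro z hz
    have h1 : 1 < z⁻¹ := (one_lt_inv₀ hz.1).2 hz.2
    by_cases h : Int.fract z⁻¹ = 0
    · right
      refine ⟨⌊z⁻¹⌋₊, ?_⟩
      have h2 := Int.floor_add_fract z⁻¹
      rw [h, add_zero] at h2
      have h3 : (⌊z⁻¹⌋₊ : ℝ) = ((⌊z⁻¹⌋ : ℤ) : ℝ) := natCast_floor_eq_intCast_floor (by linarith)
      simp only
      rw [h3, h2, inv_inv]
    · left
      have h4 : 1 ≤ ⌊z⁻¹⌋₊ := Nat.le_floor (by push_cast; linarith)
      refine mem_iUnion.2 ⟨⌊z⁻¹⌋₊ - 1, Int.fract z⁻¹, ⟨lt_of_le_of_ne (Int.fract_nonneg _) (Ne.symm h), Int.fract_lt_one _⟩, ?_⟩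
      have h2 := Int.floor_add_fract z⁻¹
      have h3 : (⌊z⁻¹⌋₊ : ℝ) = ((⌊z⁻¹⌋ : ℤ) : ℝ) := natCast_floor_eq_intCast_floor (by linarith)
      unfold br
      rw [Nat.cast_sub h4, h3]
      push_cast
      rw [sub_add_cancel, h2, inv_inv]
  refine (ae_eq_set.2 ⟨?_, ?_⟩)
  · rw [sdiff_eq_empty.2 hsub]; simp
  · refine measure_mono_null (t := range (fun n : ℕ => ((n:ℝ))⁻¹)) ?_ ((countable_range _).measure_zero _)
    rintro z ⟨h1, h2⟩
    exact (hcover h1).resolve_left h2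

def dens (x : ℝ) : ℝ := (Real.log 2)⁻¹ * (1 + x)⁻¹
@[fun_prop] lemma dens_meas : Measurable dens := by unfold dens; fun_prop

lemma lintG (φ : ℝ → ENNReal) :
    ∫⁻ x, φ x ∂gaussMeasure = ∫⁻ x in II, ENNReal.ofReal (dens x) * φ x := by
  unfold gaussMeasure
  rw [lintegral_withDensity_eq_lintegral_mul_non_measurable]
  · rfl
  · exact dens_meas.ennreal_ofReal
  · exact ae_of_all _ fun x => ENNReal.ofReal_lt_top

lemma wt_summ {y : ℝ} (hy : y ∈ II) : HasSum (fun a => wt a y) 1 := by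
  have h0 := hy.1
  have h : ∀ n : ℕ, ∑ a ∈ Finset.range n, wt a y = 1 - (1 + y) / ((n:ℝ) + 1 + y) := by
    intro n
    induction n with
    | zero => simp; field_simp; simp
    | succ n ih =>
      rw [Finset.sum_range_succ, ih]; unfold wt; push_cast
      have : (n:ℝ) + 1 + 1 + y ≠ 0 := by positivity
      field_simp; ring
  rw [hasSum_iff_tendsto_nat_of_nonneg (fun a => (wt_pos hy).le)]
  simp_rw [h]
  have : Tendsto (fun n : ℕ => (1 + y) / ((n:ℝ) + 1 + y)) atTop (nhds 0) := by
    apply Tendsto.const_div_atTop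
    exact tendsto_atTop_add_const_right _ _ (tendsto_atTop_add_const_right _ _ tendsto_natCast_atTop_atTop)
  simpa using this.const_sub 1

lemma wt_tsum {y : ℝ} (hy : y ∈ II) : ∑' a, ENNReal.ofReal (wt a y) = 1 := by
  rw [← ENNReal.ofReal_tsum_of_nonneg (fun a => (wt_pos hy).le) (wt_summ hy).summable, (wt_summ hy).tsum_eq]
  simp

lemma dens_br {a : ℕ} {y : ℝ} (hy : y ∈ II) :
    |(-((a:ℝ) + 1 + y)⁻¹ ^ 2)| * dens (br a y) = dens y * wt a y := by
  have h1 := hy.1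
  rw [abs_neg, abs_of_nonneg (by positivity)]
  unfold dens br wt
  have : 1 + ((a:ℝ) + 1 + y)⁻¹ = ((a:ℝ) + 2 + y) / ((a:ℝ) + 1 + y) := by field_simp; ring
  rw [this]
  field_simp

lemma dual2 {Φ : ℝ → ℝ → ENNReal} (hΦ : Measurable (Function.uncurry Φ)) :
    ∫⁻ x, Φ x (gaussMap x) ∂gaussMeasure =
      ∫⁻ y, ∑' a : ℕ, ENNReal.ofReal (wt a y) * Φ (br a y) y ∂gaussMeasure := by
  rw [lintG, lintG]
  conv_lhs => rw [← Measure.restrict_congr_set br_image_union]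
  rw [lintegral_iUnion _ br_image_disj]
  · simp_rw [← ENNReal.tsum_mul_left]
    rw [lintegral_tsum]
    · congr 1; ext a
      rw [lintegral_image_eq_lintegral_abs_deriv_mul (s := II) (f := br a) measurableSet_Ioo
        (f' := fun y => -((a:ℝ) + 1 + y)⁻¹ ^ 2) _ (br_inj a)]
      · refine setLIntegral_congr_fun (s := II) measurableSet_Ioo fun y hy => ?_
        rw [T_br hy, ← mul_assoc, ← mul_assoc, ← ENNReal.ofReal_mul (abs_nonneg _), dens_br hy,
          ENNReal.ofReal_mul]
        have := hy.1
        have := Real.log_pos (show (1:ℝ) < 2 by norm_num)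
        unfold dens; positivity
      · intro y hy
        have h1 := hy.1
        have : HasDerivAt (fun y : ℝ => ((a:ℝ) + 1 + y)) 1 y := (hasDerivAt_id y).const_add _
        have h2 := (this.inv (by positivity)).hasDerivWithinAt (s := II)
        have e : -((a:ℝ) + 1 + y)⁻¹ ^ 2 = -1 / ((a:ℝ) + 1 + y) ^ 2 := by rw [inv_pow]; ring
        rw [e]
        exact h2
    · intro a
      have : Measurable (fun y => Φ (br a y) y) := hΦ.comp ((br_meas a).prodMk measurable_id)
      fun_prop
  · intro a
    exact (measurableSet_Ioo).image_of_measurable_injOn (br_meas a) (br_inj a)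

instance gprob : IsProbabilityMeasure gaussMeasure := by
  constructor
  rw [← lintegral_one, lintG]
  simp only [mul_one]
  have hl := Real.log_pos (show (1:ℝ) < 2 by norm_num)
  rw [← ofReal_integral_eq_lintegral_ofReal]
  · rw [← integral_Ioc_eq_integral_Ioo, ← intervalIntegral.integral_of_le (by norm_num)]
    unfold dens
    rw [intervalIntegral.integral_const_mul]
    have : ∫ x in (0:ℝ)..1, (1 + x)⁻¹ = Real.log 2 := by
      have := intervalIntegral.integral_comp_add_left (a := 0) (b := 1) (fun x : ℝ => x⁻¹) 1
      rw [this, integral_inv_of_pos (by norm_num) (by norm_num)]; norm_num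
    rw [this, inv_mul_cancel₀ hl.ne', ENNReal.ofReal_one]
  · have : ContinuousOn dens (Icc 0 1) := by
      unfold dens
      apply ContinuousOn.mul continuousOn_const
      apply ContinuousOn.inv₀ (by fun_prop)
      intro x hx; have := hx.1; positivity
    exact (this.integrableOn_Icc).mono_set Ioo_subset_Icc_self
  · filter_upwards [ae_restrict_mem measurableSet_Ioo] with x hx
    have := hx.1
    simp only [Pi.zero_apply]
    unfold dens; positivity

lemma G_ae : ∀ᵐ x ∂gaussMeasure, x ∈ II := by
  unfold gaussMeasure
  exact (withDensity_absolutelyContinuous _ _).ae_le (ae_restrict_mem measurableSet_Ioo)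

/-- Transfer operator. -/
def UU (φ : ℝ → ENNReal) (y : ℝ) : ENNReal := ∑' a : ℕ, ENNReal.ofReal (wt a y) * φ (br a y)

@[fun_prop] lemma UU_meas {φ : ℝ → ENNReal} (h : Measurable φ) : Measurable (UU φ) := by
  unfold UU
  exact Measurable.tsum fun a => by fun_prop

lemma UU_congr {φ ψ : ℝ → ENNReal} (h : ∀ x ∈ II, φ x = ψ x) : ∀ x ∈ II, UU φ x = UU ψ x := by
  intro x hx
  unfold UU
  congr 1; ext a
  rw [h _ (br_mem hx)]

lemma UUn_congr (n : ℕ) : ∀ {φ ψ : ℝ → ENNReal}, (∀ x ∈ II, φ x = ψ x) → ∀ x ∈ II, UU^[n] φ x = UU^[n] ψ x := by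
  induction n with
  | zero => intro φ ψ h; exact h
  | succ n ih =>
    intro φ ψ h
    simp only [Function.iterate_succ_apply]
    exact ih (UU_congr h)

lemma UU_tsum (φ : ℕ → ℝ → ENNReal) : UU (fun x => ∑' a, φ a x) = fun x => ∑' a, UU (φ a) x := by
  ext x
  unfold UU
  simp_rw [← ENNReal.tsum_mul_left]
  rw [ENNReal.tsum_comm]

lemma UUn_tsum (n : ℕ) : ∀ (φ : ℕ → ℝ → ENNReal), UU^[n] (fun x => ∑' a, φ a x) = fun x => ∑' a, UU^[n] (φ a) x := by
  induction n with
  | zero => intro φ; rfl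
  | succ n ih => intro φ; simp only [Function.iterate_succ_apply]; rw [UU_tsum, ih]

lemma UU_add_const (φ : ℝ → ENNReal) (c : ENNReal) {y : ℝ} (hy : y ∈ II) : UU (fun x => φ x + c) y = UU φ y + c := by
  unfold UU
  simp_rw [mul_add]
  rw [ENNReal.tsum_add, ENNReal.tsum_mul_right, wt_tsum hy, one_mul]

lemma dual_U {φ ψ : ℝ → ENNReal} (hφ : Measurable φ) (hψ : Measurable ψ) :
    ∫⁻ x, φ x * ψ (gaussMap x) ∂gaussMeasure = ∫⁻ y, UU φ y * ψ y ∂gaussMeasure := by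
  rw [dual2 (Φ := fun x y => φ x * ψ y) (by simp only [Function.uncurry_def]; fun_prop)]
  congr 1; ext y
  unfold UU
  rw [← ENNReal.tsum_mul_right]
  simp_rw [mul_assoc]

lemma int_U {φ : ℝ → ENNReal} (hφ : Measurable φ) :
    ∫⁻ y, UU φ y ∂gaussMeasure = ∫⁻ x, φ x ∂gaussMeasure := by
  have := dual_U hφ (ψ := fun _ => 1) measurable_const
  simpa using this.symm

lemma UU2_meas {Φ : ℝ → ℝ → ENNReal} (h : Measurable (Function.uncurry Φ)) :
    Measurable (Function.uncurry fun y z => UU (fun x => Φ x z) y) := by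
  simp only [UU, Function.uncurry_def] at h ⊢
  refine Measurable.tsum fun a => ?_
  have : Measurable (fun q : ℝ × ℝ => Φ (br a q.1) q.2) := 
    h.comp (g := fun q : ℝ × ℝ => Φ q.1 q.2) (f := fun q : ℝ × ℝ => (br a q.1, q.2)) (by fun_prop)
  fun_prop

lemma Tn_meas (N : ℕ) : Measurable (gaussMap^[N]) := gm_meas.iterate N

lemma dualN (N : ℕ) : ∀ {Φ : ℝ → ℝ → ENNReal}, Measurable (Function.uncurry Φ) →
    ∫⁻ x, Φ x (gaussMap^[N] x) ∂gaussMeasure = ∫⁻ y, UU^[N] (fun x => Φ x y) y ∂gaussMeasure := by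
  induction N with
  | zero => intro Φ h; rfl
  | succ N ih =>
    intro Φ h
    simp only [Function.iterate_succ_apply]
    have h1 := dual2 (Φ := fun x z => Φ x (gaussMap^[N] z))
      (h.comp (measurable_fst.prodMk ((Tn_meas N).comp measurable_snd)))
    rw [h1]
    exact ih (Φ := fun y z => UU (fun x => Φ x z) y) (UU2_meas h)

end CMD
end

open MeasureTheory Filter Asymptotics Set
noncomputable section
namespace CMD
open ProbabilityTheory

def rr (x y : ℝ) : ℝ := max ((1 + x) / (1 + y)) ((1 + y) / (1 + x))

lemma rr_comm (x y : ℝ) : rr x y = rr y x := max_comm _ _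

lemma rr_eq {x y : ℝ} (hx : x ∈ II) (hxy : x ≤ y) : rr x y = (1 + y) / (1 + x) := by
  have := hx.1
  apply max_eq_right
  rw [div_le_div_iff₀ (by linarith) (by linarith)]
  nlinarith

lemma rr_ge_one {x y : ℝ} (hx : x ∈ II) (hy : y ∈ II) : 1 ≤ rr x y := by
  have h1 := hx.1; have h2 := hy.1
  rcases le_total x y with h | h
  · rw [rr_eq hx h, le_div_iff₀ (by linarith)]; linarith
  · rw [rr_comm, rr_eq hy h, le_div_iff₀ (by linarith)]; linarith

lemma rr_le_two {x y : ℝ} (hx : x ∈ II) (hy : y ∈ II) : rr x y ≤ 2 := by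
  have h1 := hx.1; have h2 := hy.1; have h3 := hx.2; have h4 := hy.2
  rcases le_total x y with h | h
  · rw [rr_eq hx h, div_le_iff₀ (by linarith)]; linarith
  · rw [rr_comm, rr_eq hy h, div_le_iff₀ (by linarith)]; linarith

lemma wt_le {x y : ℝ} (hx : x ∈ II) (hy : y ∈ II) (a : ℕ) : wt a x ≤ rr x y * wt a y := by
  have h1 := hx.1; have h2 := hy.1; have h3 := hx.2; have h4 := hy.2
  have ha : (0:ℝ) ≤ a := by positivity
  rcases le_total x y with h | h
  · rw [rr_eq hx h]
    unfold wt
    rw [div_mul_div_comm, div_le_div_iff₀ (by positivity) (by positivity)]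
    have e1 : (1 + x) * ((a:ℝ) + 1 + y) ≤ (1 + y) * ((a:ℝ) + 1 + x) := by nlinarith
    have e2 : (1 + x) * ((a:ℝ) + 2 + y) ≤ (1 + y) * ((a:ℝ) + 2 + x) := by nlinarith
    have := mul_le_mul e1 e2 (by positivity) (by positivity)
    nlinarith
  · rw [rr_comm, rr_eq hy h]
    unfold wt
    rw [div_mul_div_comm, div_le_div_iff₀ (by positivity) (by positivity)]
    have : ((a:ℝ) + 1 + y) * ((a:ℝ) + 2 + y) ≤ ((a:ℝ) + 1 + x) * ((a:ℝ) + 2 + x) := by gcongr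
    have h5 := mul_le_mul_of_nonneg_left this (show 0 ≤ (1 + x) * (1 + y) by positivity)
    nlinarith

lemma rr_br_aux {x y : ℝ} (hx : x ∈ II) (hy : y ∈ II) (h : x ≤ y) (a : ℕ) :
    rr (br a x) (br a y) ^ 2 ≤ rr x y := by
  have h1 := hx.1; have h2 := hy.1; have h3 := hx.2; have h4 := hy.2
  have ha : (0:ℝ) ≤ a := by positivity
  have hb : br a y ≤ br a x := by unfold br; gcongr
  rw [rr_comm, rr_eq (br_mem hy) hb, rr_eq hx h]
  have e : (1 + br a x) / (1 + br a y) = 1 + (y - x) / (((a:ℝ) + 1 + x) * ((a:ℝ) + 2 + y)) := by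
    unfold br
    have e1 : 1 + ((a:ℝ) + 1 + x)⁻¹ = ((a:ℝ) + 2 + x) / ((a:ℝ) + 1 + x) := by field_simp; ring
    have e2 : 1 + ((a:ℝ) + 1 + y)⁻¹ = ((a:ℝ) + 2 + y) / ((a:ℝ) + 1 + y) := by field_simp; ring
    rw [e1, e2]; field_simp; ring
  have e3 : 1 + (y - x) / (((a:ℝ) + 1 + x) * ((a:ℝ) + 2 + y)) ≤ 1 + (y - x) / ((1 + x) * (2 + y)) := by
    have : 0 ≤ y - x := by linarith
    gcongr <;> linarith
  have e4 : 1 + (y - x) / ((1 + x) * (2 + y)) = ((2 + x) * (1 + y)) / ((1 + x) * (2 + y)) := by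
    field_simp; ring
  rw [e]
  have h0 : 0 ≤ 1 + (y - x) / (((a:ℝ) + 1 + x) * ((a:ℝ) + 2 + y)) := by
    have : 0 ≤ y - x := by linarith
    positivity
  refine (pow_le_pow_left₀ h0 e3 2).trans ?_
  rw [e4, div_pow, div_le_div_iff₀ (by positivity) (by positivity)]
  have k1 : (2 + x) ^ 2 * (1 + y) ≤ (2 + y) ^ 2 * (1 + x) := by
    nlinarith [mul_nonneg (mul_nonneg h1.le h2.le) (show 0 ≤ y - x by linarith)]
  have k2 := mul_le_mul_of_nonneg_left k1 (show 0 ≤ (1 + x) * (1 + y) by positivity)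
  nlinarith

lemma rr_br {x y : ℝ} (hx : x ∈ II) (hy : y ∈ II) (a : ℕ) :
    rr (br a x) (br a y) ^ 2 ≤ rr x y := by
  rcases le_total x y with h | h
  · exact rr_br_aux hx hy h a
  · rw [rr_comm, rr_comm x]; exact rr_br_aux hy hx h a

def Cone (K : ℕ) (φ : ℝ → ENNReal) : Prop :=
  ∀ x ∈ II, ∀ y ∈ II, φ x ≤ ENNReal.ofReal (rr x y ^ K) * φ y

lemma Cone.mono {K L : ℕ} {φ : ℝ → ENNReal} (h : Cone K φ) (hKL : K ≤ L) : Cone L φ := by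
  intro x hx y hy
  refine (h x hx y hy).trans ?_
  gcongr
  exact rr_ge_one hx hy

lemma Cone.bterm {K : ℕ} {φ : ℝ → ENNReal} (h : Cone (2 * K) φ) (a : ℕ) :
    Cone (K + 1) (fun y => ENNReal.ofReal (wt a y) * φ (br a y)) := by
  intro x hx y hy
  simp only
  have h1 := rr_ge_one hx hy
  have h2 := h _ (br_mem (a := a) hx) _ (br_mem (a := a) hy)
  have h3 : rr (br a x) (br a y) ^ (2 * K) ≤ rr x y ^ K := by
    rw [pow_mul]; exact pow_le_pow_left₀ (by positivity) (rr_br hx hy a) K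
  calc ENNReal.ofReal (wt a x) * φ (br a x) ≤
      ENNReal.ofReal (rr x y * wt a y) * (ENNReal.ofReal (rr x y ^ K) * φ (br a y)) := by
        gcongr
        · exact wt_le hx hy a
        · exact h2.trans (by gcongr)
    _ = _ := by
        rw [pow_succ, ENNReal.ofReal_mul (by linarith), ENNReal.ofReal_mul (by positivity)]; ring

lemma Cone.tsum {K : ℕ} {φ : ℕ → ℝ → ENNReal} (h : ∀ a, Cone K (φ a)) : Cone K (fun x => ∑' a, φ a x) := by
  intro x hx y hy
  simp only
  rw [← ENNReal.tsum_mul_left]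
  exact ENNReal.tsum_le_tsum fun a => h a x hx y hy

lemma Cone.congr {K : ℕ} {φ ψ : ℝ → ENNReal} (h : Cone K φ) (e : ∀ x ∈ II, ψ x = φ x) : Cone K ψ := by
  intro x hx y hy
  rw [e x hx, e y hy]; exact h x hx y hy

lemma Cone.U2 {φ : ℝ → ENNReal} (h : Cone 2 φ) : Cone 2 (UU φ) := Cone.tsum fun a => h.bterm (K := 1) a
lemma Cone.U4 {φ : ℝ → ENNReal} (h : Cone 4 φ) : Cone 3 (UU φ) := Cone.tsum fun a => h.bterm (K := 2) a

lemma Cone.int_le {K : ℕ} {φ : ℝ → ENNReal} (h : Cone K φ) {y : ℝ} (hy : y ∈ II) :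
    ∫⁻ x, φ x ∂gaussMeasure ≤ 2 ^ K * φ y := by
  have : ∀ᵐ x ∂gaussMeasure, φ x ≤ 2 ^ K * φ y := by
    filter_upwards [G_ae] with x hx
    refine (h x hx y hy).trans ?_
    gcongr
    refine (ENNReal.ofReal_le_ofReal (pow_le_pow_left₀ (by linarith [rr_ge_one hx hy]) (rr_le_two hx hy) K)).trans ?_
    rw [ENNReal.ofReal_pow (by norm_num)]; simp
  refine (lintegral_mono_ae this).trans ?_
  simp

lemma Cone.le_int {K : ℕ} {φ : ℝ → ENNReal} (h : Cone K φ) {y : ℝ} (hy : y ∈ II) :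
    φ y ≤ 2 ^ K * ∫⁻ x, φ x ∂gaussMeasure := by
  have : ∀ᵐ x ∂gaussMeasure, φ y ≤ 2 ^ K * φ x := by
    filter_upwards [G_ae] with x hx
    refine (h y hy x hx).trans ?_
    gcongr
    refine (ENNReal.ofReal_le_ofReal (pow_le_pow_left₀ (by linarith [rr_ge_one hy hx]) (rr_le_two hy hx) K)).trans ?_
    rw [ENNReal.ofReal_pow (by norm_num)]; simp
  have h2 := lintegral_mono_ae this
  rw [lintegral_const_mul' _ _ (by simp)] at h2
  simpa using h2

lemma sub_cone_aux {a c J : ENNReal} {r : ℝ} (hr : 1 ≤ r) (h1 : a ≤ ENNReal.ofReal (r ^ 3) * c)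
    (h2 : J ≤ 2 ^ 3 * c) (hJ : J ≠ ⊤) (hc : c ≠ ⊤) :
    a - J / 32 ≤ ENNReal.ofReal (r ^ 4) * (c - J / 32) := by
  have ha : a ≠ ⊤ := ne_top_of_le_ne_top (ENNReal.mul_ne_top ENNReal.ofReal_ne_top hc) h1
  have hJ32 : J / 32 ≠ ⊤ := ENNReal.div_ne_top hJ (by norm_num)
  have h3 : J / 32 ≤ c := by
    refine ENNReal.div_le_of_le_mul' (h2.trans ?_)
    gcongr; norm_num
  rw [tsub_le_iff_right]
  have hA : a.toReal ≤ r ^ 3 * c.toReal := by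
    have := ENNReal.toReal_mono (ENNReal.mul_ne_top ENNReal.ofReal_ne_top hc) h1
    rwa [ENNReal.toReal_mul, ENNReal.toReal_ofReal (by positivity)] at this
  have hB : J.toReal ≤ 8 * c.toReal := by
    have := ENNReal.toReal_mono (ENNReal.mul_ne_top (by simp) hc) h2
    rw [ENNReal.toReal_mul] at this
    norm_num at this; exact this
  rw [← ENNReal.toReal_le_toReal ha (ENNReal.add_ne_top.2 ⟨ENNReal.mul_ne_top ENNReal.ofReal_ne_top (ENNReal.sub_ne_top hc), hJ32⟩),
    ENNReal.toReal_add (ENNReal.mul_ne_top ENNReal.ofReal_ne_top (ENNReal.sub_ne_top hc)) hJ32, ENNReal.toReal_mul,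
    ENNReal.toReal_ofReal (by positivity), ENNReal.toReal_sub_of_le h3 hc, ENNReal.toReal_div]
  norm_num
  have hJ0 : 0 ≤ J.toReal := ENNReal.toReal_nonneg
  set A := a.toReal
  set B := c.toReal
  set I := J.toReal
  have k1 : 0 ≤ r ^ 3 * (r - 1) * (8 * B - I) := by
    have : 0 ≤ r - 1 := by linarith
    have : 0 ≤ 8 * B - I := by linarith
    positivity
  have k2 : 0 ≤ (r - 1) * (3 * r ^ 3 - r ^ 2 - r - 1) * I := by
    have e1 : 0 ≤ r - 1 := by linarith
    have e2 : 0 ≤ 3 * r ^ 3 - r ^ 2 - r - 1 := by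
      have : r ^ 2 ≥ 1 := by nlinarith
      have : r ^ 3 ≥ r ^ 2 := by nlinarith
      nlinarith
    positivity
  nlinarith

def qq : ℝ := 31 / 32

lemma decomp {φ : ℝ → ENNReal} (hφ : Measurable φ) (h : Cone 4 φ) (hI : ∫⁻ x, φ x ∂gaussMeasure ≠ ⊤) (n : ℕ) :
    ∃ ψ : ℝ → ENNReal, Measurable ψ ∧ Cone 4 ψ ∧ 
      (∀ x ∈ II, UU^[n] φ x = ψ x + ENNReal.ofReal (1 - qq ^ n) * ∫⁻ x, φ x ∂gaussMeasure) ∧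
      ∫⁻ x, ψ x ∂gaussMeasure = ENNReal.ofReal (qq ^ n) * ∫⁻ x, φ x ∂gaussMeasure := by
  induction n with
  | zero => exact ⟨φ, hφ, h, by simp, by simp⟩
  | succ n ih =>
    obtain ⟨ψ, m, c, e, i⟩ := ih
    set I := ∫⁻ x, φ x ∂gaussMeasure
    set J := ∫⁻ x, ψ x ∂gaussMeasure with hJ
    have hq0 : 0 ≤ qq := by unfold qq; norm_num
    have hq1 : qq ≤ 1 := by unfold qq; norm_num
    have hqn : qq ^ n ≤ 1 := pow_le_one₀ hq0 hq1
    have hJt : J ≠ ⊤ := by rw [i]; exact ENNReal.mul_ne_top ENNReal.ofReal_ne_top hI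
    have hc3 := c.U4
    have hUJ : ∫⁻ x, UU ψ x ∂gaussMeasure = J := int_U m
    have hlow : ∀ y ∈ II, J ≤ 2 ^ 3 * UU ψ y := fun y hy => by
      have := hc3.int_le hy; rwa [hUJ] at this
    have hfin : ∀ y ∈ II, UU ψ y ≠ ⊤ := fun y hy => by
      have := hc3.le_int hy
      rw [hUJ] at this
      exact ne_top_of_le_ne_top (ENNReal.mul_ne_top (by simp) hJt) this
    have hle : ∀ y ∈ II, J / 32 ≤ UU ψ y := fun y hy => by
      refine ENNReal.div_le_of_le_mul' ((hlow y hy).trans ?_)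
      gcongr; norm_num
    have hJ32 : J / 32 ≠ ⊤ := ENNReal.div_ne_top hJt (by norm_num)
    have eJ : J / 32 = ENNReal.ofReal (qq ^ n / 32) * I := by
      rw [i, ENNReal.ofReal_div_of_pos (by norm_num)]
      simp only [div_eq_mul_inv]
      norm_num
      ring
    refine ⟨fun x => UU ψ x - J / 32, by fun_prop, ?_, ?_, ?_⟩
    · intro x hx y hy
      exact sub_cone_aux (rr_ge_one hx hy) (hc3 x hx y hy) (hlow y hy) hJt (hfin y hy)
    · intro x hx
      rw [Function.iterate_succ_apply', UU_congr e x hx, UU_add_const _ _ hx]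
      have e2 : ENNReal.ofReal (1 - qq ^ (n+1)) * I = J / 32 + ENNReal.ofReal (1 - qq ^ n) * I := by
        rw [eJ, ← add_mul, ← ENNReal.ofReal_add (by positivity) (by linarith)]
        congr 2; rw [pow_succ]; unfold qq; ring
      rw [e2, ← add_assoc, tsub_add_cancel_of_le (hle x hx)]
    · have e3 : ∫⁻ x, (UU ψ x - J / 32) ∂gaussMeasure = J - J / 32 := by
        rw [lintegral_sub measurable_const (by simp [hJ32]) (by filter_upwards [G_ae] with y hy using hle y hy), hUJ]
        simp
      simp only
      rw [e3, eJ, i, ← ENNReal.sub_mul (fun _ _ => hI), ← ENNReal.ofReal_sub _ (by positivity)]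
      congr 2; rw [pow_succ]; unfold qq; ring

lemma mix_upper {φ : ℝ → ENNReal} (hφ : Measurable φ) (h : Cone 4 φ) (hI : ∫⁻ x, φ x ∂gaussMeasure ≠ ⊤) (n : ℕ)
    {y : ℝ} (hy : y ∈ II) :
    UU^[n] φ y ≤ ENNReal.ofReal (1 + 16 * qq ^ n) * ∫⁻ x, φ x ∂gaussMeasure := by
  obtain ⟨ψ, m, c, e, i⟩ := decomp hφ h hI n
  have hq0 : 0 ≤ qq := by unfold qq; norm_num
  have hq1 : qq ≤ 1 := by unfold qq; norm_num
  have hqn : qq ^ n ≤ 1 := pow_le_one₀ hq0 hq1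
  rw [e y hy]
  have h1 := c.le_int hy
  rw [i] at h1
  calc _ ≤ 2 ^ 4 * (ENNReal.ofReal (qq ^ n) * ∫⁻ x, φ x ∂gaussMeasure) + ENNReal.ofReal 1 * ∫⁻ x, φ x ∂gaussMeasure := by
        gcongr; simp; positivity
    _ = _ := by
        rw [ENNReal.ofReal_add (by norm_num) (by positivity), ENNReal.ofReal_mul (by norm_num)]
        norm_num; ring

lemma mix_lower {φ : ℝ → ENNReal} (hφ : Measurable φ) (h : Cone 4 φ) (hI : ∫⁻ x, φ x ∂gaussMeasure ≠ ⊤) (n : ℕ)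
    {y : ℝ} (hy : y ∈ II) :
    ENNReal.ofReal (1 - qq ^ n) * ∫⁻ x, φ x ∂gaussMeasure ≤ UU^[n] φ y := by
  obtain ⟨ψ, m, c, e, i⟩ := decomp hφ h hI n
  rw [e y hy]
  exact le_add_self

end CMD
end

open MeasureTheory Filter Asymptotics Set
noncomputable section
namespace CMD
open ProbabilityTheory

def ff (x : ℝ) : ℝ := (⌊x⁻¹⌋₊ : ℝ) ^ ((1:ℝ)/3)
def Sm (m : ℕ) (x : ℝ) : ℝ := ∑ i ∈ Finset.range m, ff (gaussMap^[i] x)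

@[fun_prop] lemma ff_meas : Measurable ff := by
  unfold ff
  have : Measurable (fun x : ℝ => (⌊x⁻¹⌋₊ : ℝ)) := by fun_prop
  fun_prop

@[fun_prop] lemma Tn_meas' (N : ℕ) : Measurable (gaussMap^[N]) := gm_meas.iterate N

@[fun_prop] lemma Sm_meas (m : ℕ) : Measurable (Sm m) := by
  unfold Sm; fun_prop

lemma Sm_succ (m : ℕ) (x : ℝ) : Sm (m+1) x = ff x + Sm m (gaussMap x) := by
  unfold Sm
  rw [Finset.sum_range_succ', add_comm]
  simp

lemma ff_br {a : ℕ} {y : ℝ} (hy : y ∈ II) : ff (br a y) = ((a:ℝ) + 1) ^ ((1:ℝ)/3) := by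
  unfold ff; rw [floor_br hy]; push_cast; rfl

lemma cone_S (m : ℕ) : ∀ (ρ w : ℝ → ENNReal), Cone 2 ρ → Cone 2 (UU^[m] (fun x => ρ x * w (Sm m x))) := by
  induction m with
  | zero =>
    intro ρ w h x hx y hy
    simp only [Function.iterate_zero, id, Sm, Finset.range_zero, Finset.sum_empty]
    rw [← mul_assoc]
    gcongr
    exact h x hx y hy
  | succ m ih =>
    intro ρ w h
    rw [Function.iterate_succ_apply]
    have e : ∀ y ∈ II, UU (fun x => ρ x * w (Sm (m+1) x)) y =
      ∑' a : ℕ, (ENNReal.ofReal (wt a y) * ρ (br a y)) * w (((a:ℝ) + 1) ^ ((1:ℝ)/3) + Sm m y) := by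
      intro y hy
      unfold UU
      congr 1; ext a
      simp only
      rw [Sm_succ, ff_br hy, T_br hy, mul_assoc]
    have e2 := UUn_congr m e
    rw [UUn_tsum m (fun (a : ℕ) y => (ENNReal.ofReal (wt a y) * ρ (br a y)) * w (((a:ℝ) + 1) ^ ((1:ℝ)/3) + Sm m y))] at e2
    refine Cone.congr (Cone.tsum fun a => ?_) e2
    exact ih (fun y => ENNReal.ofReal (wt a y) * ρ (br a y)) (fun s => w (((a:ℝ) + 1) ^ ((1:ℝ)/3) + s)) (h.bterm (K := 1) a)

lemma cone_one : Cone 2 (fun _ => 1) := by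
  intro x hx y hy
  simp only [mul_one]
  rw [← ENNReal.ofReal_one]
  exact ENNReal.ofReal_le_ofReal (one_le_pow₀ (rr_ge_one hx hy))

lemma cone_S1 (m : ℕ) (w : ℝ → ENNReal) : Cone 2 (UU^[m] (fun x => w (Sm m x))) := by
  have := cone_S m (fun _ => 1) w cone_one
  simpa using this

lemma UUn_meas (n : ℕ) {φ : ℝ → ENNReal} (h : Measurable φ) : Measurable (UU^[n] φ) := by
  induction n generalizing φ with
  | zero => exact h
  | succ n ih => rw [Function.iterate_succ_apply]; exact ih (UU_meas h)

lemma int_Un (n : ℕ) {φ : ℝ → ENNReal} (hφ : Measurable φ) :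
    ∫⁻ y, UU^[n] φ y ∂gaussMeasure = ∫⁻ x, φ x ∂gaussMeasure := by
  induction n generalizing φ with
  | zero => rfl
  | succ n ih => rw [Function.iterate_succ_apply, ih (UU_meas hφ), int_U hφ]

lemma PI_cons (k : ℕ) (L : Measure ℝ) [IsProbabilityMeasure L] {F : (Fin (k+1) → ℝ) → ENNReal} (hF : Measurable F) :
    ∫⁻ z, F z ∂(PI (k+1) L) = ∫⁻ s, ∫⁻ z, F (Fin.cons s z) ∂(PI k L) ∂L := by
  have hm := (measurePreserving_piFinSuccAbove (fun _ : Fin (k+1) => L) 0).symm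
  unfold PI
  rw [← hm.lintegral_comp hF, lintegral_prod]
  · simp_rw [MeasurableEquiv.piFinSuccAbove_symm_apply, Fin.insertNthEquiv, Fin.insertNth_zero]
    rfl
  · exact (hF.comp hm.measurable).aemeasurable

section
variable (m : ℕ) (g : ℝ → ℝ)

def Xv (k : ℕ) (x : ℝ) : Fin k → ℝ := fun j => g (Sm m (gaussMap^[2 * m * j] x))

lemma Xv_succ (k : ℕ) (x : ℝ) : Xv m g (k+1) x = Fin.cons (g (Sm m x)) (Xv m g k (gaussMap^[2*m] x)) := by
  funext j
  refine Fin.cases ?_ (fun i => ?_) j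
  · simp [Xv]
  · simp only [Xv, Fin.cons_succ, Fin.val_succ]
    rw [← Function.iterate_add_apply]
    congr 4

variable {g}

lemma Xv_meas (hg : Measurable g) (k : ℕ) : Measurable (Xv m g k) := by
  unfold Xv
  refine measurable_pi_lambda _ fun j => ?_
  fun_prop

def lawS (m : ℕ) (g : ℝ → ℝ) : Measure ℝ := gaussMeasure.map (fun x => g (Sm m x))

lemma lawS_prob (hg : Measurable g) : IsProbabilityMeasure (lawS m g) :=
  Measure.isProbabilityMeasure_map (by fun_prop)

lemma cons_meas (k : ℕ) : Measurable (fun z : ℝ × (Fin k → ℝ) => (Fin.cons z.1 z.2 : Fin (k+1) → ℝ)) := by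
  refine measurable_pi_lambda _ fun j => ?_
  refine Fin.cases ?_ (fun i => ?_) j
  · simp only [Fin.cons_zero]; fun_prop
  · simp only [Fin.cons_succ]; fun_prop

lemma mixing (hg : Measurable g) (k : ℕ) : ∀ {F : (Fin k → ℝ) → ENNReal}, Measurable F → (∀ z, F z ≤ 1) →
    ENNReal.ofReal (1 - qq ^ m) ^ k * ∫⁻ z, F z ∂(PI k (lawS m g)) ≤ ∫⁻ x, F (Xv m g k x) ∂gaussMeasure ∧
    ∫⁻ x, F (Xv m g k x) ∂gaussMeasure ≤ ENNReal.ofReal (1 + 16 * qq ^ m) ^ k * ∫⁻ z, F z ∂(PI k (lawS m g)) := by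
  have hpr := lawS_prob m hg
  induction k with
  | zero =>
    intro F _ _
    have e : ∀ z : Fin 0 → ℝ, F z = F default := fun z => by rw [Subsingleton.elim z default]
    simp only [e]
    simp
  | succ k ih =>
    intro F hF hF1
    have hc : Measurable (fun z : ℝ × ℝ => (Fin.cons (g (Sm m z.1)) (Xv m g k z.2) : Fin (k+1) → ℝ)) :=
      (cons_meas k).comp (f := fun z : ℝ × ℝ => (g (Sm m z.1), Xv m g k z.2))
        ((by fun_prop : Measurable fun z : ℝ × ℝ => g (Sm m z.1)).prodMk ((Xv_meas m hg k).comp measurable_snd))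
    have hΦ : Measurable (Function.uncurry fun x y => F (Fin.cons (g (Sm m x)) (Xv m g k y))) := hF.comp hc
    have e1 : ∫⁻ x, F (Xv m g (k+1) x) ∂gaussMeasure =
      ∫⁻ y, UU^[2*m] (fun x => F (Fin.cons (g (Sm m x)) (Xv m g k y))) y ∂gaussMeasure := by
      simp_rw [Xv_succ]
      exact dualN (2*m) hΦ
    have hconsz : ∀ s, Measurable (fun z : Fin k → ℝ => F (Fin.cons s z)) := fun s =>
      hF.comp ((cons_meas k).comp (measurable_const.prodMk measurable_id))
    have e2 : ∫⁻ z, F z ∂(PI (k+1) (lawS m g)) =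
        ∫⁻ x, ∫⁻ z, F (Fin.cons (g (Sm m x)) z) ∂(PI k (lawS m g)) ∂gaussMeasure := by
      rw [PI_cons k _ hF]
      have hmeas : Measurable (fun s => ∫⁻ z, F (Fin.cons s z) ∂(PI k (lawS m g))) :=
        Measurable.lintegral_prod_right' (ν := PI k (lawS m g)) (f := fun z : ℝ × (Fin k → ℝ) => F (Fin.cons z.1 z.2))
          (hF.comp (cons_meas k))
      exact lintegral_map (μ := gaussMeasure) hmeas (by fun_prop)
    have hx : ∀ y, Measurable (fun x => F (Fin.cons (g (Sm m x)) (Xv m g k y))) := fun y =>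
      hΦ.comp (f := fun x => (x, y)) (measurable_id.prodMk measurable_const)
    have hfin : ∀ y, ∫⁻ x, F (Fin.cons (g (Sm m x)) (Xv m g k y)) ∂gaussMeasure ≠ ⊤ := fun y => by
      refine ne_top_of_le_ne_top ENNReal.one_ne_top ((lintegral_mono (g := fun _ => 1) fun x => hF1 _).trans ?_)
      simp
    have hC : ∀ y, Cone 4 (UU^[m] (fun x => F (Fin.cons (g (Sm m x)) (Xv m g k y)))) := fun y =>
      (cone_S1 m (fun s => F (Fin.cons (g s) (Xv m g k y)))).mono (by norm_num)
    have hswap : ∫⁻ y, ∫⁻ x, F (Fin.cons (g (Sm m x)) (Xv m g k y)) ∂gaussMeasure ∂gaussMeasure =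
        ∫⁻ x, ∫⁻ y, F (Fin.cons (g (Sm m x)) (Xv m g k y)) ∂gaussMeasure ∂gaussMeasure :=
      lintegral_lintegral_swap (f := fun y x => F (Fin.cons (g (Sm m x)) (Xv m g k y)))
        (hΦ.comp measurable_swap).aemeasurable
    rw [e1, e2]
    simp_rw [two_mul m, Function.iterate_add_apply]
    constructor
    · calc _ ≤ ENNReal.ofReal (1 - qq ^ m) * ∫⁻ y, ∫⁻ x, F (Fin.cons (g (Sm m x)) (Xv m g k y)) ∂gaussMeasure ∂gaussMeasure := by
            rw [hswap, pow_succ', mul_assoc, ← lintegral_const_mul' _ _ (by simp)]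
            gcongr with x
            exact (ih (hconsz _) (fun z => hF1 _)).1
        _ ≤ _ := by
            rw [← lintegral_const_mul' _ _ (by simp)]
            refine lintegral_mono_ae ?_
            filter_upwards [G_ae] with y hy
            have := mix_lower (UUn_meas m (hx y)) (hC y) (by rw [int_Un m (hx y)]; exact hfin y) m hy
            rwa [int_Un m (hx y)] at this
    · calc _ ≤ ENNReal.ofReal (1 + 16 * qq ^ m) * ∫⁻ y, ∫⁻ x, F (Fin.cons (g (Sm m x)) (Xv m g k y)) ∂gaussMeasure ∂gaussMeasure := by
            rw [← lintegral_const_mul' _ _ (by simp)]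
            refine lintegral_mono_ae ?_
            filter_upwards [G_ae] with y hy
            have := mix_upper (UUn_meas m (hx y)) (hC y) (by rw [int_Un m (hx y)]; exact hfin y) m hy
            rwa [int_Un m (hx y)] at this
        _ ≤ _ := by
            rw [hswap, pow_succ', mul_assoc, ← lintegral_const_mul' (ENNReal.ofReal (1 + 16 * qq ^ m) ^ k) _ (by simp)]
            gcongr with x
            exact (ih (hconsz _) (fun z => hF1 _)).2

end

end CMD
end

open MeasureTheory Filter Asymptotics Set
noncomputable section
namespace CMD
open ProbabilityTheory

lemma ff_nonneg (x : ℝ) : 0 ≤ ff x := by unfold ff; positivity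

/-- bound for `U (f^s)` -/
def CU (s : ℝ) : ENNReal := ∑' a : ℕ, ENNReal.ofReal (2 * ((a:ℝ) + 1) ^ (s / 3 - 2))

lemma CU_lt {s : ℝ} (hs : s < 3) : CU s ≠ ⊤ := by
  unfold CU
  have : Summable (fun a : ℕ => 2 * ((a:ℝ) + 1) ^ (s / 3 - 2)) := by
    have h := (Real.summable_nat_rpow (p := s / 3 - 2)).2 (by linarith)
    have h2 := ((summable_nat_add_iff 1).2 h).mul_left 2
    refine h2.congr fun a => by push_cast; rfl
  rw [← ENNReal.ofReal_tsum_of_nonneg (fun a => by positivity) this]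
  exact ENNReal.ofReal_ne_top

lemma UU_ff_le (s : ℝ) {y : ℝ} (hy : y ∈ II) : UU (fun x => ENNReal.ofReal (ff x ^ s)) y ≤ CU s := by
  unfold UU CU
  refine ENNReal.tsum_le_tsum fun a => ?_
  rw [← ENNReal.ofReal_mul (wt_pos hy).le]
  apply ENNReal.ofReal_le_ofReal
  rw [ff_br hy, ← Real.rpow_mul (by positivity)]
  have h1 := hy.1
  have h2 := hy.2
  have ha : (0:ℝ) ≤ a := by positivity
  have e : ((a:ℝ) + 1) ^ (s / 3 - 2) = (((a:ℝ) + 1) ^ 2)⁻¹ * ((a:ℝ) + 1) ^ (s / 3) := by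
    rw [Real.rpow_sub (by positivity)]
    norm_cast
    field_simp
  rw [e, show 1 / 3 * s = s / 3 by ring, ← mul_assoc]
  have : wt a y ≤ 2 * (((a:ℝ) + 1) ^ 2)⁻¹ := by
    unfold wt
    rw [← div_eq_mul_inv]
    gcongr
    · linarith
    · nlinarith
  gcongr

lemma lint_ff {s : ℝ} (hs : s < 3) : ∫⁻ x, ENNReal.ofReal (ff x ^ s) ∂gaussMeasure ≠ ⊤ := by
  rw [← int_U (by fun_prop)]
  refine ne_top_of_le_ne_top (CU_lt hs) ?_
  refine (lintegral_mono_ae (g := fun _ => CU s) ?_).trans (by simp)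
  filter_upwards [G_ae] with y hy using UU_ff_le s hy

lemma ff_int {s : ℝ} (hs : s < 3) : Integrable (fun x => ff x ^ s) gaussMeasure := by
  refine ⟨(ff_meas.pow_const s).aestronglyMeasurable, ?_⟩
  rw [hasFiniteIntegral_iff_ofReal (ae_of_all _ fun x => Real.rpow_nonneg (ff_nonneg x) s)]
  exact (lint_ff hs).lt_top

lemma ff_int1 : Integrable ff gaussMeasure := by
  have := ff_int (s := 1) (by norm_num)
  simpa using this

lemma wt_integral (a : ℕ) : ∫⁻ y, ENNReal.ofReal (wt a y) ∂gaussMeasure =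
    ENNReal.ofReal ((Real.log 2)⁻¹ * Real.log (1 + (((a:ℝ) + 1) * ((a:ℝ) + 3))⁻¹)) := by
  have hl := Real.log_pos (show (1:ℝ) < 2 by norm_num)
  have ha : (0:ℝ) ≤ a := by positivity
  rw [lintG]
  have e : ∀ y ∈ II, ENNReal.ofReal (dens y) * ENNReal.ofReal (wt a y) =
      ENNReal.ofReal ((Real.log 2)⁻¹ * (((a:ℝ) + 1 + y)⁻¹ - ((a:ℝ) + 2 + y)⁻¹)) := by
    intro y hy
    have := hy.1
    rw [← ENNReal.ofReal_mul (by unfold dens; positivity)]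
    congr 1
    unfold dens wt
    field_simp; ring
  rw [setLIntegral_congr_fun measurableSet_Ioo e]
  have hi : ∀ c : ℝ, 0 < c → IntervalIntegrable (fun y : ℝ => (c + y)⁻¹) volume 0 1 := by
    intro c hc
    apply ContinuousOn.intervalIntegrable
    apply ContinuousOn.inv₀ (by fun_prop)
    intro y hy
    rw [uIcc_of_le (by norm_num)] at hy
    have := hy.1; positivity
  have hi2 := ((hi ((a:ℝ) + 1) (by positivity)).sub (hi ((a:ℝ)+2) (by positivity))).const_mul (Real.log 2)⁻¹
  rw [← ofReal_integral_eq_lintegral_ofReal]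
  · congr 1
    rw [← integral_Ioc_eq_integral_Ioo, ← intervalIntegral.integral_of_le (by norm_num),
      intervalIntegral.integral_const_mul, intervalIntegral.integral_sub (hi _ (by positivity)) (hi _ (by positivity))]
    have h1 : ∀ c : ℝ, 0 < c → ∫ y in (0:ℝ)..1, (c + y)⁻¹ = Real.log ((c + 1) / c) := by
      intro c hc
      have := intervalIntegral.integral_comp_add_left (a := 0) (b := 1) (fun x : ℝ => x⁻¹) c
      rw [this, integral_inv_of_pos (by linarith) (by linarith)]; simp
    rw [h1 _ (by positivity), h1 _ (by positivity), ← Real.log_div (by positivity) (by positivity)]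
    congr 2
    field_simp; ring
  · exact ((intervalIntegrable_iff_integrableOn_Ioc_of_le (by norm_num)).1 hi2).mono_set Ioo_subset_Ioc_self
  · filter_upwards [ae_restrict_mem measurableSet_Ioo] with y hy
    have := hy.1
    have h2 : ((a:ℝ) + 2 + y)⁻¹ ≤ ((a:ℝ) + 1 + y)⁻¹ := by gcongr; norm_num
    simp only [Pi.zero_apply]
    have : 0 ≤ ((a:ℝ) + 1 + y)⁻¹ - ((a:ℝ) + 2 + y)⁻¹ := by linarith
    positivity

lemma mu_eq : ∫ x, ff x ∂gaussMeasure = μcf := by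
  rw [integral_eq_lintegral_of_nonneg_ae (ae_of_all _ ff_nonneg) (by fun_prop)]
  rw [← int_U (by fun_prop)]
  have e : ∫⁻ y, UU (fun x => ENNReal.ofReal (ff x)) y ∂gaussMeasure =
      ∫⁻ y, ∑' a : ℕ, ENNReal.ofReal (((a:ℝ) + 1) ^ ((1:ℝ)/3)) * ENNReal.ofReal (wt a y) ∂gaussMeasure := by
    refine lintegral_congr_ae ?_
    filter_upwards [G_ae] with y hy
    unfold UU
    congr 1; ext a
    simp only
    rw [ff_br hy, mul_comm]
  rw [e, lintegral_tsum (fun a => by fun_prop)]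
  simp_rw [lintegral_const_mul' _ _ ENNReal.ofReal_ne_top, wt_integral]
  rw [ENNReal.tsum_toReal_eq (fun a => ENNReal.mul_ne_top ENNReal.ofReal_ne_top ENNReal.ofReal_ne_top)]
  unfold μcf
  rw [← tsum_mul_left]
  congr 1; ext a
  have hl := Real.log_pos (show (1:ℝ) < 2 by norm_num)
  have : 0 ≤ Real.log (1 + (((a:ℝ) + 1) * ((a:ℝ) + 3))⁻¹) := by
    apply Real.log_nonneg
    have : 0 ≤ (((a:ℝ) + 1) * ((a:ℝ) + 3))⁻¹ := by positivity
    linarith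
  rw [ENNReal.toReal_mul, ENNReal.toReal_ofReal (by positivity), ENNReal.toReal_ofReal (by positivity)]
  ring

lemma mu_nonneg : 0 ≤ μcf := by rw [← mu_eq]; exact integral_nonneg ff_nonneg

lemma mu_lint : ∫⁻ x, ENNReal.ofReal (ff x) ∂gaussMeasure = ENNReal.ofReal μcf := by
  rw [← mu_eq, ofReal_integral_eq_lintegral_ofReal ff_int1 (ae_of_all _ ff_nonneg)]

def Fn (n : ℕ) : ℝ → ENNReal := UU^[n] (fun x => ENNReal.ofReal (ff x))

@[fun_prop] lemma Fn_meas (n : ℕ) : Measurable (Fn n) := UUn_meas n (by fun_prop)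

lemma Fn_succ (n : ℕ) : Fn (n+1) = UU (Fn n) := Function.iterate_succ_apply' _ _ _

lemma Fn_bounds (n : ℕ) {y : ℝ} (hy : y ∈ II) :
    Fn (n+1) y ≠ ⊤ ∧ |(Fn (n+1) y).toReal - μcf| ≤ 16 * μcf * qq ^ n := by
  have hq0 : 0 ≤ qq := by unfold qq; norm_num
  have hq1 : qq ≤ 1 := by unfold qq; norm_num
  have hqn : qq ^ n ≤ 1 := pow_le_one₀ hq0 hq1
  have hqn0 : 0 ≤ qq ^ n := pow_nonneg hq0 _
  have hm := mu_nonneg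
  have hC : Cone 4 (UU (fun x => ENNReal.ofReal (ff x))) := by
    have := (cone_S1 1 (fun s => ENNReal.ofReal s)).mono (show 2 ≤ 4 by norm_num)
    simpa [Sm] using this
  have hI : ∫⁻ x, UU (fun x => ENNReal.ofReal (ff x)) x ∂gaussMeasure = ENNReal.ofReal μcf := by
    rw [int_U (by fun_prop), mu_lint]
  have e : Fn (n+1) = UU^[n] (UU (fun x => ENNReal.ofReal (ff x))) := Function.iterate_succ_apply _ _ _
  have h1 := mix_upper (UU_meas (by fun_prop)) hC (by rw [hI]; exact ENNReal.ofReal_ne_top) n hy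
  have h2 := mix_lower (UU_meas (by fun_prop)) hC (by rw [hI]; exact ENNReal.ofReal_ne_top) n hy
  rw [hI, ← e, ← ENNReal.ofReal_mul (by linarith)] at h1 h2
  have ht : Fn (n+1) y ≠ ⊤ := ne_top_of_le_ne_top ENNReal.ofReal_ne_top h1
  refine ⟨ht, ?_⟩
  have h3 := ENNReal.toReal_le_of_le_ofReal (by positivity) h1
  have h4 := (ENNReal.ofReal_le_iff_le_toReal ht).1 h2
  rw [abs_le]
  constructor <;> nlinarith [mul_nonneg hm hqn0]

def vv (n : ℕ) : ℝ → ℝ := II.indicator (fun y => (Fn (n+1) y).toReal - μcf)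

@[fun_prop] lemma vv_meas (n : ℕ) : Measurable (vv n) := by
  unfold vv
  exact Measurable.indicator (by fun_prop) measurableSet_Ioo

lemma vv_le (n : ℕ) (y : ℝ) : |vv n y| ≤ 16 * μcf * qq ^ n := by
  unfold vv
  by_cases hy : y ∈ II
  · rw [indicator_of_mem hy]; exact (Fn_bounds n hy).2
  · rw [indicator_of_notMem hy, abs_zero]
    have := mu_nonneg
    unfold qq; positivity

lemma qsum : HasSum (fun n : ℕ => 16 * μcf * qq ^ n) (512 * μcf) := by
  have := (hasSum_geometric_of_lt_one (r := qq) (by unfold qq; norm_num) (by unfold qq; norm_num)).mul_left (16 * μcf)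
  have e : 16 * μcf * (1 - qq)⁻¹ = 512 * μcf := by unfold qq; norm_num; ring
  rw [e] at this; exact this

def uu (y : ℝ) : ℝ := ∑' n, vv n y

lemma vv_summ (y : ℝ) : Summable (fun n => vv n y) :=
  Summable.of_norm_bounded qsum.summable (fun n => vv_le n y)

lemma uu_le (y : ℝ) : |uu y| ≤ 512 * μcf := by
  unfold uu; rw [← Real.norm_eq_abs]
  exact tsum_of_norm_bounded qsum (fun n => vv_le n y)

@[fun_prop] lemma uu_meas : Measurable uu := by
  refine measurable_of_tendsto_metrizable (f := fun N y => ∑ n ∈ Finset.range N, vv n y) (fun N => by fun_prop) ?_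
  rw [tendsto_pi_nhds]
  intro y
  exact (vv_summ y).hasSum.tendsto_sum_nat

lemma T_mp : MeasurePreserving gaussMap gaussMeasure gaussMeasure := by
  refine ⟨gm_meas, ?_⟩
  ext A hA
  rw [Measure.map_apply gm_meas hA, ← lintegral_indicator_one hA, ← lintegral_indicator_one (gm_meas hA)]
  have := dual_U (φ := fun _ => 1) (ψ := A.indicator 1) measurable_const (measurable_one.indicator hA)
  simp only [one_mul] at this
  refine Eq.trans (lintegral_congr fun x => ?_) (this.trans (lintegral_congr_ae ?_))
  · rfl
  · filter_upwards [G_ae] with y hy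
    have : UU (fun _ => 1) y = 1 := by unfold UU; simp [wt_tsum hy]
    rw [this, one_mul]

lemma map_wd {h : ℝ → ENNReal} (hh : Measurable h) :
    (gaussMeasure.withDensity h).map gaussMap = gaussMeasure.withDensity (UU h) := by
  ext A hA
  rw [Measure.map_apply gm_meas hA, withDensity_apply _ (gm_meas hA), withDensity_apply _ hA,
    ← lintegral_indicator (gm_meas hA), ← lintegral_indicator hA]
  have := dual_U (φ := h) (ψ := A.indicator 1) hh (measurable_one.indicator hA)
  refine Eq.trans (lintegral_congr fun x => ?_) (this.trans (lintegral_congr fun x => ?_))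
  · by_cases hx : gaussMap x ∈ A
    · have : x ∈ gaussMap ⁻¹' A := hx
      simp [hx]
    · have : x ∉ gaussMap ⁻¹' A := hx
      simp [hx]
  · by_cases hx : x ∈ A <;> simp [hx]

lemma dualR {h : ℝ → ENNReal} (hh : Measurable h) (h1 : ∀ᵐ x ∂gaussMeasure, h x < ⊤)
    (h2 : ∀ᵐ x ∂gaussMeasure, UU h x < ⊤) {φ : ℝ → ℝ} (hφ : Measurable φ)
    (hi : Integrable (fun y => (UU h y).toReal * φ y) gaussMeasure) :
    Integrable (fun x => (h x).toReal * φ (gaussMap x)) gaussMeasure ∧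
    ∫ x, (h x).toReal * φ (gaussMap x) ∂gaussMeasure = ∫ y, (UU h y).toReal * φ y ∂gaussMeasure := by
  have hi' : Integrable φ (gaussMeasure.withDensity (UU h)) := by
    rw [integrable_withDensity_iff_integrable_smul' (UU_meas hh) h2]; exact hi
  rw [← map_wd hh, integrable_map_measure hφ.aestronglyMeasurable (by fun_prop)] at hi'
  rw [integrable_withDensity_iff_integrable_smul' hh h1] at hi'
  refine ⟨hi', ?_⟩
  have e1 := integral_withDensity_eq_integral_toReal_smul hh h1 (fun x => φ (gaussMap x))
  have e2 := integral_withDensity_eq_integral_toReal_smul (UU_meas hh) h2 φ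
  rw [← map_wd hh, integral_map (by fun_prop) hφ.aestronglyMeasurable] at e2
  simp only [smul_eq_mul] at e1 e2
  rw [← e1, e2]

def dd (x : ℝ) : ℝ := ff x - μcf + uu x - uu (gaussMap x)
@[fun_prop] lemma dd_meas : Measurable dd := by unfold dd; fun_prop

lemma bdd_mul_int {φ v : ℝ → ℝ} (hφ : Integrable φ gaussMeasure) (hv : Measurable v) {B : ℝ} (hB : ∀ x, |v x| ≤ B) :
    Integrable (fun x => v x * φ x) gaussMeasure :=
  hφ.bdd_mul hv.aestronglyMeasurable (ae_of_all _ hB)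

lemma ae_fin (n : ℕ) : ∀ᵐ x ∂gaussMeasure, Fn n x < ⊤ := by
  rcases n with _ | n
  · exact ae_of_all _ fun x => ENNReal.ofReal_lt_top
  · filter_upwards [G_ae] with x hx using (Fn_bounds n hx).1.lt_top

lemma vv_ae (n : ℕ) : ∀ᵐ x ∂gaussMeasure, vv n x = (Fn (n+1) x).toReal - μcf := by
  filter_upwards [G_ae] with x hx
  unfold vv; rw [indicator_of_mem hx]

lemma Fn_int {φ : ℝ → ℝ} (hφ : Integrable φ gaussMeasure) (n : ℕ) :
    Integrable (fun x => (Fn (n+1) x).toReal * φ x) gaussMeasure := by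
  have h1 := (bdd_mul_int hφ (vv_meas n) (vv_le n)).add (hφ.const_mul μcf)
  refine h1.congr ?_
  filter_upwards [vv_ae n] with x hx
  simp only [Pi.add_apply]
  rw [hx]; ring

lemma step_e {φ : ℝ → ℝ} (hm : Measurable φ) (hφ : Integrable φ gaussMeasure) (n : ℕ) :
    Integrable (fun x => ((Fn n x).toReal - μcf) * φ (gaussMap x)) gaussMeasure ∧
    ∫ x, ((Fn n x).toReal - μcf) * φ (gaussMap x) ∂gaussMeasure = ∫ x, vv n x * φ x ∂gaussMeasure := by
  have h1 := ae_fin n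
  have h2 := ae_fin (n+1)
  have h3 := Fn_int hφ n
  rw [Fn_succ] at h2 h3
  obtain ⟨a1, a2⟩ := dualR (Fn_meas n) h1 h2 hm h3
  have hφT : Integrable (fun x => φ (gaussMap x)) gaussMeasure := T_mp.integrable_comp_of_integrable hφ
  have eT : ∫ x, φ (gaussMap x) ∂gaussMeasure = ∫ x, φ x ∂gaussMeasure := by
    have := integral_map (μ := gaussMeasure) (φ := gaussMap) (by fun_prop) (f := φ) hm.aestronglyMeasurable
    rw [T_mp.map_eq] at this
    exact this.symm
  simp_rw [sub_mul]
  refine ⟨a1.sub (hφT.const_mul _), ?_⟩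
  rw [integral_sub a1 (hφT.const_mul _), a2, integral_const_mul, eT, ← integral_const_mul,
    ← integral_sub h3 (hφ.const_mul _)]
  refine integral_congr_ae ?_
  filter_upwards [vv_ae n] with x hx
  rw [hx, ← Fn_succ]; ring

lemma orth {φ : ℝ → ℝ} (hm : Measurable φ) (hφ : Integrable φ gaussMeasure) :
    Integrable (fun x => dd x * φ (gaussMap x)) gaussMeasure ∧
    ∫ x, dd x * φ (gaussMap x) ∂gaussMeasure = 0 := by
  have hφT : Integrable (fun x => φ (gaussMap x)) gaussMeasure := T_mp.integrable_comp_of_integrable hφ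
  have hmT : ∀ g : ℝ → ℝ, Measurable g → ∫ x, g (gaussMap x) ∂gaussMeasure = ∫ x, g x ∂gaussMeasure := by
    intro g hg
    have := integral_map (μ := gaussMeasure) (φ := gaussMap) (by fun_prop) (f := g) hg.aestronglyMeasurable
    rw [T_mp.map_eq] at this
    exact this.symm
  have h0 := step_e hm hφ 0
  have key : ∀ ψ : ℝ → ℝ, Integrable ψ gaussMeasure →
      HasSum (fun n => ∫ x, vv n x * ψ x ∂gaussMeasure) (∫ x, uu x * ψ x ∂gaussMeasure) := by
    intro ψ hψ
    have hi : ∀ n, Integrable (fun x => vv n x * ψ x) gaussMeasure := fun n => bdd_mul_int hψ (vv_meas n) (vv_le n)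
    have := hasSum_integral_of_summable_integral_norm hi ?_
    · have e : (fun x => uu x * ψ x) = fun x => ∑' n, vv n x * ψ x := by
        ext x; unfold uu; rw [tsum_mul_right]
      rw [e]; exact this
    · refine Summable.of_nonneg_of_le (fun n => integral_nonneg fun x => norm_nonneg _) (fun n => ?_)
        (qsum.summable.mul_right (∫ x, ‖ψ x‖ ∂gaussMeasure))
      rw [← integral_const_mul]
      refine integral_mono (hi n).norm (hψ.norm.const_mul _) fun x => ?_
      simp only [norm_mul]
      gcongr
      exact vv_le n x
  have k1 := key _ hφT
  have k2 := key _ hφ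
  have e : ∀ n, ∫ x, vv n x * φ (gaussMap x) ∂gaussMeasure = ∫ x, vv (n+1) x * φ x ∂gaussMeasure := by
    intro n
    rw [← (step_e hm hφ (n+1)).2]
    refine integral_congr_ae ?_
    filter_upwards [vv_ae n] with x hx
    rw [hx]
  simp_rw [e] at k1
  have k3 := (hasSum_nat_add_iff' (f := fun n => ∫ x, vv n x * φ x ∂gaussMeasure) 1).2 k2
  have k4 := k1.unique k3
  rw [Finset.sum_range_one] at k4
  have i1 : Integrable (fun x => (ff x - μcf) * φ (gaussMap x)) gaussMeasure := by
    refine h0.1.congr (ae_of_all _ fun x => ?_)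
    simp only [Fn, Function.iterate_zero, id, ENNReal.toReal_ofReal (ff_nonneg x)]
  have e1 : ∫ x, (ff x - μcf) * φ (gaussMap x) ∂gaussMeasure = ∫ x, vv 0 x * φ x ∂gaussMeasure := by
    rw [← h0.2]
    refine integral_congr_ae (ae_of_all _ fun x => ?_)
    simp only [Fn, Function.iterate_zero, id, ENNReal.toReal_ofReal (ff_nonneg x)]
  have i2 : Integrable (fun x => uu x * φ (gaussMap x)) gaussMeasure := bdd_mul_int hφT uu_meas uu_le
  have i3 : Integrable (fun x => uu (gaussMap x) * φ (gaussMap x)) gaussMeasure :=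
    bdd_mul_int hφT (v := fun x => uu (gaussMap x)) (by fun_prop) (fun x => uu_le _)
  have ed : (fun x => dd x * φ (gaussMap x)) = fun x => ((ff x - μcf) * φ (gaussMap x) + uu x * φ (gaussMap x)) -
      uu (gaussMap x) * φ (gaussMap x) := by
    ext x; unfold dd; ring
  rw [ed]
  refine ⟨(i1.add i2).sub i3, ?_⟩
  have i12 : Integrable (fun x => (ff x - μcf) * φ (gaussMap x) + uu x * φ (gaussMap x)) gaussMeasure := i1.add i2
  rw [integral_sub i12 i3, integral_add i1 i2, e1, k4, hmT (fun x => uu x * φ x) (by fun_prop)]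
  ring

end CMD
end

open MeasureTheory Filter Asymptotics Set
noncomputable section
namespace CMD
open ProbabilityTheory

def KB : ℝ := 1025 * μcf
lemma KB_nonneg : 0 ≤ KB := by have := mu_nonneg; unfold KB; positivity

lemma dd_near (x : ℝ) : |dd x - ff x| ≤ KB := by
  have h1 := abs_le.1 (uu_le x)
  have h2 := abs_le.1 (uu_le (gaussMap x))
  have := mu_nonneg
  unfold dd KB
  rw [abs_le]
  constructor <;> linarith [h1.1, h1.2, h2.1, h2.2]

lemma dd_le (x : ℝ) : |dd x| ≤ ff x + KB := by
  have h1 := abs_le.1 (dd_near x)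
  have h2 := ff_nonneg x
  have := KB_nonneg
  rw [abs_le]; constructor <;> linarith [h1.1, h1.2]

def Mm (m : ℕ) (x : ℝ) : ℝ := ∑ i ∈ Finset.range m, dd (gaussMap^[i] x)

@[fun_prop] lemma Mm_meas (m : ℕ) : Measurable (Mm m) := by unfold Mm; fun_prop

lemma Mm_zero (x : ℝ) : Mm 0 x = 0 := by simp [Mm]

lemma Mm_succ (m : ℕ) (x : ℝ) : Mm (m+1) x = dd x + Mm m (gaussMap x) := by
  unfold Mm
  rw [Finset.sum_range_succ', add_comm]
  simp

lemma Mm_eq (m : ℕ) : ∀ x, Mm m x = Sm m x - m * μcf + uu x - uu (gaussMap^[m] x) := by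
  induction m with
  | zero => intro x; simp [Mm, Sm]
  | succ m ih =>
    intro x
    rw [Mm_succ, Sm_succ, ih, Function.iterate_succ_apply]
    unfold dd; push_cast; ring

lemma dd_memLp {s : ℝ} (h0 : 0 < s) (hs : s < 3) : MemLp dd (ENNReal.ofReal s) gaussMeasure := by
  have h1 : MemLp ff (ENNReal.ofReal s) gaussMeasure := by
    rw [← integrable_norm_rpow_iff (by fun_prop) (by simpa using h0) ENNReal.ofReal_ne_top,
      ENNReal.toReal_ofReal h0.le]
    refine (ff_int hs).congr (ae_of_all _ fun x => ?_)
    simp only [Real.norm_eq_abs, abs_of_nonneg (ff_nonneg x)]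
  have h2 : MemLp (fun x => dd x - ff x) (ENNReal.ofReal s) gaussMeasure :=
    MemLp.of_bound (by fun_prop) KB (ae_of_all _ dd_near)
  have h3 := h1.add h2
  refine h3.congr_norm (by fun_prop) (ae_of_all _ fun x => ?_)
  simp

lemma Mm_memLp {s : ℝ} (h0 : 0 < s) (hs : s < 3) (m : ℕ) : MemLp (Mm m) (ENNReal.ofReal s) gaussMeasure := by
  unfold Mm
  refine memLp_finsetSum _ fun i _ => ?_
  exact (dd_memLp h0 hs).comp_measurePreserving (T_mp.iterate i)

lemma Mm_int {s : ℝ} (h0 : 0 < s) (hs : s < 3) (m : ℕ) : Integrable (fun x => |Mm m x| ^ s) gaussMeasure := by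
  have := (Mm_memLp h0 hs m).integrable_norm_rpow (by simpa using h0) ENNReal.ofReal_ne_top
  rw [ENNReal.toReal_ofReal h0.le] at this
  exact this

lemma dd_int {s : ℝ} (h0 : 0 < s) (hs : s < 3) : Integrable (fun x => |dd x| ^ s) gaussMeasure := by
  have := Mm_int h0 hs 1
  simpa [Mm] using this

lemma Mm_int1 (m : ℕ) : Integrable (Mm m) gaussMeasure := by
  have := Mm_memLp (s := 1) (by norm_num) (by norm_num) m
  rw [ENNReal.ofReal_one] at this
  exact memLp_one_iff_integrable.1 this

lemma Mm_int2 (m : ℕ) : Integrable (fun x => Mm m x ^ 2) gaussMeasure := by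
  have := Mm_int (s := 2) (by norm_num) (by norm_num) m
  simpa using this

lemma dd_int2 : Integrable (fun x => dd x ^ 2) gaussMeasure := by
  have := Mm_int2 1
  simpa [Mm] using this

lemma T_int {φ : ℝ → ℝ} (hφ : Measurable φ) : ∫ x, φ (gaussMap x) ∂gaussMeasure = ∫ x, φ x ∂gaussMeasure := by
  have := integral_map (μ := gaussMeasure) (φ := gaussMap) (by fun_prop) (f := φ) hφ.aestronglyMeasurable
  rw [T_mp.map_eq] at this
  exact this.symm

lemma T_integrable {φ : ℝ → ℝ} (hφ : Integrable φ gaussMeasure) : Integrable (fun x => φ (gaussMap x)) gaussMeasure :=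
  T_mp.integrable_comp_of_integrable hφ

def sg2 : ℝ := ∫ x, dd x ^ 2 ∂gaussMeasure

lemma Mm_sq (m : ℕ) : ∫ x, Mm m x ^ 2 ∂gaussMeasure = m * sg2 := by
  induction m with
  | zero => simp [Mm]
  | succ m ih =>
    have e : ∀ x, Mm (m+1) x ^ 2 = (dd x ^ 2 + 2 * (dd x * Mm m (gaussMap x))) + Mm m (gaussMap x) ^ 2 := by
      intro x; rw [Mm_succ]; ring
    simp_rw [e]
    have o := orth (Mm_meas m) (Mm_int1 m)
    have i2 := T_integrable (Mm_int2 m)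
    have i12 : Integrable (fun x => dd x ^ 2 + 2 * (dd x * Mm m (gaussMap x))) gaussMeasure :=
      dd_int2.add (o.1.const_mul 2)
    rw [integral_add i12 i2, integral_add dd_int2 (o.1.const_mul 2), integral_const_mul, o.2,
      T_int (φ := fun x => Mm m x ^ 2) (by fun_prop), ih]
    push_cast; unfold sg2; ring

lemma sg2_pos : 0 < sg2 := by
  have h0 : 0 ≤ sg2 := integral_nonneg fun x => sq_nonneg _
  rcases h0.lt_or_eq with h | h
  · exact h
  exfalso
  have h1 := (integral_eq_zero_iff_of_nonneg (fun x => sq_nonneg (dd x)) dd_int2).1 h.symm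
  have h2 : ∀ᵐ x ∂gaussMeasure, ff x ≤ KB := by
    filter_upwards [h1] with x hx
    have : dd x = 0 := by simpa using hx
    have h := abs_le.1 (dd_near x)
    linarith [h.1]
  unfold gaussMeasure at h2
  rw [ae_withDensity_iff (by fun_prop)] at h2
  have h3 : ∀ᵐ x ∂(volume.restrict II), x ∈ II := ae_restrict_mem measurableSet_Ioo
  have h4 : ∀ᵐ x ∂(volume.restrict II), ff x ≤ KB := by
    filter_upwards [h2, h3] with x hx hI
    apply hx
    have := hI.1
    have hl := Real.log_pos (show (1:ℝ) < 2 by norm_num)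
    simp only [ne_eq, ENNReal.ofReal_eq_zero, not_le]
    positivity
  obtain ⟨N, hN⟩ := exists_nat_gt (KB ^ (3:ℝ))
  have hN1 : (0:ℝ) < (N:ℝ) + 2 := by positivity
  have hbig : ∀ x ∈ Ioo (0:ℝ) ((N:ℝ)+2)⁻¹, KB < ff x := by
    intro x hx
    have h5 : N + 2 ≤ ⌊x⁻¹⌋₊ := by
      apply Nat.le_floor
      push_cast
      rw [le_inv_comm₀ hN1 hx.1]; exact hx.2.le
    have h6 : (N:ℝ) + 2 ≤ (⌊x⁻¹⌋₊:ℝ) := by exact_mod_cast h5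
    have hK := KB_nonneg
    calc KB = (KB ^ (3:ℝ)) ^ ((1:ℝ)/3) := by rw [← Real.rpow_mul hK]; norm_num
      _ < ff x := by
        unfold ff
        apply Real.rpow_lt_rpow (by positivity) _ (by norm_num)
        linarith
  have h7 : volume.restrict II (Ioo (0:ℝ) ((N:ℝ)+2)⁻¹) = 0 := by
    refine measure_mono_null (fun x hx => ?_) h4
    simpa using hbig x hx
  rw [Measure.restrict_apply measurableSet_Ioo] at h7
  have h8 : Ioo (0:ℝ) ((N:ℝ)+2)⁻¹ ∩ II = Ioo (0:ℝ) ((N:ℝ)+2)⁻¹ := by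
    apply inter_eq_left.2
    apply Ioo_subset_Ioo_right
    apply inv_le_one_of_one_le₀
    have : (0:ℝ) ≤ N := by positivity
    linarith
  rw [h8, Real.volume_Ioo] at h7
  simp at h7
  linarith

lemma dd2_bound : ∃ D : ℝ, 0 ≤ D ∧ ∀ φ : ℝ → ℝ, Measurable φ → (∀ x, 0 ≤ φ x) → Integrable φ gaussMeasure →
    Integrable (fun x => φ (gaussMap x) * dd x ^ 2) gaussMeasure ∧
    ∫ x, φ (gaussMap x) * dd x ^ 2 ∂gaussMeasure ≤ D * ∫ x, φ x ∂gaussMeasure := by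
  have hK := KB_nonneg
  set E : ENNReal := 2 * CU 2 + ENNReal.ofReal (2 * KB ^ 2) with hE
  have hEt : E ≠ ⊤ := ENNReal.add_ne_top.2 ⟨ENNReal.mul_ne_top (by simp) (CU_lt (by norm_num)), ENNReal.ofReal_ne_top⟩
  refine ⟨E.toReal, ENNReal.toReal_nonneg, fun φ hm h0 hi => ?_⟩
  have key : ∫⁻ x, ENNReal.ofReal (φ (gaussMap x) * dd x ^ 2) ∂gaussMeasure ≤ E * ∫⁻ x, ENNReal.ofReal (φ x) ∂gaussMeasure := by
    have hmeas : Measurable (fun x => 2 * ENNReal.ofReal (ff x ^ (2:ℝ)) + ENNReal.ofReal (2 * KB ^ 2)) := by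
      have := ff_meas.pow_const (2:ℝ)
      fun_prop
    calc _ ≤ ∫⁻ x, (2 * ENNReal.ofReal (ff x ^ (2:ℝ)) + ENNReal.ofReal (2 * KB ^ 2)) * ENNReal.ofReal (φ (gaussMap x)) ∂gaussMeasure := by
          refine lintegral_mono fun x => ?_
          rw [show (2:ENNReal) = ENNReal.ofReal 2 by simp, ← ENNReal.ofReal_mul (by norm_num),
            ← ENNReal.ofReal_add (by have := ff_nonneg x; positivity) (by positivity),
            ← ENNReal.ofReal_mul (by have := ff_nonneg x; positivity)]
          apply ENNReal.ofReal_le_ofReal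
          rw [mul_comm]
          apply mul_le_mul_of_nonneg_right _ (h0 _)
          have h1 := dd_le x
          have h2 := ff_nonneg x
          rw [Real.rpow_two, ← sq_abs (dd x)]
          nlinarith [abs_nonneg (dd x), sq_nonneg (ff x - KB)]
      _ = ∫⁻ y, UU (fun x => 2 * ENNReal.ofReal (ff x ^ (2:ℝ)) + ENNReal.ofReal (2 * KB ^ 2)) y * ENNReal.ofReal (φ y) ∂gaussMeasure :=
          dual_U (φ := fun x => 2 * ENNReal.ofReal (ff x ^ (2:ℝ)) + ENNReal.ofReal (2 * KB ^ 2))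
            (ψ := fun y => ENNReal.ofReal (φ y)) hmeas (by fun_prop)
      _ ≤ ∫⁻ y, E * ENNReal.ofReal (φ y) ∂gaussMeasure := by
          refine lintegral_mono_ae ?_
          filter_upwards [G_ae] with y hy
          gcongr
          rw [UU_add_const _ _ hy, hE]
          gcongr
          have : UU (fun x => 2 * ENNReal.ofReal (ff x ^ (2:ℝ))) y = 2 * UU (fun x => ENNReal.ofReal (ff x ^ (2:ℝ))) y := by
            unfold UU
            rw [← ENNReal.tsum_mul_left]
            congr 1; ext a; ring
          rw [this]
          gcongr
          exact UU_ff_le 2 hy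
      _ = _ := lintegral_const_mul' _ _ hEt
  have hfin : ∫⁻ x, ENNReal.ofReal (φ x) ∂gaussMeasure = ENNReal.ofReal (∫ x, φ x ∂gaussMeasure) :=
    (ofReal_integral_eq_lintegral_ofReal hi (ae_of_all _ h0)).symm
  have hnn : ∀ x, 0 ≤ φ (gaussMap x) * dd x ^ 2 := fun x => mul_nonneg (h0 _) (sq_nonneg _)
  have hintg : Integrable (fun x => φ (gaussMap x) * dd x ^ 2) gaussMeasure := by
    refine ⟨by fun_prop, ?_⟩
    rw [hasFiniteIntegral_iff_ofReal (ae_of_all _ hnn)]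
    refine key.trans_lt ?_
    rw [hfin]
    exact ENNReal.mul_lt_top hEt.lt_top ENNReal.ofReal_lt_top
  refine ⟨hintg, ?_⟩
  rw [hfin, ← ofReal_integral_eq_lintegral_ofReal hintg (ae_of_all _ hnn), ← ENNReal.ofReal_toReal hEt,
    ← ENNReal.ofReal_mul ENNReal.toReal_nonneg] at key
  exact (ENNReal.ofReal_le_ofReal_iff (mul_nonneg ENNReal.toReal_nonneg (integral_nonneg h0))).1 key

lemma pineq1 {p : ℝ} (h2 : 2 ≤ p) (h3 : p ≤ 3) (x : ℝ) :
    |1 + x| ^ p ≤ 1 + p * x + 8 * (x ^ 2 + |x| ^ p) := by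
  have hxp : 0 ≤ |x| ^ p := by positivity
  rcases lt_or_ge x (-1) with h | h
  · have h1 : |1 + x| ≤ |x| := by rw [abs_of_neg (by linarith), abs_of_neg (by linarith)]; linarith
    have h4 : |1 + x| ^ p ≤ |x| ^ p := Real.rpow_le_rpow (abs_nonneg _) h1 (by linarith)
    nlinarith
  rcases le_or_gt x 1 with h' | h'
  · have h1 : 0 ≤ 1 + x := by linarith
    rw [abs_of_nonneg h1]
    have hb := rpow_one_add_le_one_add_mul_self h (p := p - 2) (by linarith) (by linarith)
    have e : (1 + x) ^ p = (1 + x) ^ 2 * (1 + x) ^ (p - 2) := by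
      rcases h1.eq_or_lt with h0 | h0
      · rw [← h0, Real.zero_rpow (by linarith)]; simp
      · rw [← Real.rpow_two, ← Real.rpow_add h0]; congr 1; ring
    rw [e]
    have h5 : (1 + x) ^ 2 * (1 + x) ^ (p - 2) ≤ (1 + x) ^ 2 * (1 + (p - 2) * x) := by gcongr
    refine h5.trans ?_
    have h6 : (p - 2) * x ^ 2 * x ≤ (p - 2) * x ^ 2 * 1 := by
      apply mul_le_mul_of_nonneg_left h'
      have : 0 ≤ p - 2 := by linarith
      positivity
    nlinarith [sq_nonneg x, mul_nonneg (show 0 ≤ 3 - p by linarith) (sq_nonneg x)]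
  · have h1 : |1 + x| ≤ 2 * |x| := by rw [abs_of_pos (by linarith), abs_of_pos (by linarith)]; linarith
    have h4 : |1 + x| ^ p ≤ (2 * |x|) ^ p := Real.rpow_le_rpow (abs_nonneg _) h1 (by linarith)
    rw [Real.mul_rpow (by norm_num) (abs_nonneg _)] at h4
    have h5 : (2:ℝ) ^ p ≤ 2 ^ (3:ℝ) := Real.rpow_le_rpow_of_exponent_le (by norm_num) h3
    have h6 : (2:ℝ) ^ (3:ℝ) = 8 := by norm_num
    rw [h6] at h5
    nlinarith [mul_le_mul_of_nonneg_right h5 hxp]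

lemma pineq {p : ℝ} (h2 : 2 < p) (h3 : p ≤ 3) (a b : ℝ) :
    |a + b| ^ p ≤ |a| ^ p + p * (b * (|a| ^ (p - 2) * a)) + 8 * (|a| ^ (p - 2) * b ^ 2 + |b| ^ p) := by
  by_cases ha : a = 0
  · subst ha
    have : 0 ≤ |b| ^ p := by positivity
    simp [Real.zero_rpow (show p ≠ 0 by linarith), Real.zero_rpow (show p - 2 ≠ 0 by linarith)]
    linarith
  have hA : 0 < |a| := abs_pos.2 ha
  have h := pineq1 h2.le h3 (b / a)
  have hp : 0 < |a| ^ p := by positivity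
  have e0 : |a| ^ p = |a| ^ (p - 2) * a ^ 2 := by
    rw [← sq_abs a, ← Real.rpow_two, ← Real.rpow_add hA]; congr 1; ring
  have e1 : |a + b| ^ p = |a| ^ p * |1 + b / a| ^ p := by
    rw [← Real.mul_rpow hA.le (abs_nonneg _), ← abs_mul]; congr 2; field_simp
  have e2 : |a| ^ p * |b / a| ^ p = |b| ^ p := by
    rw [← Real.mul_rpow hA.le (abs_nonneg _), ← abs_mul]; congr 2; field_simp
  rw [e1]
  calc |a| ^ p * |1 + b / a| ^ p ≤ |a| ^ p * (1 + p * (b / a) + 8 * ((b / a) ^ 2 + |b / a| ^ p)) := by gcongr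
    _ = |a| ^ p + p * (|a| ^ p * (b / a)) + 8 * (|a| ^ p * (b / a) ^ 2 + |a| ^ p * |b / a| ^ p) := by ring
    _ = _ := by
      rw [e2]
      have : |a| ^ p * (b / a) = b * (|a| ^ (p - 2) * a) := by rw [e0]; field_simp
      rw [this]
      have : |a| ^ p * (b / a) ^ 2 = |a| ^ (p - 2) * b ^ 2 := by rw [e0]; field_simp
      rw [this]

end CMD
end

open MeasureTheory Filter Asymptotics Set
noncomputable section
namespace CMD
open ProbabilityTheory

lemma low_mom {p : ℝ} (h2 : 2 < p) (h3 : p < 3) (m : ℕ) :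
    ∫ x, |Mm m x| ^ (p - 2) ∂gaussMeasure ≤ ((m:ℝ) + 1) ^ ((p - 2) / 2) * (1 + sg2) := by
  have hm : (0:ℝ) < (m:ℝ) + 1 := by positivity
  have hs := sg2_pos
  have hpt : ∀ x, |Mm m x| ^ (p - 2) ≤ ((m:ℝ) + 1) ^ ((p - 2) / 2) * (1 + Mm m x ^ 2 / ((m:ℝ) + 1)) := by
    intro x
    have hA := abs_nonneg (Mm m x)
    have hq : (0:ℝ) < √((m:ℝ) + 1) := Real.sqrt_pos.2 hm
    have e : |Mm m x| ^ (p - 2) = ((m:ℝ) + 1) ^ ((p - 2) / 2) * (|Mm m x| / √((m:ℝ) + 1)) ^ (p - 2) := by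
      rw [Real.div_rpow hA hq.le, Real.sqrt_eq_rpow, ← Real.rpow_mul hm.le]
      rw [show 1 / 2 * (p - 2) = (p - 2) / 2 by ring]
      have : 0 < ((m:ℝ) + 1) ^ ((p - 2) / 2) := by positivity
      field_simp
    rw [e]
    gcongr
    have e2 : Mm m x ^ 2 / ((m:ℝ) + 1) = (|Mm m x| / √((m:ℝ) + 1)) ^ 2 := by
      rw [div_pow, sq_abs, Real.sq_sqrt hm.le]
    rw [e2]
    set y := |Mm m x| / √((m:ℝ) + 1)
    have hy : 0 ≤ y := by positivity
    rcases le_or_gt y 1 with h | h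
    · have := Real.rpow_le_one hy h (show 0 ≤ p - 2 by linarith)
      nlinarith
    · have := Real.rpow_le_rpow_of_exponent_le h.le (show p - 2 ≤ 2 by linarith)
      rw [Real.rpow_two] at this
      linarith
  have hi1 : Integrable (fun x => 1 + Mm m x ^ 2 / ((m:ℝ) + 1)) gaussMeasure :=
    (integrable_const 1).add ((Mm_int2 m).div_const _)
  calc _ ≤ ∫ x, ((m:ℝ) + 1) ^ ((p - 2) / 2) * (1 + Mm m x ^ 2 / ((m:ℝ) + 1)) ∂gaussMeasure :=
        integral_mono (Mm_int (by linarith) (by linarith) m) (hi1.const_mul _) hpt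
    _ = ((m:ℝ) + 1) ^ ((p - 2) / 2) * (1 + m * sg2 / ((m:ℝ) + 1)) := by
        rw [integral_const_mul, integral_add (integrable_const 1) ((Mm_int2 m).div_const _), integral_div, Mm_sq]
        simp
    _ ≤ _ := by
        gcongr
        rw [div_le_iff₀ hm]
        nlinarith

lemma Mm_mom {p : ℝ} (h2 : 2 < p) (h3 : p < 3) : ∃ K : ℝ, 0 ≤ K ∧ ∀ m : ℕ,
    ∫ x, |Mm m x| ^ p ∂gaussMeasure ≤ K * (m:ℝ) ^ (p / 2) := by
  obtain ⟨D, hD, hb⟩ := dd2_bound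
  have hs := sg2_pos
  set J := ∫ x, |dd x| ^ p ∂gaussMeasure with hJ
  have hJ0 : 0 ≤ J := integral_nonneg fun x => by positivity
  refine ⟨8 * (D * (1 + sg2) + J), by positivity, fun m => ?_⟩
  set K := 8 * (D * (1 + sg2) + J) with hK
  have hK0 : 0 ≤ K := by positivity
  have main : ∫ x, |Mm m x| ^ p ∂gaussMeasure ≤ K * (m * (m:ℝ) ^ ((p - 2) / 2)) := by
    induction m with
    | zero => simp [Mm, Real.zero_rpow (show p ≠ 0 by linarith)]
    | succ m ih =>
      have hφm : Measurable (fun x => |Mm m x| ^ (p - 2) * Mm m x) := by fun_prop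
      have hφi : Integrable (fun x => |Mm m x| ^ (p - 2) * Mm m x) gaussMeasure := by
        refine (Mm_int (s := p - 1) (by linarith) (by linarith) m).mono' (by fun_prop) (ae_of_all _ fun x => ?_)
        rw [Real.norm_eq_abs, abs_mul, abs_of_nonneg (by positivity)]
        rcases (abs_nonneg (Mm m x)).eq_or_lt with h | h
        · rw [← h]; simp [Real.zero_rpow (show p - 1 ≠ 0 by linarith)]
        · have e : |Mm m x| ^ (p - 1) = |Mm m x| ^ (p - 2) * |Mm m x| := by
            rw [← Real.rpow_add_one h.ne']; congr 1; ring
          rw [e]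
      obtain ⟨o1, o2⟩ := orth hφm hφi
      obtain ⟨b1, b2⟩ := hb (fun x => |Mm m x| ^ (p - 2)) (by fun_prop) (fun x => by positivity)
        (Mm_int (by linarith) (by linarith) m)
      have hl := low_mom h2 h3 m
      have i1 := T_integrable (Mm_int (s := p) (by linarith) h3 m)
      have i4 := dd_int (s := p) (by linarith) h3
      have i12 : Integrable (fun x => |Mm m (gaussMap x)| ^ p +
          p * (dd x * (|Mm m (gaussMap x)| ^ (p - 2) * Mm m (gaussMap x)))) gaussMeasure := i1.add (o1.const_mul p)
      have i34 : Integrable (fun x => |Mm m (gaussMap x)| ^ (p - 2) * dd x ^ 2 + |dd x| ^ p) gaussMeasure := b1.add i4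
      have step : ∫ x, |Mm (m+1) x| ^ p ∂gaussMeasure ≤ ∫ x, |Mm m x| ^ p ∂gaussMeasure +
          8 * (∫ x, |Mm m (gaussMap x)| ^ (p - 2) * dd x ^ 2 ∂gaussMeasure + J) := by
        calc _ ≤ ∫ x, ((|Mm m (gaussMap x)| ^ p + p * (dd x * (|Mm m (gaussMap x)| ^ (p - 2) * Mm m (gaussMap x)))) +
              8 * (|Mm m (gaussMap x)| ^ (p - 2) * dd x ^ 2 + |dd x| ^ p)) ∂gaussMeasure := by
              refine integral_mono (Mm_int (by linarith) h3 _) (i12.add (i34.const_mul 8)) fun x => ?_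
              have := pineq h2 h3.le (Mm m (gaussMap x)) (dd x)
              simp only
              rw [Mm_succ, add_comm]
              exact this
          _ = _ := by
              rw [integral_add i12 (i34.const_mul 8), integral_add i1 (o1.const_mul p), integral_const_mul, integral_const_mul,
                o2, integral_add b1 i4, T_int (φ := fun x => |Mm m x| ^ p) (by fun_prop)]
              ring
      have hm1 : (1:ℝ) ≤ ((m:ℝ) + 1) ^ ((p - 2) / 2) := by
        apply Real.one_le_rpow
        · have : (0:ℝ) ≤ m := by positivity
          linarith
        · linarith
      have hmm : (m:ℝ) ^ ((p - 2) / 2) ≤ ((m:ℝ) + 1) ^ ((p - 2) / 2) := by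
        apply Real.rpow_le_rpow (by positivity) (by linarith) (by linarith)
      push_cast
      calc _ ≤ K * (m * (m:ℝ) ^ ((p - 2) / 2)) + 8 * (D * (((m:ℝ) + 1) ^ ((p - 2) / 2) * (1 + sg2)) + J) := by
            refine step.trans ?_
            gcongr
            exact b2.trans (by gcongr)
        _ ≤ K * (m * ((m:ℝ) + 1) ^ ((p - 2) / 2)) + 8 * (D * (((m:ℝ) + 1) ^ ((p - 2) / 2) * (1 + sg2)) + J * ((m:ℝ) + 1) ^ ((p - 2) / 2)) := by
            gcongr
            exact le_mul_of_one_le_right hJ0 hm1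
        _ = _ := by rw [hK]; ring
  refine main.trans (le_of_eq ?_)
  rcases Nat.eq_zero_or_pos m with h | h
  · subst h; simp [Real.zero_rpow (show p / 2 ≠ 0 by linarith)]
  · have hm : (0:ℝ) < m := by exact_mod_cast h
    have : (m:ℝ) ^ (p / 2) = m * (m:ℝ) ^ ((p - 2) / 2) := by
      nth_rw 2 [← Real.rpow_one (m:ℝ)]
      rw [← Real.rpow_add hm]; congr 1; ring
    rw [this]

def XX (m : ℕ) (x : ℝ) : ℝ := Sm m x - m * μcf
@[fun_prop] lemma XX_meas (m : ℕ) : Measurable (XX m) := by unfold XX; fun_prop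

def BB : ℝ := 1024 * μcf
lemma BB_nonneg : 0 ≤ BB := by have := mu_nonneg; unfold BB; positivity

lemma XX_near (m : ℕ) (x : ℝ) : |XX m x - Mm m x| ≤ BB := by
  have h1 := abs_le.1 (uu_le x)
  have h2 := abs_le.1 (uu_le (gaussMap^[m] x))
  rw [Mm_eq]; unfold XX BB
  rw [abs_le]
  constructor <;> linarith [h1.1, h1.2, h2.1, h2.2]

lemma XX_memLp {s : ℝ} (h0 : 0 < s) (hs : s < 3) (m : ℕ) : MemLp (XX m) (ENNReal.ofReal s) gaussMeasure := by
  have h2 : MemLp (fun x => XX m x - Mm m x) (ENNReal.ofReal s) gaussMeasure :=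
    MemLp.of_bound (by fun_prop) BB (ae_of_all _ (XX_near m))
  have h3 := (Mm_memLp h0 hs m).add h2
  refine h3.congr_norm (by fun_prop) (ae_of_all _ fun x => ?_)
  simp

lemma XX_int {s : ℝ} (h0 : 0 < s) (hs : s < 3) (m : ℕ) : Integrable (fun x => |XX m x| ^ s) gaussMeasure := by
  have := (XX_memLp h0 hs m).integrable_norm_rpow (by simpa using h0) ENNReal.ofReal_ne_top
  rw [ENNReal.toReal_ofReal h0.le] at this
  exact this

lemma XX_int1 (m : ℕ) : Integrable (XX m) gaussMeasure := by
  have := XX_memLp (s := 1) (by norm_num) (by norm_num) m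
  rw [ENNReal.ofReal_one] at this
  exact memLp_one_iff_integrable.1 this

lemma XX_int2 (m : ℕ) : Integrable (fun x => XX m x ^ 2) gaussMeasure := by
  have := XX_int (s := 2) (by norm_num) (by norm_num) m
  simpa using this

lemma XX_mean (m : ℕ) : ∫ x, XX m x ∂gaussMeasure = 0 := by
  induction m with
  | zero => simp [XX, Sm]
  | succ m ih =>
    have e : ∀ x, XX (m+1) x = (ff x - μcf) + XX m (gaussMap x) := by
      intro x; unfold XX; rw [Sm_succ]; push_cast; ring
    simp_rw [e]
    have i1 : Integrable (fun x => ff x - μcf) gaussMeasure := ff_int1.sub (integrable_const _)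
    rw [integral_add i1 (T_integrable (XX_int1 m)),
      integral_sub ff_int1 (integrable_const _), T_int (XX_meas m), ih, mu_eq]
    simp

lemma XX_var (m : ℕ) : m * sg2 / 2 - BB ^ 2 ≤ ∫ x, XX m x ^ 2 ∂gaussMeasure := by
  have h : ∫ x, Mm m x ^ 2 ∂gaussMeasure ≤ ∫ x, (2 * XX m x ^ 2 + 2 * BB ^ 2) ∂gaussMeasure := by
    refine integral_mono (Mm_int2 m) (((XX_int2 m).const_mul 2).add (integrable_const _)) fun x => ?_
    have h1 := abs_le.1 (XX_near m x)
    have h2 : (Mm m x - XX m x) ^ 2 ≤ BB ^ 2 := by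
      rw [sq_le_sq, abs_sub_comm, abs_of_nonneg BB_nonneg]; exact XX_near m x
    nlinarith [sq_nonneg (XX m x - (Mm m x - XX m x))]
  rw [Mm_sq, integral_add ((XX_int2 m).const_mul 2) (integrable_const _), integral_const_mul] at h
  simp at h
  linarith

lemma XX_mom {p : ℝ} (h2 : 2 < p) (h3 : p < 3) : ∃ K : ℝ, 0 ≤ K ∧ ∀ m : ℕ, 1 ≤ m →
    ∫ x, |XX m x| ^ p ∂gaussMeasure ≤ K * (m:ℝ) ^ (p / 2) := by
  obtain ⟨K, hK, h⟩ := Mm_mom h2 h3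
  have hB := BB_nonneg
  refine ⟨8 * (K + BB ^ p), by positivity, fun m hm => ?_⟩
  have hpt : ∀ x, |XX m x| ^ p ≤ 8 * (|Mm m x| ^ p + BB ^ p) := by
    intro x
    have h5 : (2:ℝ) ^ p ≤ 2 ^ (3:ℝ) := Real.rpow_le_rpow_of_exponent_le (by norm_num) h3.le
    have h6 : (2:ℝ) ^ (3:ℝ) = 8 := by norm_num
    rw [h6] at h5
    have h7 : |XX m x| ≤ |Mm m x| + BB := by
      have := abs_sub_abs_le_abs_sub (XX m x) (Mm m x)
      linarith [XX_near m x]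
    have hM := abs_nonneg (Mm m x)
    have hMp : 0 ≤ |Mm m x| ^ p := by positivity
    have hBp : 0 ≤ BB ^ p := by positivity
    rcases le_total |Mm m x| BB with hc | hc
    · calc _ ≤ (2 * BB) ^ p := Real.rpow_le_rpow (abs_nonneg _) (by linarith) (by linarith)
        _ = 2 ^ p * BB ^ p := Real.mul_rpow (by norm_num) hB
        _ ≤ 8 * BB ^ p := by gcongr
        _ ≤ _ := by linarith
    · calc _ ≤ (2 * |Mm m x|) ^ p := Real.rpow_le_rpow (abs_nonneg _) (by linarith) (by linarith)
        _ = 2 ^ p * |Mm m x| ^ p := Real.mul_rpow (by norm_num) hM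
        _ ≤ 8 * |Mm m x| ^ p := by gcongr
        _ ≤ _ := by linarith
  have hi := (Mm_int (s := p) (by linarith) h3 m)
  have hm1 : (1:ℝ) ≤ (m:ℝ) ^ (p / 2) := Real.one_le_rpow (by exact_mod_cast hm) (by linarith)
  have hBp : 0 ≤ BB ^ p := by positivity
  calc _ ≤ ∫ x, 8 * (|Mm m x| ^ p + BB ^ p) ∂gaussMeasure :=
        integral_mono (XX_int (by linarith) h3 m) ((hi.add (integrable_const _)).const_mul 8) hpt
    _ = 8 * (∫ x, |Mm m x| ^ p ∂gaussMeasure + BB ^ p) := by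
        rw [integral_const_mul, integral_add hi (integrable_const _)]; simp
    _ ≤ 8 * (K * (m:ℝ) ^ (p / 2) + BB ^ p * (m:ℝ) ^ (p / 2)) := by
        gcongr
        · exact h m
        · exact le_mul_of_one_le_right hBp hm1
    _ = _ := by ring

def sdev (m : ℕ) : ℝ := √(∫ x, XX m x ^ 2 ∂gaussMeasure)
def gN (m : ℕ) (s : ℝ) : ℝ := (s - m * μcf) / sdev m
@[fun_prop] lemma gN_meas (m : ℕ) : Measurable (gN m) := by unfold gN; fun_prop

lemma good_law {p : ℝ} (h2 : 2 < p) (h3 : p < 3) : ∃ C : ℝ, ∃ m0 : ℕ, ∀ m, m0 ≤ m →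
    0 < sdev m ∧ Good p C (lawS m (gN m)) := by
  obtain ⟨K, hK, h⟩ := XX_mom h2 h3
  have hs := sg2_pos
  obtain ⟨m1, hm1⟩ := exists_nat_gt (4 * BB ^ 2 / sg2)
  refine ⟨K / (sg2 / 4) ^ (p / 2), m1 + 1, fun m hm => ?_⟩
  have hmm : 4 * BB ^ 2 / sg2 < m := hm1.trans_le (by exact_mod_cast (by omega : m1 ≤ m))
  have hm1 : 1 ≤ m := by omega
  have hm0 : (0:ℝ) < m := by exact_mod_cast hm1
  rw [div_lt_iff₀ hs] at hmm
  have hv : m * (sg2 / 4) ≤ ∫ x, XX m x ^ 2 ∂gaussMeasure := by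
    have := XX_var m
    linarith
  have hv0 : 0 < ∫ x, XX m x ^ 2 ∂gaussMeasure := lt_of_lt_of_le (by positivity) hv
  have hsd : 0 < sdev m := Real.sqrt_pos.2 hv0
  have hsq : sdev m ^ 2 = ∫ x, XX m x ^ 2 ∂gaussMeasure := Real.sq_sqrt hv0.le
  have hmeas : AEMeasurable (fun x => gN m (Sm m x)) gaussMeasure := by fun_prop
  have eX : ∀ x, gN m (Sm m x) = XX m x / sdev m := fun x => rfl
  have habs : Measurable (fun x : ℝ => |x| ^ p) := (measurable_norm (α := ℝ)).pow_const p
  have hip : Integrable (fun x => |gN m (Sm m x)| ^ p) gaussMeasure := by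
    refine ((XX_int (s := p) (by linarith) h3 m).div_const (sdev m ^ p)).congr (ae_of_all _ fun x => ?_)
    simp only
    rw [eX, abs_div, abs_of_pos hsd, Real.div_rpow (abs_nonneg _) hsd.le]
  refine ⟨hsd, ?_, ?_, ?_, ?_, ?_, ?_, ?_⟩
  · exact lawS_prob m (gN_meas m)
  · unfold lawS
    rw [integrable_map_measure (by fun_prop) hmeas]
    exact (XX_int1 m).div_const _
  · unfold lawS
    rw [integral_map hmeas (by fun_prop)]
    simp_rw [eX]
    rw [integral_div, XX_mean, zero_div]
  · unfold lawS
    rw [integrable_map_measure (by fun_prop) hmeas]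
    refine ((XX_int2 m).div_const (sdev m ^ 2)).congr (ae_of_all _ fun x => ?_)
    simp only [Function.comp]
    rw [eX, div_pow]
  · unfold lawS
    rw [integral_map hmeas (by fun_prop)]
    simp_rw [eX, div_pow]
    rw [integral_div, hsq, div_self hv0.ne']
  · unfold lawS
    rw [integrable_map_measure habs.aestronglyMeasurable hmeas]
    exact hip
  · unfold lawS
    rw [integral_map hmeas habs.aestronglyMeasurable]
    have e : ∀ x, |gN m (Sm m x)| ^ p = |XX m x| ^ p / sdev m ^ p := by
      intro x
      rw [eX, abs_div, abs_of_pos hsd, Real.div_rpow (abs_nonneg _) hsd.le]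
    simp_rw [e]
    rw [integral_div]
    have e2 : sdev m ^ p = (sdev m ^ 2) ^ (p / 2) := by
      rw [← Real.rpow_two, ← Real.rpow_mul hsd.le]; congr 1; ring
    rw [e2, hsq]
    calc _ ≤ K * (m:ℝ) ^ (p / 2) / (m * (sg2 / 4)) ^ (p / 2) := by
          gcongr
          exact h m hm1
      _ = _ := by
          rw [Real.mul_rpow hm0.le (by positivity)]
          have : 0 < (m:ℝ) ^ (p / 2) := by positivity
          field_simp

end CMD
end

open MeasureTheory Filter Asymptotics Set
noncomputable section
namespace CMD
open ProbabilityTheory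

lemma sum_Icc_one (k : ℕ) (f : ℕ → ℝ) : ∑ j ∈ Finset.Icc 1 k, f j = ∑ j ∈ Finset.range k, f (j + 1) := by
  induction k with
  | zero => simp
  | succ k ih => rw [Finset.sum_Icc_succ_top (by omega), Finset.sum_range_succ, ih]

lemma block_eq (α : ℝ) (n j : ℕ) (x : ℝ) :
    blockSum cfRV α n (j + 1) x = Sm (blockLen α n) (gaussMap^[2 * blockLen α n * j] x) := by
  unfold blockSum Sm
  rw [sum_Icc_one]
  refine Finset.sum_congr rfl fun i _ => ?_
  rw [← Function.iterate_add_apply]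
  unfold cfRV cfDigit ff
  rw [show 2 * blockLen α n * (j + 1 - 1) + (i + 1) - 1 = i + 2 * blockLen α n * j by
    rw [Nat.add_sub_cancel]; omega]

lemma W_eq (α : ℝ) (n : ℕ) (h : 0 < sdev (blockLen α n)) (x : ℝ) :
    Wcf α n x = SS (Xv (blockLen α n) (gN (blockLen α n)) (numBlocks α n) x) /
      √(QQ (Xv (blockLen α n) (gN (blockLen α n)) (numBlocks α n) x)) := by
  unfold Wcf SS QQ Xv gN
  rw [sum_Icc_one, sum_Icc_one]
  simp_rw [block_eq, div_pow]
  rw [← Finset.sum_div, ← Finset.sum_div, Real.sqrt_div' _ (by positivity), Real.sqrt_sq h.le]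
  rw [Fin.sum_univ_eq_sum_range (fun j => Sm (blockLen α n) (gaussMap^[2 * blockLen α n * j] x) - (blockLen α n : ℝ) * μcf),
    Fin.sum_univ_eq_sum_range (fun j => (Sm (blockLen α n) (gaussMap^[2 * blockLen α n * j] x) - (blockLen α n : ℝ) * μcf) ^ 2)]
  rw [div_div_div_cancel_right₀ h.ne']

lemma sandwich (α : ℝ) (n : ℕ) (h : 0 < sdev (blockLen α n)) (t : ℝ) :
    (1 - qq ^ blockLen α n) ^ numBlocks α n * Pr (numBlocks α n) (lawS (blockLen α n) (gN (blockLen α n))) t ≤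
      (gaussMeasure {x | t ≤ Wcf α n x}).toReal ∧
    (gaussMeasure {x | t ≤ Wcf α n x}).toReal ≤
      (1 + 16 * qq ^ blockLen α n) ^ numBlocks α n * Pr (numBlocks α n) (lawS (blockLen α n) (gN (blockLen α n))) t := by
  set m := blockLen α n
  set k := numBlocks α n
  have hq0 : 0 ≤ qq := by unfold qq; norm_num
  have hq1 : qq ≤ 1 := by unfold qq; norm_num
  have hqn : qq ^ m ≤ 1 := pow_le_one₀ hq0 hq1
  have hqn0 : 0 ≤ qq ^ m := pow_nonneg hq0 _
  have hpr := lawS_prob m (gN_meas m)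
  set A : Set (Fin k → ℝ) := {z | t ≤ SS z / √(QQ z)} with hA
  have hAm : MeasurableSet A := measurableSet_le measurable_const (by fun_prop)
  have e1 : ∫⁻ z, A.indicator 1 z ∂(PI k (lawS m (gN m))) = ENNReal.ofReal (Pr k (lawS m (gN m)) t) := by
    rw [lintegral_indicator_one hAm]
    unfold Pr
    rw [ofReal_measureReal]
  have e2 : ∫⁻ x, A.indicator 1 (Xv m (gN m) k x) ∂gaussMeasure =
      ENNReal.ofReal (gaussMeasure {x | t ≤ Wcf α n x}).toReal := by
    have hX := Xv_meas m (gN_meas m) k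
    have : {x | t ≤ Wcf α n x} = (Xv m (gN m) k) ⁻¹' A := by
      ext x
      simp only [Set.mem_ofPred_eq, mem_preimage, hA]
      rw [W_eq α n h x]
    rw [this, ENNReal.ofReal_toReal (measure_ne_top _ _), ← lintegral_indicator_one (hX hAm)]
    rfl
  have hP : 0 ≤ Pr k (lawS m (gN m)) t := measureReal_nonneg
  have hmix := mixing m (gN_meas m) k (F := A.indicator 1) (measurable_one.indicator hAm)
    (fun z => by by_cases hz : z ∈ A <;> simp [hz])
  rw [e1, e2, ← ENNReal.ofReal_pow (by linarith), ← ENNReal.ofReal_pow (by linarith),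
    ← ENNReal.ofReal_mul (by apply pow_nonneg; linarith), ← ENNReal.ofReal_mul (by positivity)] at hmix
  exact ⟨(ENNReal.ofReal_le_ofReal_iff ENNReal.toReal_nonneg).1 hmix.1,
    (ENNReal.ofReal_le_ofReal_iff (by positivity)).1 hmix.2⟩

lemma natpow_top {s : ℝ} (hs : 0 < s) : Tendsto (fun n : ℕ => (n:ℝ) ^ s) atTop atTop :=
  (tendsto_rpow_atTop hs).comp tendsto_natCast_atTop_atTop

lemma len_top {α : ℝ} (h0 : 0 < α) : Tendsto (blockLen α) atTop atTop :=
  tendsto_nat_floor_atTop.comp (natpow_top h0)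

lemma num_ge {α : ℝ} (h0 : 0 < α) (h1 : α < 1) :
    ∀ᶠ n : ℕ in atTop, (n:ℝ) ^ (1 - α) / 4 ≤ numBlocks α n := by
  filter_upwards [(natpow_top (show 0 < 1 - α by linarith)).eventually_ge_atTop 4, eventually_ge_atTop 1,
    (len_top h0).eventually_ge_atTop 1] with n hn hn1 hm
  have hn0 : (0:ℝ) < n := by exact_mod_cast hn1
  have hm0 : (0:ℝ) < blockLen α n := by exact_mod_cast hm
  have hle : (blockLen α n : ℝ) ≤ (n:ℝ) ^ α := Nat.floor_le (by positivity)
  have hk : n < (numBlocks α n + 1) * (2 * blockLen α n) := by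
    unfold numBlocks
    have := Nat.lt_mul_div_succ n (show 0 < 2 * blockLen α n by omega)
    linarith [this]
  have hk' : (n:ℝ) < (numBlocks α n + 1) * (2 * blockLen α n) := by exact_mod_cast hk
  have hpos : (0:ℝ) < (n:ℝ) ^ α := by positivity
  have e : (n:ℝ) = (n:ℝ) ^ (1 - α) * (n:ℝ) ^ α := by
    rw [← Real.rpow_add hn0]; simp
  have h3 : (n:ℝ) ^ (1 - α) * (n:ℝ) ^ α < (numBlocks α n + 1) * 2 * (n:ℝ) ^ α := by
    rw [← e]
    refine hk'.trans_le ?_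
    rw [← mul_assoc]
    gcongr
  have h4 := lt_of_mul_lt_mul_right h3 hpos.le
  linarith

lemma num_top {α : ℝ} (h0 : 0 < α) (h1 : α < 1) : Tendsto (numBlocks α) atTop atTop := by
  rw [← tendsto_natCast_atTop_iff (R := ℝ)]
  refine tendsto_atTop_mono' _ (num_ge h0 h1) ?_
  exact (natpow_top (show 0 < 1 - α by linarith)).atTop_div_const (by norm_num)

lemma kq_lim {α : ℝ} (h0 : 0 < α) : Tendsto (fun n => (numBlocks α n : ℝ) * qq ^ blockLen α n) atTop (nhds 0) := by
  have hq0 : 0 < qq := by unfold qq; norm_num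
  have hq1 : qq < 1 := by unfold qq; norm_num
  have hb : 0 < - Real.log qq := by have := Real.log_neg hq0 hq1; linarith
  have hl := ((tendsto_rpow_mul_exp_neg_mul_atTop_nhds_zero (1 / α) _ hb).comp (natpow_top h0)).const_mul qq⁻¹
  rw [mul_zero] at hl
  refine squeeze_zero (fun n => by positivity) (fun n => ?_) hl
  simp only [Function.comp]
  have e : ((n:ℝ) ^ α) ^ (1 / α) = n := by
    rw [← Real.rpow_mul (by positivity)]
    rw [mul_one_div_cancel h0.ne', Real.rpow_one]
  rw [e]
  have h1 : qq ^ blockLen α n ≤ qq⁻¹ * Real.exp (- -Real.log qq * (n:ℝ) ^ α) := by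
    have e2 : qq⁻¹ * Real.exp (- -Real.log qq * (n:ℝ) ^ α) = qq ^ ((n:ℝ) ^ α - 1) := by
      rw [neg_neg, Real.rpow_def_of_pos hq0, mul_sub, mul_one, Real.exp_sub, Real.exp_log hq0]
      field_simp
    rw [e2, ← Real.rpow_natCast]
    apply Real.rpow_le_rpow_of_exponent_ge hq0 hq1.le
    have := Nat.lt_floor_add_one ((n:ℝ) ^ α)
    unfold blockLen
    linarith
  have h2 : (numBlocks α n : ℝ) ≤ n := by
    exact_mod_cast Nat.div_le_self _ _
  calc _ ≤ (n:ℝ) * (qq⁻¹ * Real.exp (- -Real.log qq * (n:ℝ) ^ α)) := by gcongr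
    _ = _ := by ring

lemma t_lim {α ρ : ℝ} (h0 : 0 < α) (h1 : α < 1) (hρ : 0 < ρ) {t : ℕ → ℝ} (ht : ∀ n, 0 ≤ t n)
    (ho : t =o[atTop] fun n => (n : ℝ) ^ ((1 - α) * ρ / (4 + 2 * ρ))) :
    Tendsto (fun n => (numBlocks α n : ℝ) * (t n / √(numBlocks α n : ℝ)) ^ (2 + ρ)) atTop (nhds 0) := by
  set e : ℝ := ρ / (4 + 2 * ρ) with he
  have he0 : 0 < e := by positivity
  have hl := ho.tendsto_div_nhds_zero
  have hl2 := (hl.mul_const ((4:ℝ) ^ e)).rpow_const (p := 2 + ρ) (Or.inr (by linarith))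
  rw [zero_mul, Real.zero_rpow (by linarith)] at hl2
  refine squeeze_zero' (Eventually.of_forall fun n => ?_) ?_ hl2
  · have := ht n; positivity
  filter_upwards [num_ge h0 h1, eventually_ge_atTop 1, (num_top h0 h1).eventually_ge_atTop 1] with n hk hn hk1
  have hn0 : (0:ℝ) < n := by exact_mod_cast hn
  have hk0 : (0:ℝ) < numBlocks α n := by exact_mod_cast hk1
  have htn := ht n
  have e1 : (numBlocks α n : ℝ) * (t n / √(numBlocks α n : ℝ)) ^ (2 + ρ) = (t n / (numBlocks α n : ℝ) ^ e) ^ (2 + ρ) := by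
    rw [Real.div_rpow htn (by positivity), Real.div_rpow htn (by positivity), Real.sqrt_eq_rpow, ← Real.rpow_mul hk0.le,
      ← Real.rpow_mul hk0.le]
    have e2 : (numBlocks α n : ℝ) ^ (1 / 2 * (2 + ρ)) = numBlocks α n * (numBlocks α n : ℝ) ^ (e * (2 + ρ)) := by
      nth_rw 2 [← Real.rpow_one (numBlocks α n : ℝ)]
      rw [← Real.rpow_add hk0]; congr 1
      rw [he]; field_simp; ring
    rw [e2]
    have : 0 < (numBlocks α n : ℝ) ^ (e * (2 + ρ)) := by positivity
    field_simp
  rw [e1]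
  apply Real.rpow_le_rpow (by positivity) _ (by linarith)
  have h3 : ((n:ℝ) ^ (1 - α) / 4) ^ e ≤ (numBlocks α n : ℝ) ^ e := Real.rpow_le_rpow (by positivity) hk he0.le
  calc t n / (numBlocks α n : ℝ) ^ e ≤ t n / ((n:ℝ) ^ (1 - α) / 4) ^ e := by gcongr
    _ = _ := by
      rw [Real.div_rpow (by positivity) (by norm_num), ← Real.rpow_mul hn0.le, he, mul_div_assoc]
      field_simp

theorem final (α ρ : ℝ) (hα : α ∈ Set.Ioo (0 : ℝ) 1) (hρ : ρ ∈ Set.Ioo (0 : ℝ) 1) (t : ℕ → ℝ) (ht : ∀ n, 0 ≤ t n)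
    (ho : t =o[atTop] fun n => (n : ℝ) ^ ((1 - α) * ρ / (4 + 2 * ρ))) :
    Tendsto (fun n => (gaussMeasure {x | t n ≤ Wcf α n x}).toReal / (1 - stdGaussCDF (t n))) atTop (nhds 1) := by
  obtain ⟨C, m0, hgood⟩ := good_law (p := 2 + ρ) (by linarith [hρ.1]) (by linarith [hρ.2])
  have hq0 : 0 < qq := by unfold qq; norm_num
  have hq1 : qq < 1 := by unfold qq; norm_num
  set M : ℕ → ℕ := fun n => max m0 (blockLen α n) with hM
  have hcr := iid_cramer (p := 2 + ρ) (C := C) (k := numBlocks α) (ν := fun n => lawS (M n) (gN (M n))) (t := t)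
    (by linarith [hρ.1]) (by linarith [hρ.2]) (num_top hα.1 hα.2)
    (fun n => (hgood (M n) (le_max_left _ _)).2) ht (t_lim hα.1 hα.2 hρ.1 ht ho)
  have hkq := kq_lim hα.1
  have hlow : Tendsto (fun n => (1 - qq ^ blockLen α n) ^ numBlocks α n) atTop (nhds 1) := by
    have h1 : Tendsto (fun n => 1 - (numBlocks α n : ℝ) * qq ^ blockLen α n) atTop (nhds 1) := by
      simpa using hkq.const_sub 1
    refine tendsto_of_tendsto_of_tendsto_of_le_of_le h1 tendsto_const_nhds (fun n => ?_) (fun n => ?_)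
    · have h2 := one_add_mul_le_pow (a := - qq ^ blockLen α n) (by
        have := pow_le_one₀ (n := blockLen α n) hq0.le hq1.le; linarith) (numBlocks α n)
      simp only
      rw [sub_eq_add_neg 1 (qq ^ _)]
      linarith
    · have := pow_le_one₀ (n := blockLen α n) hq0.le hq1.le
      have h3 : 0 ≤ qq ^ blockLen α n := by positivity
      exact pow_le_one₀ (by linarith) (by linarith)
  have hup : Tendsto (fun n => (1 + 16 * qq ^ blockLen α n) ^ numBlocks α n) atTop (nhds 1) := by
    have h1 : Tendsto (fun n => Real.exp (16 * ((numBlocks α n : ℝ) * qq ^ blockLen α n))) atTop (nhds 1) := by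
      have := (Real.continuous_exp.tendsto _).comp (hkq.const_mul 16)
      rw [mul_zero, Real.exp_zero] at this
      exact this
    refine tendsto_of_tendsto_of_tendsto_of_le_of_le tendsto_const_nhds h1 (fun n => ?_) (fun n => ?_)
    · have h3 : 0 ≤ qq ^ blockLen α n := by positivity
      exact one_le_pow₀ (by linarith)
    · have h3 : 0 ≤ qq ^ blockLen α n := by positivity
      simp only
      rw [show 16 * ((numBlocks α n : ℝ) * qq ^ blockLen α n) = numBlocks α n * (16 * qq ^ blockLen α n) by ring,
        Real.exp_nat_mul]
      gcongr
      linarith [Real.add_one_le_exp (16 * qq ^ blockLen α n)]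
  have L := hlow.mul hcr
  have R := hup.mul hcr
  rw [mul_one] at L R
  have hev := (len_top hα.1).eventually_ge_atTop m0
  refine tendsto_of_tendsto_of_tendsto_of_le_of_le' L R ?_ ?_
  · filter_upwards [hev] with n hn
    have hMn : M n = blockLen α n := max_eq_right hn
    have hs := sandwich α n (hgood _ hn).1 (t n)
    have hg := gT_pos (t n)
    rw [hMn, ← mul_div_assoc]
    exact div_le_div_of_nonneg_right hs.1 hg.le
  · filter_upwards [hev] with n hn
    have hMn : M n = blockLen α n := max_eq_right hn
    have hs := sandwich α n (hgood _ hn).1 (t n)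
    have hg := gT_pos (t n)
    rw [hMn, ← mul_div_assoc]
    exact div_le_div_of_nonneg_right hs.2 hg.le

end CMD
end

/-- Corollary 3.2: self-normalized Cramér type moderate deviations for the continued
fraction expansion under the Gauss measure. -/
theorem cramer_moderate_deviation_continued_fraction
    (α ρ : ℝ) (hα : α ∈ Set.Ioo (0 : ℝ) 1) (hρ : ρ ∈ Set.Ioo (0 : ℝ) 1) :
    ∀ t : ℕ → ℝ, (∀ n, 0 ≤ t n) →
      (t =o[atTop] fun n => (n : ℝ) ^ ((1 - α) * ρ / (4 + 2 * ρ))) →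
      Tendsto
        (fun n =>
          (gaussMeasure {x | t n ≤ Wcf α n x}).toReal / (1 - stdGaussCDF (t n)))
        atTop (nhds 1) := by
  intro t ht ho
  exact CMD.final α ρ hα hρ t ht ho

end
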